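/- Let h = 0 and β > β_c, and let P be the g-function from the main theorem (the one with respect to which ν_{β,0}^+ is the unique consistent, almost regular g-measure). Then for every pair of pasts σ, τ ∈ Ω_{<0} and for ν_{β,0}^+-almost every ω ∈ Ω_{<0}, one has ∑_{k=0}^∞ ∑_{a∈{−1,+1}} | P(a | σ_{−∞}^{−(k+1)} ω_{−k}^{−1}) − P(a | τ_{−∞}^{−(k+1)} ω_{−k}^{−1}) |² < ∞, where σ_{−∞}^{−(k+1)} ω_{−k}^{−1} denotes the past that agrees with ω on coordinates −k,…,−1 and with σ on coordinates ≤ −(k+1). -/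

import Mathlib

open MeasureTheory Filter Topology ProbabilityTheory

noncomputable section

/-- Spin value of a Boolean spin: `true ↦ +1`, `false ↦ -1`. -/
def sval (b : Bool) : ℝ := if b then 1 else -1

/-- Two-dimensional spin configurations. -/
abbrev Cfg2 := ℤ × ℤ → Bool

/-- Two-sided sequences over an alphabet `A`. -/
abbrev ZSeq (A : Type*) := ℤ → A

/-- Pasts: index `k` corresponds to the coordinate `-(k+1)`. -/
abbrev Past (A : Type*) := ℕ → A

/-- The four nearest neighbours of a site of `ℤ²`. -/
def nbrs (x : ℤ × ℤ) : Finset (ℤ × ℤ) :=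
  {(x.1 + 1, x.2), (x.1 - 1, x.2), (x.1, x.2 + 1), (x.1, x.2 - 1)}

/-- Boltzmann weight
`exp(β[Σ_{{x,y}⊆Λ, x∼y} ω_x ω_y + Σ_{x∈Λ, y∉Λ, x∼y} ω_x σ_y] − h Σ_{x∈Λ} ω_x)`
(the sum over unordered pairs inside `Λ` is written as half the ordered sum). -/
def isingWeight (β h : ℝ) (Λ : Finset (ℤ × ℤ)) (σ ω : Cfg2) : ℝ :=
  Real.exp (β * ((∑ x ∈ Λ, ∑ y ∈ Λ.filter (fun y => y ∈ nbrs x),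
        sval (ω x) * sval (ω y)) / 2
      + ∑ x ∈ Λ, ∑ y ∈ (nbrs x).filter (fun y => y ∉ Λ), sval (ω x) * sval (σ y))
    - h * ∑ x ∈ Λ, sval (ω x))

/-- Fill in the values `τ` inside `Λ` and `σ` outside. -/
def fill (Λ : Finset (ℤ × ℤ)) (σ : Cfg2) (τ : ↥Λ → Bool) : Cfg2 :=
  fun x => if hx : x ∈ Λ then τ ⟨x, hx⟩ else σ x

/-- The finite-volume Ising measure in `Λ` with boundary condition `σ`, viewed as a measure on
the full configuration space, the spins outside `Λ` being frozen to `σ`. -/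
def isingFV (β h : ℝ) (Λ : Finset (ℤ × ℤ)) (σ : Cfg2) : Measure Cfg2 :=
  (∑ τ : ↥Λ → Bool, ENNReal.ofReal (isingWeight β h Λ σ (fill Λ σ τ)))⁻¹ •
    ∑ τ : ↥Λ → Bool,
      ENNReal.ofReal (isingWeight β h Λ σ (fill Λ σ τ)) • Measure.dirac (fill Λ σ τ)

/-- The box `[-n,n]²`. -/
def box (n : ℕ) : Finset (ℤ × ℤ) :=
  (Finset.Icc (-(n : ℤ)) (n : ℤ)) ×ˢ (Finset.Icc (-(n : ℤ)) (n : ℤ))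

/-- Convergence of a sequence of measures on a product space in the sense of convergence of the
measures of all finite-dimensional cylinder events; for probability measures on `{−1,+1}^ι`
this is exactly weak convergence. -/
def CylTendsto {ι A : Type*} [MeasurableSpace A] (μs : ℕ → Measure (ι → A))
    (μ : Measure (ι → A)) : Prop :=
  ∀ (s : Finset ι) (f : ι → A),
    Tendsto (fun n => μs n {η | ∀ i ∈ s, η i = f i}) atTop (𝓝 (μ {η | ∀ i ∈ s, η i = f i}))

/-- `μ` is the plus phase `μ_{β,h}^+`: the weak limit of the finite-volume Ising measures on
`[-n,n]²` with all-plus boundary conditions. -/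
def IsPlusPhase (β h : ℝ) (μ : Measure Cfg2) : Prop :=
  IsProbabilityMeasure μ ∧ CylTendsto (fun n => isingFV β h (box n) (fun _ => true)) μ

/-- `μ` is the minus phase `μ_{β,h}^-`. -/
def IsMinusPhase (β h : ℝ) (μ : Measure Cfg2) : Prop :=
  IsProbabilityMeasure μ ∧ CylTendsto (fun n => isingFV β h (box n) (fun _ => false)) μ

/-- The critical inverse temperature `β_c = ln(1+√2)/2`. -/
def betaCrit : ℝ := Real.log (1 + Real.sqrt 2) / 2

/-- Projection of a two-dimensional configuration onto the line `ℤ × {0}`. -/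
def lineProj (η : Cfg2) : ZSeq Bool := fun i => η (i, 0)

/-- The Schonmann projection of a measure on `{−1,+1}^{ℤ²}`. -/
def schonmann (μ : Measure Cfg2) : Measure (ZSeq Bool) := μ.map lineProj

/-- Restriction of a two-sided sequence to its strict past; index `k` is coordinate `-(k+1)`. -/
def restrictPast {A : Type*} (ω : ZSeq A) : Past A := fun k => ω (-(k + 1 : ℤ))

/-- The shift on two-sided sequences. -/
def shiftSeq {A : Type*} : ZSeq A → ZSeq A := fun ω i => ω (i + 1)

/-- The σ-algebra `ℱ_{<0}` generated by the coordinates of negative index. -/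
def pastSigma (A : Type*) [MeasurableSpace A] : MeasurableSpace (ZSeq A) :=
  MeasurableSpace.comap (fun ω : ZSeq A => restrictPast ω) inferInstance

/-- The σ-algebra generated by the coordinates in `S`. -/
def sigmaOn {ι A : Type*} [MeasurableSpace A] (S : Set ι) : MeasurableSpace (ι → A) :=
  MeasurableSpace.comap (fun ω : ι → A => S.restrict ω) inferInstance

/-- A g-function on the alphabet `A`: measurable, `[0,1]`-valued, normalized. -/
def IsGFunction {A : Type*} [Fintype A] [MeasurableSpace A] (P : A → Past A → ℝ) : Prop :=
  (∀ a, Measurable (P a)) ∧ ∀ ω, (∑ a : A, P a ω) = 1 ∧ ∀ a, P a ω ∈ Set.Icc (0 : ℝ) 1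

/-- `μ` is a translation-invariant g-measure consistent with the g-function `P`: for each `a`,
`ω ↦ P a (restrictPast ω)` is a version of the conditional probability `μ(X₀ = a | ℱ_{<0})`. -/
def IsGMeasure {A : Type*} [MeasurableSpace A] (μ : Measure (ZSeq A))
    (P : A → Past A → ℝ) : Prop :=
  IsProbabilityMeasure μ ∧ μ.map shiftSeq = μ ∧
    ∀ a : A, (fun ω => P a (restrictPast ω))
      =ᵐ[μ] μ[Set.indicator {ω : ZSeq A | ω 0 = a} (fun _ => (1 : ℝ)) | pastSigma A]

/-- The `k`-th variation of a g-function: the supremum of `|P a ω − P a σ|` over pasts agreeing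
on the coordinates `−k,…,−1`. -/
def varG {A : Type*} (P : A → Past A → ℝ) (k : ℕ) : ℝ :=
  sSup {d : ℝ | ∃ (a : A) (ω σ' : Past A), (∀ j < k, ω j = σ' j) ∧ d = |P a ω - P a σ'|}

/-- Elementary conditional probability `μ(B | A)`, as a real number. -/
def condProbR {X : Type*} [MeasurableSpace X] (μ : Measure X) (B A : Set X) : ℝ :=
  ((μ[|A]) B).toReal

/-- The event that `η_i = ω` (suitably reindexed) for `−n ≤ i ≤ −1` and `η_i = b`
for `−(n+l) ≤ i ≤ −(n+1)`. -/
def pastEvt (n l : ℕ) (b : Bool) (ω : Past Bool) : Set (ZSeq Bool) :=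
  {η | (∀ i : ℤ, -(n : ℤ) ≤ i → i ≤ -1 → η i = ω (i.natAbs - 1)) ∧
       (∀ i : ℤ, -((n : ℤ) + l) ≤ i → i ≤ -((n : ℤ) + 1) → η i = b)}

/-- The event that `η_i = b` for `−(n+l) ≤ i ≤ −n`. -/
def blockEvt (n l : ℕ) (b : Bool) : Set (ZSeq Bool) :=
  {η | ∀ i : ℤ, -((n : ℤ) + l) ≤ i → i ≤ -(n : ℤ) → η i = b}

/-- The event that `η_i = b` for `−n ≤ i ≤ −1`. -/
def allBlock (n : ℕ) (b : Bool) : Set (ZSeq Bool) :=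
  {η | ∀ i : ℤ, -(n : ℤ) ≤ i → i ≤ -1 → η i = b}

/-- `P` is the g-function `P^{+,b}` obtained from `ν` by conditioning on the symbol `b`
in the far past: `P(a|ω) = lim_n lim_l ν(η₀ = a | η = b on [−(n+l),−(n+1)], η = ω on [−n,−1])`,
both iterated limits being required to exist. -/
def IsCondG (ν : Measure (ZSeq Bool)) (b : Bool) (P : Bool → Past Bool → ℝ) : Prop :=
  ∀ (a : Bool) (ω : Past Bool), ∃ L : ℕ → ℝ,
    (∀ n, Tendsto (fun l => condProbR ν {η | η 0 = a} (pastEvt n l b ω)) atTop (𝓝 (L n))) ∧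
    Tendsto L atTop (𝓝 (P a ω))

/-- `ν'` is the iterated weak limit `lim_n lim_l ν( · | η = b on [−(n+l),−n])`. -/
def IsCondLimitMeasure (ν : Measure (ZSeq Bool)) (b : Bool) (ν' : Measure (ZSeq Bool)) : Prop :=
  ∃ νseq : ℕ → Measure (ZSeq Bool),
    (∀ n, CylTendsto (fun l => ν[|blockEvt n l b]) (νseq n)) ∧ CylTendsto νseq ν'

/-- Stochastic domination: `ν ≤ μ` iff `ν B ≤ μ B` for every increasing measurable event `B`. -/
def StochDom {A : Type*} [MeasurableSpace A] [Preorder A]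
    (ν μ : Measure (ZSeq A)) : Prop :=
  ∀ B : Set (ZSeq A), MeasurableSet B → (∀ ⦃x y : ZSeq A⦄, x ≤ y → x ∈ B → y ∈ B) → ν B ≤ μ B

/-- `π` is the i.i.d. product measure with `π(η_i = +1) = ρ` for each coordinate. -/
def IsBernoulliProd (ρ : ℝ) (π : Measure (ZSeq Bool)) : Prop :=
  IsProbabilityMeasure π ∧ ∀ (s : Finset ℤ) (f : ℤ → Bool),
    π {η | ∀ i ∈ s, η i = f i} = ∏ i ∈ s, ENNReal.ofReal (if f i then ρ else 1 - ρ)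

/-- Splicing of pasts: coordinates `−k,…,−1` (indices `< k`) from `ω`, the rest from `σ`. -/
def splice {A : Type*} (σ ω : Past A) (k : ℕ) : Past A := fun j => if j < k then ω j else σ j

/-- `ν'` is an extreme point of the convex set of g-measures consistent with `P`. -/
def ExtremeGMeasure (ν' : Measure (ZSeq Bool)) (P : Bool → Past Bool → ℝ) : Prop :=
  IsGMeasure ν' P ∧
  ∀ ν₁ ν₂ : Measure (ZSeq Bool), IsGMeasure ν₁ P → IsGMeasure ν₂ P →
    ∀ t : ℝ, t ∈ Set.Ioo (0 : ℝ) 1 →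
      ν' = ENNReal.ofReal t • ν₁ + ENNReal.ofReal (1 - t) • ν₂ → ν₁ = ν' ∧ ν₂ = ν'

/-- The event that the spins on the line are `−1` on `{−m,…,−n} × {0}`. -/
def lineMinusEvt (n m : ℕ) : Set Cfg2 :=
  {η | ∀ i : ℤ, -(m : ℤ) ≤ i → i ≤ -(n : ℤ) → η (i, 0) = false}

/-- Nearest-neighbour adjacency in `ℤ²` (`‖x−y‖₁ = 1`). -/
def adj2 (x y : ℤ × ℤ) : Prop := (x.1 - y.1).natAbs + (x.2 - y.2).natAbs = 1

/-- The event `A_n`: there is an infinite nearest-neighbour path of `+1` spins starting at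
`(n,0)` entirely contained in the half-plane `{x ≤ n}`. -/
def plusPathEvt (n : ℕ) : Set Cfg2 :=
  {η | ∃ γ : ℕ → ℤ × ℤ, γ 0 = ((n : ℤ), 0) ∧ (∀ j, adj2 (γ j) (γ (j + 1))) ∧
    Function.Injective γ ∧ (∀ j, (γ j).1 ≤ (n : ℤ)) ∧ ∀ j, η (γ j) = true}

/-- The block map for the decimation `ν_{l,k}`: the `j`-th letter consists of the spins on
`[j(k+l), j(k+l)+l−1]`. -/
def blockMap (l k : ℕ) (η : ZSeq Bool) : ZSeq (Fin l → Bool) :=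
  fun j r => η (j * ((k : ℤ) + l) + r)

end

namespace Schonmann

open Matrix Finset

section SkewDet

variable {n : Type*} [Fintype n] [DecidableEq n]

theorem dotProduct_mulVec_skew {A : Matrix n n ℝ} (hA : Aᵀ = -A) (x : n → ℝ) :
    x ⬝ᵥ (A *ᵥ x) = 0 := by
  have h : x ⬝ᵥ (A *ᵥ x) = -(x ⬝ᵥ (A *ᵥ x)) := by
    conv_lhs => rw [dotProduct_mulVec, ← mulVec_transpose, hA, neg_mulVec, neg_dotProduct,
      dotProduct_comm]
  linarith

theorem det_one_add_skew_ne_zero {A : Matrix n n ℝ} (hA : Aᵀ = -A) : (1 + A).det ≠ 0 := by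
  intro h
  obtain ⟨v, hv, hv0⟩ := Matrix.exists_mulVec_eq_zero_iff.mpr h
  have : v ⬝ᵥ ((1 + A) *ᵥ v) = v ⬝ᵥ v := by
    rw [add_mulVec, one_mulVec, dotProduct_add, dotProduct_mulVec_skew hA, add_zero]
  rw [hv0, dotProduct_zero] at this
  exact hv (dotProduct_self_eq_zero.mp this.symm)

theorem det_one_add_skew_pos {A : Matrix n n ℝ} (hA : Aᵀ = -A) : 0 < (1 + A).det := by
  by_contra! hneg
  let f : ℝ → ℝ := fun θ => (1 + θ • A).det
  have hf : Continuous f := by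
    refine Continuous.matrix_det ?_
    fun_prop
  have h0 : f 0 = 1 := by simp [f]
  have h1 : f 1 ≤ 0 := by simpa [f] using hneg
  obtain ⟨θ, -, hθ⟩ := intermediate_value_Icc' (zero_le_one) hf.continuousOn
    (show (0 : ℝ) ∈ Set.Icc (f 1) (f 0) from ⟨h1, by rw [h0]; exact zero_le_one⟩)
  exact det_one_add_skew_ne_zero (A := θ • A) (by rw [transpose_smul, hA, smul_neg]) hθ

theorem det_smul_one_add_skew_pos {A : Matrix n n ℝ} (hA : Aᵀ = -A) {s : ℝ} (hs : 0 < s) :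
    0 < (s • (1 : Matrix n n ℝ) + A).det := by
  have : s • (1 : Matrix n n ℝ) + A = s • (1 + s⁻¹ • A) := by
    rw [smul_add, smul_smul, mul_inv_cancel₀ hs.ne', one_smul]
  rw [this, det_smul]
  exact mul_pos (pow_pos hs _)
    (det_one_add_skew_pos (by rw [transpose_smul, hA, smul_neg]))

theorem det_skew_nonneg {A : Matrix n n ℝ} (hA : Aᵀ = -A) : 0 ≤ A.det := by
  have hf : Continuous fun s : ℝ => (s • (1 : Matrix n n ℝ) + A).det := by
    refine Continuous.matrix_det ?_
    fun_prop
  have h := (hf.tendsto 0).mono_left (nhdsWithin_le_nhds (s := Set.Ioi 0))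
  simp only [zero_smul, zero_add] at h
  refine ge_of_tendsto h ?_
  filter_upwards [self_mem_nhdsWithin] with s hs
  exact (det_smul_one_add_skew_pos hA hs).le

/-- Expansion of `det (diag u + diag d * A)` in principal minors of `A`. -/
theorem det_diagonal_add_mul (u d : n → ℝ) (A : Matrix n n ℝ) :
    (diagonal u + diagonal d * A).det = ∑ W : Finset n,
      (∏ i ∈ Wᶜ, u i) * (∏ i ∈ W, d i) *
        (A.submatrix (Subtype.val : W → n) (Subtype.val : W → n)).det := by
  let D := (detRowAlternating : (n → ℝ) [⋀^n]→ₗ[ℝ] ℝ)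
  have h1 : (diagonal u + diagonal d * A).det =
      D ((fun i => (diagonal d * A) i) + fun i => (diagonal u) i) := by
    rw [add_comm]; rfl
  rw [h1, D.map_add_univ]
  refine sum_congr rfl fun W _ => ?_
  have h2 : (W.piecewise (fun i => (diagonal d * A) i) fun i => (diagonal u : Matrix n n ℝ) i) =
      fun i => (if i ∈ W then d i else u i) • (W.piecewise A (1 : Matrix n n ℝ)) i := by
    funext i j
    by_cases hi : i ∈ W
    · simp [Finset.piecewise, hi, diagonal_mul]
    · simp [Finset.piecewise, hi, diagonal_apply, one_apply]
  rw [h2, D.map_smul_univ, prod_ite, smul_eq_mul]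
  have h3 : D (fun i => W.piecewise A (1 : Matrix n n ℝ) i) =
      (A.submatrix (Subtype.val : W → n) (Subtype.val : W → n)).det :=
    det_piecewise_one_eq_submatrix_det A W
  rw [h3, mul_comm (∏ i ∈ Wᶜ, u i)]
  congr 2
  · congr 1; simp
  · congr 1; ext; simp

theorem transpose_submatrix_skew {m : Type*} {A : Matrix n n ℝ} (hA : Aᵀ = -A) (f : m → n) :
    (A.submatrix f f)ᵀ = -(A.submatrix f f) := by
  ext i j
  exact congrFun (congrFun hA (f i)) (f j)

theorem abs_det_diagonal_add_mul_le {A : Matrix n n ℝ} (hA : Aᵀ = -A) {u d : n → ℝ}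
    (hu : ∀ i, 0 ≤ u i) (hd : ∀ i, |d i| ≤ 1) :
    |(diagonal u + diagonal d * A).det| ≤ (diagonal u + A).det := by
  have h1 : diagonal u + A = diagonal u + diagonal (fun _ => (1 : ℝ)) * A := by
    rw [diagonal_one, one_mul]
  rw [h1, det_diagonal_add_mul, det_diagonal_add_mul]
  refine (abs_sum_le_sum_abs _ _).trans (sum_le_sum fun W _ => ?_)
  have hm := det_skew_nonneg (transpose_submatrix_skew hA (Subtype.val : W → n))
  rw [abs_mul, abs_mul, abs_of_nonneg hm, abs_of_nonneg (prod_nonneg fun i _ => hu i),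
    abs_prod, prod_const_one]
  have : ∏ i ∈ W, |d i| ≤ 1 := prod_le_one (fun i _ => abs_nonneg _) fun i _ => hd i
  have h0 : 0 ≤ ∏ i ∈ Wᶜ, u i := prod_nonneg fun i _ => hu i
  gcongr

end SkewDet

end Schonmann

namespace Schonmann

open Matrix Finset

section Sources

variable {n : Type*} [Fintype n] [DecidableEq n]

/-- Coupling `E` extra sources to a skew matrix: the bordered determinant. -/
theorem det_bordered {E : Type*} [Fintype E] [DecidableEq E] (A : Matrix n n ℝ) (Y : Matrix n E ℝ)
    (J : Matrix E E ℝ) (u : ℝ) (d : n → ℝ)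
    (hX : (u • (1 : Matrix n n ℝ) + diagonal d * A).det ≠ 0) :
    (diagonal (Sum.elim (fun _ : n => u) (fun _ : E => 0)) +
      diagonal (Sum.elim d fun _ => 1) * fromBlocks A Y (-Yᵀ) J).det =
    (u • (1 : Matrix n n ℝ) + diagonal d * A).det *
      (J + Yᵀ * ((u • (1 : Matrix n n ℝ) + diagonal d * A)⁻¹ * diagonal d) * Y).det := by
  have h1 : diagonal (Sum.elim (fun _ : n => u) (fun _ : E => 0)) +
      diagonal (Sum.elim d fun _ => 1) * fromBlocks A Y (-Yᵀ) J =
      fromBlocks (u • (1 : Matrix n n ℝ) + diagonal d * A) (diagonal d * Y) (-Yᵀ) J := by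
    ext (i | i) (j | j)
    · simp [diagonal_mul, diagonal_apply, one_apply]
    · simp [diagonal_mul]
    · simp [diagonal_mul]
    · simp [diagonal_mul, diagonal_apply]
  let : Invertible (u • (1 : Matrix n n ℝ) + diagonal d * A) :=
    invertibleOfIsUnitDet _ (isUnit_iff_ne_zero.mpr hX)
  rw [h1, det_fromBlocks₁₁, invOf_eq_nonsing_inv]
  congr 2
  rw [Matrix.neg_mul, Matrix.neg_mul, sub_neg_eq_add]
  simp only [Matrix.mul_assoc]

theorem abs_det_bordered_le {E : Type*} [Fintype E] [DecidableEq E] {A : Matrix n n ℝ}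
    (hA : Aᵀ = -A) (Y : Matrix n E ℝ)
    {J : Matrix E E ℝ} (hJ : Jᵀ = -J) {u : ℝ} (hu : 0 ≤ u) {d : n → ℝ} (hd : ∀ i, |d i| ≤ 1) :
    |(diagonal (Sum.elim (fun _ : n => u) (fun _ : E => 0)) +
      diagonal (Sum.elim d fun _ => 1) * fromBlocks A Y (-Yᵀ) J).det| ≤
    (diagonal (Sum.elim (fun _ : n => u) (fun _ : E => 0)) +
      diagonal (Sum.elim (fun _ => 1) fun _ => 1) * fromBlocks A Y (-Yᵀ) J).det := by
  have hF : (fromBlocks A Y (-Yᵀ) J)ᵀ = -(fromBlocks A Y (-Yᵀ) J) := by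
    rw [fromBlocks_transpose, fromBlocks_neg, hA, hJ, transpose_neg, transpose_transpose, neg_neg]
  have h1 : (diagonal (Sum.elim (fun _ : n => (1 : ℝ)) fun _ : E => (1 : ℝ))) = 1 := by
    ext (i | i) (j | j) <;> simp [diagonal_apply, one_apply]
  rw [h1, Matrix.one_mul]
  refine abs_det_diagonal_add_mul_le hF ?_ ?_
  · rintro (i | i) <;> simp [hu]
  · rintro (i | i) <;> simp [hd]

theorem abs_det_source_le {E : Type*} [Fintype E] [DecidableEq E] {A : Matrix n n ℝ}
    (hA : Aᵀ = -A) (Y : Matrix n E ℝ)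
    {J : Matrix E E ℝ} (hJ : Jᵀ = -J) {u : ℝ} (hu : 0 < u) {d : n → ℝ} (hd : ∀ i, |d i| ≤ 1)
    (hX : (u • (1 : Matrix n n ℝ) + diagonal d * A).det ≠ 0) :
    |(u • (1 : Matrix n n ℝ) + diagonal d * A).det *
      (J + Yᵀ * ((u • (1 : Matrix n n ℝ) + diagonal d * A)⁻¹ * diagonal d) * Y).det| ≤
    (u • (1 : Matrix n n ℝ) + A).det * (J + Yᵀ * (u • (1 : Matrix n n ℝ) + A)⁻¹ * Y).det := by
  have h := abs_det_bordered_le hA Y hJ hu.le hd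
  have hp := det_smul_one_add_skew_pos hA hu
  rw [det_bordered A Y J u d hX, det_bordered A Y J u (fun _ => 1)
    (by rw [diagonal_one, Matrix.one_mul]; exact hp.ne'), diagonal_one, Matrix.one_mul,
    Matrix.mul_one] at h
  exact h

end Sources

section Kappa

variable {n : Type*} [Fintype n] [DecidableEq n]

theorem mul_mulVec_one_source (B : Matrix n n ℝ) (y : n → ℝ) :
    ((0 : Matrix Unit Unit ℝ) + (replicateCol Unit y)ᵀ * B * replicateCol Unit y).det =
      y ⬝ᵥ (B *ᵥ y) := by
  rw [det_unique, zero_add, Matrix.mul_assoc]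
  simp [Matrix.mul_apply, dotProduct, mulVec]

theorem mul_mulVec_two_source (B : Matrix n n ℝ) (y z : n → ℝ) (e : ℝ) :
    ((!![0, e; -e, 0] : Matrix (Fin 2) (Fin 2) ℝ) +
      (Matrix.of fun i (j : Fin 2) => if j = 0 then y i else z i)ᵀ * B *
        (Matrix.of fun i (j : Fin 2) => if j = 0 then y i else z i)).det =
      (y ⬝ᵥ (B *ᵥ y)) * (z ⬝ᵥ (B *ᵥ z)) - (y ⬝ᵥ (B *ᵥ z)) * (z ⬝ᵥ (B *ᵥ y)) + e ^ 2
        + e * (y ⬝ᵥ (B *ᵥ z) - z ⬝ᵥ (B *ᵥ y)) := by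
  rw [det_fin_two, Matrix.mul_assoc]
  simp [Matrix.mul_apply, dotProduct, mulVec]
  ring

theorem dotProduct_self_nonneg' (x : n → ℝ) : 0 ≤ x ⬝ᵥ x :=
  Finset.sum_nonneg fun i _ => mul_self_nonneg (x i)

theorem two_mul_abs_dotProduct_le (x y : n → ℝ) : 2 * |x ⬝ᵥ y| ≤ x ⬝ᵥ x + y ⬝ᵥ y := by
  have h1 := dotProduct_self_nonneg' (x + y)
  have h2 := dotProduct_self_nonneg' (x - y)
  simp only [add_dotProduct, dotProduct_add, sub_dotProduct, dotProduct_sub] at h1 h2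
  rw [dotProduct_comm y x] at h1 h2
  rcases abs_cases (x ⬝ᵥ y) with ⟨h, -⟩ | ⟨h, -⟩ <;> rw [h] <;> linarith

theorem sq_dotProduct_le (x y : n → ℝ) : (x ⬝ᵥ y) ^ 2 ≤ (x ⬝ᵥ x) * (y ⬝ᵥ y) := by
  simp only [dotProduct, ← pow_two]
  exact Finset.sum_mul_sq_le_sq_mul_sq _ _ _

theorem norm_smul_one_add_skew {A : Matrix n n ℝ} (hA : Aᵀ = -A) (u : ℝ) (x : n → ℝ) :
    ((u • (1 : Matrix n n ℝ) + A) *ᵥ x) ⬝ᵥ ((u • (1 : Matrix n n ℝ) + A) *ᵥ x) =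
      u ^ 2 * (x ⬝ᵥ x) + (A *ᵥ x) ⬝ᵥ (A *ᵥ x) := by
  have h := dotProduct_mulVec_skew hA x
  simp only [add_mulVec, smul_mulVec, one_mulVec, add_dotProduct, dotProduct_add, smul_dotProduct,
    dotProduct_smul, smul_eq_mul, h, dotProduct_comm (A *ᵥ x) x]
  ring

theorem dotProduct_inv_mulVec {A : Matrix n n ℝ} (hA : Aᵀ = -A) {u : ℝ} (hu : 0 < u) (y : n → ℝ) :
    y ⬝ᵥ ((u • (1 : Matrix n n ℝ) + A)⁻¹ *ᵥ y) =
      u * (((u • (1 : Matrix n n ℝ) + A)⁻¹ *ᵥ y) ⬝ᵥ ((u • (1 : Matrix n n ℝ) + A)⁻¹ *ᵥ y)) := by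
  set z := (u • (1 : Matrix n n ℝ) + A)⁻¹ *ᵥ y
  have hz : (u • (1 : Matrix n n ℝ) + A) *ᵥ z = y := by
    rw [mulVec_mulVec, mul_nonsing_inv _
      (isUnit_iff_ne_zero.mpr (det_smul_one_add_skew_pos hA hu).ne'), one_mulVec]
  rw [← hz, add_mulVec, add_dotProduct, dotProduct_comm (A *ᵥ z), dotProduct_mulVec_skew hA,
    smul_mulVec, one_mulVec, smul_dotProduct, add_zero, smul_eq_mul]

theorem norm_inv_mulVec_le {A : Matrix n n ℝ} (hA : Aᵀ = -A) {u : ℝ} (hu : 1 ≤ u) (y : n → ℝ) :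
    ((u • (1 : Matrix n n ℝ) + A)⁻¹ *ᵥ y) ⬝ᵥ ((u • (1 : Matrix n n ℝ) + A)⁻¹ *ᵥ y) ≤ y ⬝ᵥ y := by
  set z := (u • (1 : Matrix n n ℝ) + A)⁻¹ *ᵥ y
  have hz : (u • (1 : Matrix n n ℝ) + A) *ᵥ z = y := by
    rw [mulVec_mulVec, mul_nonsing_inv _
      (isUnit_iff_ne_zero.mpr (det_smul_one_add_skew_pos hA (by linarith)).ne'), one_mulVec]
  have h := norm_smul_one_add_skew hA u z
  rw [hz] at h
  have h1 := dotProduct_self_nonneg' (A *ᵥ z)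
  have h2 := dotProduct_self_nonneg' z
  nlinarith [mul_nonneg h2 (by nlinarith : (0 : ℝ) ≤ u ^ 2 - 1)]

theorem abs_dotProduct_inv_mulVec_le {A : Matrix n n ℝ} (hA : Aᵀ = -A) {u : ℝ} (hu : 1 ≤ u)
    (x y : n → ℝ) :
    (x ⬝ᵥ ((u • (1 : Matrix n n ℝ) + A)⁻¹ *ᵥ y)) ^ 2 ≤ (x ⬝ᵥ x) * (y ⬝ᵥ y) := by
  refine (sq_dotProduct_le _ _).trans ?_
  exact mul_le_mul_of_nonneg_left (norm_inv_mulVec_le hA hu y) (dotProduct_self_nonneg' x)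

/-- The bilinear form `(det X_d / det X_1) yᵀ X_d⁻¹ d z` is bounded, uniformly. -/
theorem abs_kappa_le {A : Matrix n n ℝ} (hA : Aᵀ = -A) {u : ℝ} (hu : 1 ≤ u) {d : n → ℝ}
    (hd : ∀ i, |d i| ≤ 1) (hX : (u • (1 : Matrix n n ℝ) + diagonal d * A).det ≠ 0)
    (y z : n → ℝ) :
    4 * |(u • (1 : Matrix n n ℝ) + diagonal d * A).det *
      (y ⬝ᵥ (((u • (1 : Matrix n n ℝ) + diagonal d * A)⁻¹ * diagonal d) *ᵥ z))| ≤
    5 * ((u • (1 : Matrix n n ℝ) + A).det * (y ⬝ᵥ y + z ⬝ᵥ z)) := by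
  have hu0 : 0 < u := by linarith
  set p := (u • (1 : Matrix n n ℝ) + A).det with hp
  set q := (u • (1 : Matrix n n ℝ) + diagonal d * A).det with hq
  set K := (u • (1 : Matrix n n ℝ) + diagonal d * A)⁻¹ * diagonal d with hK
  have hp0 : 0 < p := det_smul_one_add_skew_pos hA hu0
  have hdiag : ∀ w : n → ℝ, |q * (w ⬝ᵥ (K *ᵥ w))| ≤ p * (w ⬝ᵥ w) := by
    intro w
    have h := abs_det_source_le hA (replicateCol Unit w) (J := 0) (by simp) hu0 hd hX
    rw [mul_mulVec_one_source, mul_mulVec_one_source] at h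
    refine h.trans (mul_le_mul_of_nonneg_left ?_ hp0.le)
    have h1 := abs_dotProduct_inv_mulVec_le hA hu w w
    rw [← pow_two] at h1
    exact (abs_le_of_sq_le_sq' h1 (dotProduct_self_nonneg' w)).2
  set e := y ⬝ᵥ y + z ⬝ᵥ z with he
  have hy0 := dotProduct_self_nonneg' y
  have hz0 := dotProduct_self_nonneg' z
  have he0 : 0 ≤ e := add_nonneg hy0 hz0
  have hsym : 2 * |q * (y ⬝ᵥ (K *ᵥ z) + z ⬝ᵥ (K *ᵥ y))| ≤ 2 * (p * e) := by
    have h1 := hdiag (y + z)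
    have h2 := hdiag (y - z)
    have hzy : z ⬝ᵥ y = y ⬝ᵥ z := dotProduct_comm _ _
    simp only [mulVec_add, mulVec_sub, add_dotProduct, dotProduct_add, sub_dotProduct,
      dotProduct_sub, hzy] at h1 h2
    rw [abs_le] at h1 h2
    rcases abs_cases (q * (y ⬝ᵥ (K *ᵥ z) + z ⬝ᵥ (K *ᵥ y))) with ⟨h, -⟩ | ⟨h, -⟩ <;>
      rw [h, he] <;> nlinarith
  have hanti : 2 * |q * (y ⬝ᵥ (K *ᵥ z) - z ⬝ᵥ (K *ᵥ y))| ≤ 3 * (p * e) := by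
    rcases he0.eq_or_lt with he' | he'
    · have hy : y = 0 := dotProduct_self_eq_zero.mp (by linarith)
      have hz : z = 0 := dotProduct_self_eq_zero.mp (by linarith)
      simp [hy, hz, he]
    set G := (u • (1 : Matrix n n ℝ) + A)⁻¹ with hG
    have key : ∀ e' : ℝ, |q * ((y ⬝ᵥ (K *ᵥ y)) * (z ⬝ᵥ (K *ᵥ z)) -
        (y ⬝ᵥ (K *ᵥ z)) * (z ⬝ᵥ (K *ᵥ y)) + e' ^ 2
        + e' * (y ⬝ᵥ (K *ᵥ z) - z ⬝ᵥ (K *ᵥ y)))| ≤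
        p * ((y ⬝ᵥ (G *ᵥ y)) * (z ⬝ᵥ (G *ᵥ z)) - (y ⬝ᵥ (G *ᵥ z)) * (z ⬝ᵥ (G *ᵥ y)) + e' ^ 2
        + e' * (y ⬝ᵥ (G *ᵥ z) - z ⬝ᵥ (G *ᵥ y))) := fun e' => by
      have h := abs_det_source_le hA
        (Matrix.of fun i (j : Fin 2) => if j = 0 then y i else z i) (J := !![0, e'; -e', 0])
        (by ext i j; fin_cases i <;> fin_cases j <;> simp) hu0 hd hX
      rw [mul_mulVec_two_source, mul_mulVec_two_source] at h
      exact h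
    have k1 := key e
    have k2 := key (-e)
    have g1 := abs_dotProduct_inv_mulVec_le hA hu y y
    have g2 := abs_dotProduct_inv_mulVec_le hA hu z z
    have g3 := abs_dotProduct_inv_mulVec_le hA hu y z
    have g4 := abs_dotProduct_inv_mulVec_le hA hu z y
    have gb : (y ⬝ᵥ (G *ᵥ y)) * (z ⬝ᵥ (G *ᵥ z)) - (y ⬝ᵥ (G *ᵥ z)) * (z ⬝ᵥ (G *ᵥ y)) ≤
        e ^ 2 / 2 := by
      have m1 := sq_nonneg (y ⬝ᵥ (G *ᵥ z) + z ⬝ᵥ (G *ᵥ y))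
      have m3 : (y ⬝ᵥ (G *ᵥ y)) * (z ⬝ᵥ (G *ᵥ z)) ≤ (y ⬝ᵥ y) * (z ⬝ᵥ z) := by
        rw [← pow_two] at g1 g2
        have a1 := abs_le_of_sq_le_sq g1 hy0
        have a2 := abs_le_of_sq_le_sq g2 hz0
        calc _ ≤ |y ⬝ᵥ (G *ᵥ y)| * |z ⬝ᵥ (G *ᵥ z)| := by rw [← abs_mul]; exact le_abs_self _
          _ ≤ _ := mul_le_mul a1 a2 (abs_nonneg _) hy0
      have m4 := sq_nonneg (y ⬝ᵥ y - z ⬝ᵥ z)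
      rw [he]
      nlinarith
    have hbound : 2 * (e * |q * (y ⬝ᵥ (K *ᵥ z) - z ⬝ᵥ (K *ᵥ y))|) ≤ 3 * (p * e) * e := by
      have hb : p * ((y ⬝ᵥ (G *ᵥ y)) * (z ⬝ᵥ (G *ᵥ z)) - (y ⬝ᵥ (G *ᵥ z)) * (z ⬝ᵥ (G *ᵥ y))) ≤
        p * (e ^ 2 / 2) := mul_le_mul_of_nonneg_left gb hp0.le
      have e1 : e * |q * (y ⬝ᵥ (K *ᵥ z) - z ⬝ᵥ (K *ᵥ y))| =
          |e * (q * (y ⬝ᵥ (K *ᵥ z) - z ⬝ᵥ (K *ᵥ y)))| := by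
        rw [abs_mul e, abs_of_nonneg he0]
      rw [e1]
      rw [abs_le] at k1 k2
      rcases abs_cases (e * (q * (y ⬝ᵥ (K *ᵥ z) - z ⬝ᵥ (K *ᵥ y)))) with ⟨h, -⟩ | ⟨h, -⟩ <;>
        rw [h] <;> nlinarith
    have : e * (2 * |q * (y ⬝ᵥ (K *ᵥ z) - z ⬝ᵥ (K *ᵥ y))|) ≤ e * (3 * (p * e)) := by linarith
    exact le_of_mul_le_mul_left this he'
  have hsplit : 2 * (q * (y ⬝ᵥ (K *ᵥ z))) = q * (y ⬝ᵥ (K *ᵥ z) + z ⬝ᵥ (K *ᵥ y)) +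
      q * (y ⬝ᵥ (K *ᵥ z) - z ⬝ᵥ (K *ᵥ y)) := by ring
  have := abs_add_le (q * (y ⬝ᵥ (K *ᵥ z) + z ⬝ᵥ (K *ᵥ y)))
    (q * (y ⬝ᵥ (K *ᵥ z) - z ⬝ᵥ (K *ᵥ y)))
  rw [← hsplit, abs_mul, abs_two] at this
  linarith

end Kappa

end Schonmann

namespace Schonmann

open Matrix Finset

section CombesThomas

theorem schur_test {n : Type*} [Fintype n] (B : Matrix n n ℝ) {S : ℝ} (hS : 0 ≤ S)
    (hr : ∀ i, ∑ j, |B i j| ≤ S) (hc : ∀ j, ∑ i, |B i j| ≤ S) (x : n → ℝ) :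
    (B *ᵥ x) ⬝ᵥ (B *ᵥ x) ≤ S ^ 2 * (x ⬝ᵥ x) := by
  have h1 : ∀ i, (B *ᵥ x) i * (B *ᵥ x) i ≤ S * ∑ j, |B i j| * (x j * x j) := by
    intro i
    have hcs := Finset.sum_mul_sq_le_sq_mul_sq univ (fun j => Real.sqrt |B i j|)
      (fun j => Real.sqrt |B i j| * |x j|)
    have ha : ∀ j, Real.sqrt |B i j| * (Real.sqrt |B i j| * |x j|) = |B i j * x j| := fun j => by
      rw [← mul_assoc, Real.mul_self_sqrt (abs_nonneg _), abs_mul]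
    have hb : ∀ j, (Real.sqrt |B i j| * |x j|) ^ 2 = |B i j| * (x j * x j) := fun j => by
      rw [mul_pow, Real.sq_sqrt (abs_nonneg _), sq_abs, pow_two]
    simp only [ha, hb, Real.sq_sqrt (abs_nonneg _)] at hcs
    have h2 : (B *ᵥ x) i * (B *ᵥ x) i ≤ (∑ j, |B i j * x j|) ^ 2 := by
      rw [← pow_two]
      refine sq_le_sq' ?_ ?_
      · exact neg_le.mp ((neg_le_abs _).trans (abs_sum_le_sum_abs _ _))
      · exact (le_abs_self _).trans (abs_sum_le_sum_abs _ _)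
    refine h2.trans (hcs.trans ?_)
    exact mul_le_mul_of_nonneg_right (hr i)
      (sum_nonneg fun j _ => mul_nonneg (abs_nonneg _) (mul_self_nonneg _))
  calc (B *ᵥ x) ⬝ᵥ (B *ᵥ x) ≤ ∑ i, S * ∑ j, |B i j| * (x j * x j) := sum_le_sum fun i _ => h1 i
    _ = S * ∑ j, (∑ i, |B i j|) * (x j * x j) := by
      rw [← mul_sum, sum_comm]; simp only [sum_mul]
    _ ≤ S * ∑ j, S * (x j * x j) := by
      gcongr with j
      · exact mul_self_nonneg _
      · exact hc j
    _ = S ^ 2 * (x ⬝ᵥ x) := by rw [← mul_sum, dotProduct]; ring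

theorem sum_abs_sub_le {f : ℕ → ℝ} (hf : ∀ s, 0 ≤ f s) {T : ℝ} (hT : HasSum f T) {q : ℕ}
    (i : Fin q) : ∑ j : Fin q, f ((i : ℤ) - (j : ℤ)).natAbs ≤ 2 * T := by
  have h1 : ∀ j : Fin q, f ((i : ℤ) - (j : ℤ)).natAbs ≤ f ((i : ℕ) - j) * (if j ≤ i then 1 else 0)
      + f ((j : ℕ) - i) * (if i ≤ j then 1 else 0) := by
    intro j
    rcases le_total j i with h | h
    · have : ((i : ℤ) - (j : ℤ)).natAbs = (i : ℕ) - j := by have := Fin.le_def.mp h; omega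
      rw [this, if_pos h, mul_one]
      have := mul_nonneg (hf ((j : ℕ) - i)) (by split_ifs <;> norm_num : (0 : ℝ) ≤ if i ≤ j then 1 else 0)
      linarith
    · have : ((i : ℤ) - (j : ℤ)).natAbs = (j : ℕ) - i := by have := Fin.le_def.mp h; omega
      rw [this, if_pos h, mul_one]
      have := mul_nonneg (hf ((i : ℕ) - j)) (by split_ifs <;> norm_num : (0 : ℝ) ≤ if j ≤ i then 1 else 0)
      linarith
  refine (sum_le_sum fun j _ => h1 j).trans ?_
  rw [sum_add_distrib, two_mul]
  simp only [mul_ite, mul_one, mul_zero, ← sum_filter]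
  refine add_le_add ?_ ?_
  · have : ∑ j ∈ univ.filter (fun j : Fin q => j ≤ i), f ((i : ℕ) - j) =
        ∑ s ∈ (univ.filter (fun j : Fin q => j ≤ i)).image (fun j : Fin q => (i : ℕ) - (j : ℕ)), f s := by
      rw [sum_image]
      intro a ha b hb hab
      simp only [coe_filter, mem_univ, true_and, Set.mem_ofPred_eq, Fin.le_def] at ha hb
      apply Fin.ext; dsimp at hab; omega
    rw [this]
    exact sum_le_hasSum _ (fun s _ => hf s) hT
  · have : ∑ j ∈ univ.filter (fun j : Fin q => i ≤ j), f ((j : ℕ) - i) =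
        ∑ s ∈ (univ.filter (fun j : Fin q => i ≤ j)).image (fun j : Fin q => (j : ℕ) - (i : ℕ)), f s := by
      rw [sum_image]
      intro a ha b hb hab
      simp only [coe_filter, mem_univ, true_and, Set.mem_ofPred_eq, Fin.le_def] at ha hb
      apply Fin.ext; dsimp at hab; omega
    rw [this]
    exact sum_le_hasSum _ (fun s _ => hf s) hT

/-- Schur test for matrices on `Fin q` dominated by a summable function of `|i - j|`. -/
theorem schur_test_dist {q : ℕ} (B : Matrix (Fin q) (Fin q) ℝ) {f : ℕ → ℝ} (hf : ∀ s, 0 ≤ f s)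
    {T : ℝ} (hT : HasSum f T) (hB : ∀ i j : Fin q, |B i j| ≤ f ((i : ℤ) - (j : ℤ)).natAbs)
    (x : Fin q → ℝ) : (B *ᵥ x) ⬝ᵥ (B *ᵥ x) ≤ (2 * T) ^ 2 * (x ⬝ᵥ x) := by
  have hT0 : 0 ≤ T := hT.nonneg hf
  refine schur_test B (by linarith) (fun i => ?_) (fun j => ?_) x
  · exact (sum_le_sum fun j _ => hB i j).trans (sum_abs_sub_le hf hT i)
  · refine (sum_le_sum fun i _ => hB i j).trans (le_trans (le_of_eq ?_) (sum_abs_sub_le hf hT j))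
    refine sum_congr rfl fun i _ => ?_
    congr 1; omega

/-- Exponential decay of `(u + A)⁻¹ v` beyond position `k`. -/
theorem combes_thomas {ρ lam C₁ C₂ : ℝ} (hρ : 0 ≤ ρ) (hlam : 1 ≤ lam) (hρlam : ρ * lam < 1)
    (hC₁ : 0 ≤ C₁) (hT : 4 * C₁ * ((1 - ρ * lam)⁻¹ - (1 - ρ)⁻¹) ≤ 1)
    {q : ℕ} {A : Matrix (Fin q) (Fin q) ℝ} (hA : Aᵀ = -A)
    (hAd : ∀ i j : Fin q, |A i j| ≤ C₁ * ρ ^ ((i : ℤ) - (j : ℤ)).natAbs)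
    {v : Fin q → ℝ} {V : ℝ} (hV : V ^ 2 ≤ v ⬝ᵥ v)
    (hv : ∀ i : Fin q, |v i| ≤ C₂ * ρ ^ (i : ℕ) * |V|)
    {u : ℝ} (hu : 1 ≤ u) {z : Fin q → ℝ} (hz : (u • (1 : Matrix (Fin q) (Fin q) ℝ) + A) *ᵥ z = v)
    (k : ℕ) :
    lam ^ (2 * k) * ∑ i : Fin q, (if k ≤ (i : ℕ) then z i else 0) ^ 2 ≤
      4 * (C₂ ^ 2 * (1 - (ρ * lam) ^ 2)⁻¹) * (v ⬝ᵥ v) := by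
  have hlam0 : 0 < lam := by linarith
  have hρ1 : ρ < 1 := lt_of_le_of_lt (le_mul_of_one_le_right hρ hlam) hρlam
  set zh : Fin q → ℝ := fun i => lam ^ (i : ℕ) * z i with hzh
  set vh : Fin q → ℝ := fun i => lam ^ (i : ℕ) * v i with hvh
  set B : Matrix (Fin q) (Fin q) ℝ :=
    Matrix.of fun i j => (lam ^ (i : ℕ) * (lam ^ (j : ℕ))⁻¹ - 1) * A i j with hB
  have heq : (u • (1 : Matrix (Fin q) (Fin q) ℝ) + A) *ᵥ zh = vh - B *ᵥ zh := by
    rw [eq_sub_iff_add_eq, ← add_mulVec]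
    funext i
    have := congrFun hz i
    simp only [mulVec, dotProduct, hB, hzh, hvh] at this ⊢
    rw [← this, mul_sum]
    refine sum_congr rfl fun j _ => ?_
    have h0 : (lam ^ (j : ℕ)) ≠ 0 := (pow_pos hlam0 _).ne'
    by_cases hij : i = j
    · subst hij
      simp only [Matrix.add_apply, Matrix.of_apply]
      field_simp
      ring
    · simp only [Matrix.add_apply, Matrix.of_apply, Matrix.smul_apply, Matrix.one_apply_ne hij]
      field_simp
      ring
  have hBd : ∀ i j : Fin q, |B i j| ≤ C₁ * ((ρ * lam) ^ ((i : ℤ) - (j : ℤ)).natAbs -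
      ρ ^ ((i : ℤ) - (j : ℤ)).natAbs) := by
    intro i j
    have h2 : |lam ^ (i : ℕ) * (lam ^ (j : ℕ))⁻¹ - 1| ≤ lam ^ ((i : ℤ) - (j : ℤ)).natAbs - 1 := by
      rcases le_total (j : ℕ) i with h | h
      · have e : ((i : ℤ) - (j : ℤ)).natAbs = (i : ℕ) - j := by omega
        rw [e, pow_sub₀ _ hlam0.ne' h]
        refine le_of_eq (abs_of_nonneg ?_)
        rw [← pow_sub₀ _ hlam0.ne' h]
        exact sub_nonneg.mpr (one_le_pow₀ hlam)
      · have e : ((i : ℤ) - (j : ℤ)).natAbs = (j : ℕ) - i := by omega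
        have e2 : lam ^ (i : ℕ) * (lam ^ (j : ℕ))⁻¹ = (lam ^ ((j : ℕ) - i))⁻¹ := by
          rw [pow_sub₀ _ hlam0.ne' h, mul_inv, inv_inv, mul_comm]
        rw [e, e2]
        have h1 : 1 ≤ lam ^ ((j : ℕ) - i) := one_le_pow₀ hlam
        have h0 : 0 < lam ^ ((j : ℕ) - i) := by linarith
        have h3 : (lam ^ ((j : ℕ) - i))⁻¹ ≤ 1 := inv_le_one_of_one_le₀ h1
        rw [abs_of_nonpos (by linarith)]
        have h4 : (lam ^ ((j : ℕ) - i))⁻¹ * (lam ^ ((j : ℕ) - i)) = 1 := inv_mul_cancel₀ h0.ne'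
        nlinarith [sq_nonneg (lam ^ ((j : ℕ) - i) - 1), inv_pos.mpr h0]
    rw [hB, Matrix.of_apply, abs_mul]
    calc _ ≤ (lam ^ ((i : ℤ) - (j : ℤ)).natAbs - 1) * (C₁ * ρ ^ ((i : ℤ) - (j : ℤ)).natAbs) :=
          mul_le_mul h2 (hAd i j) (abs_nonneg _) ((abs_nonneg _).trans h2)
      _ = _ := by rw [mul_pow]; ring
  have hsum : HasSum (fun s : ℕ => C₁ * ((ρ * lam) ^ s - ρ ^ s))
      (C₁ * ((1 - ρ * lam)⁻¹ - (1 - ρ)⁻¹)) :=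
    ((hasSum_geometric_of_lt_one (by positivity) hρlam).sub
      (hasSum_geometric_of_lt_one hρ hρ1)).mul_left _
  have hf0 : ∀ s : ℕ, 0 ≤ C₁ * ((ρ * lam) ^ s - ρ ^ s) := fun s =>
    mul_nonneg hC₁ (sub_nonneg.mpr (pow_le_pow_left₀ hρ (le_mul_of_one_le_right hρ hlam) s))
  have hBn := schur_test_dist B hf0 hsum hBd zh
  have hN0 := dotProduct_self_nonneg' zh
  have hBn' : (B *ᵥ zh) ⬝ᵥ (B *ᵥ zh) ≤ 1 / 4 * (zh ⬝ᵥ zh) := by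
    refine hBn.trans (mul_le_mul_of_nonneg_right ?_ hN0)
    have hT0 := hsum.nonneg hf0
    nlinarith
  have hskew := norm_smul_one_add_skew hA u zh
  rw [heq] at hskew
  have hpar : (vh - B *ᵥ zh) ⬝ᵥ (vh - B *ᵥ zh) ≤ 2 * (vh ⬝ᵥ vh) + 2 * ((B *ᵥ zh) ⬝ᵥ (B *ᵥ zh)) := by
    have := dotProduct_self_nonneg' (vh + B *ᵥ zh)
    simp only [add_dotProduct, dotProduct_add, sub_dotProduct, dotProduct_sub] at this ⊢
    linarith
  have h4 : zh ⬝ᵥ zh ≤ 4 * (vh ⬝ᵥ vh) := by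
    have h1 := dotProduct_self_nonneg' (A *ᵥ zh)
    nlinarith [mul_nonneg hN0 (by nlinarith : (0 : ℝ) ≤ u ^ 2 - 1)]
  have hvv : vh ⬝ᵥ vh ≤ C₂ ^ 2 * (1 - (ρ * lam) ^ 2)⁻¹ * (v ⬝ᵥ v) := by
    have hx0 : 0 ≤ ρ * lam := by positivity
    have hg : HasSum (fun s : ℕ => C₂ ^ 2 * V ^ 2 * ((ρ * lam) ^ 2) ^ s)
        (C₂ ^ 2 * V ^ 2 * (1 - (ρ * lam) ^ 2)⁻¹) :=
      (hasSum_geometric_of_lt_one (by positivity) (by nlinarith)).mul_left _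
    have hle : vh ⬝ᵥ vh ≤ ∑ i : Fin q, C₂ ^ 2 * V ^ 2 * ((ρ * lam) ^ 2) ^ (i : ℕ) := by
      refine sum_le_sum fun i _ => ?_
      have h1 : |vh i| ≤ lam ^ (i : ℕ) * (C₂ * ρ ^ (i : ℕ) * |V|) := by
        rw [hvh, abs_mul, abs_of_pos (pow_pos hlam0 _)]
        exact mul_le_mul_of_nonneg_left (hv i) (pow_pos hlam0 _).le
      have h2 := pow_le_pow_left₀ (abs_nonneg _) h1 2
      rw [sq_abs, pow_two] at h2
      refine h2.trans (le_of_eq ?_)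
      rw [mul_pow, mul_pow, mul_pow, sq_abs, mul_pow, ← pow_mul, ← pow_mul, mul_pow, ← pow_mul,
        ← pow_mul, mul_comm (i : ℕ) 2]
      ring
    have h1 : ∑ i : Fin q, C₂ ^ 2 * V ^ 2 * ((ρ * lam) ^ 2) ^ (i : ℕ) ≤
        C₂ ^ 2 * V ^ 2 * (1 - (ρ * lam) ^ 2)⁻¹ := by
      rw [Fin.sum_univ_eq_sum_range (fun s => C₂ ^ 2 * V ^ 2 * ((ρ * lam) ^ 2) ^ s)]
      exact sum_le_hasSum _ (fun s _ => by positivity) hg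
    refine hle.trans (h1.trans ?_)
    have : 0 ≤ (1 - (ρ * lam) ^ 2)⁻¹ := inv_nonneg.mpr (by nlinarith)
    calc C₂ ^ 2 * V ^ 2 * (1 - (ρ * lam) ^ 2)⁻¹ = C₂ ^ 2 * (1 - (ρ * lam) ^ 2)⁻¹ * V ^ 2 := by ring
      _ ≤ _ := by gcongr
  have hQ : lam ^ (2 * k) * ∑ i : Fin q, (if k ≤ (i : ℕ) then z i else 0) ^ 2 ≤ zh ⬝ᵥ zh := by
    rw [mul_sum]
    refine sum_le_sum fun i _ => ?_
    split_ifs with h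
    · rw [hzh]
      have : lam ^ (2 * k) ≤ lam ^ (2 * (i : ℕ)) := pow_le_pow_right₀ hlam (by omega)
      calc lam ^ (2 * k) * z i ^ 2 ≤ lam ^ (2 * (i : ℕ)) * z i ^ 2 := by gcongr
        _ = _ := by rw [mul_comm 2, pow_mul]; ring
    · simpa using mul_self_nonneg (zh i)
  linarith

end CombesThomas

end Schonmann

namespace Schonmann

open Matrix Finset

section SourceComparison

theorem exists_rate {ρ C₁ : ℝ} (hρ1 : ρ < 1) :
    ∃ lam : ℝ, 1 < lam ∧ ρ * lam < 1 ∧ 4 * C₁ * ((1 - ρ * lam)⁻¹ - (1 - ρ)⁻¹) ≤ 1 := by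
  have hc : ContinuousAt (fun lam : ℝ => 4 * C₁ * ((1 - ρ * lam)⁻¹ - (1 - ρ)⁻¹)) 1 := by
    have : (1 - ρ * 1) ≠ 0 := by linarith
    fun_prop (disch := assumption)
  have hc2 : ContinuousAt (fun lam : ℝ => ρ * lam) 1 := by fun_prop
  have h1 : ∀ᶠ lam in nhds (1 : ℝ), 4 * C₁ * ((1 - ρ * lam)⁻¹ - (1 - ρ)⁻¹) < 1 :=
    hc.eventually_lt continuousAt_const (by simp)
  have h2 : ∀ᶠ lam in nhds (1 : ℝ), ρ * lam < 1 :=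
    hc2.eventually_lt continuousAt_const (by simpa using hρ1)
  have h3 : ∀ᶠ lam in nhdsWithin (1 : ℝ) (Set.Ioi 1), 1 < lam := self_mem_nhdsWithin
  obtain ⟨lam, h⟩ := ((h1.filter_mono nhdsWithin_le_nhds).and
    ((h2.filter_mono nhdsWithin_le_nhds).and h3)).exists
  exact ⟨lam, h.2.2, h.2.1, h.1.le⟩

variable {n : Type*} [Fintype n] [DecidableEq n]

/-- Resolvent expansion of the sign-modified propagator. -/
theorem dotProduct_modified {A : Matrix n n ℝ} {u : ℝ} {d : n → ℝ} (hd : ∀ i, d i * d i = 1)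
    (hX : (u • (1 : Matrix n n ℝ) + diagonal d * A).det ≠ 0)
    {v z z' : n → ℝ} (hz : (u • (1 : Matrix n n ℝ) + A) *ᵥ z = v)
    (hz' : z' ᵥ* (u • (1 : Matrix n n ℝ) + A) = v) :
    v ⬝ᵥ (((u • (1 : Matrix n n ℝ) + diagonal d * A)⁻¹ * diagonal d) *ᵥ v) =
      v ⬝ᵥ z + u * (z' ⬝ᵥ (diagonal (fun i => 1 - d i) *ᵥ z)) +
      u ^ 2 * ((diagonal (fun i => 1 - d i) *ᵥ z') ⬝ᵥ
        (((u • (1 : Matrix n n ℝ) + diagonal d * A)⁻¹ * diagonal d) *ᵥ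
          (diagonal (fun i => 1 - d i) *ᵥ z))) := by
  set X := u • (1 : Matrix n n ℝ) + diagonal d * A with hXd
  set K := X⁻¹ * diagonal d with hK
  set Q : Matrix n n ℝ := diagonal (fun i => 1 - d i) with hQ
  have hu : IsUnit X.det := isUnit_iff_ne_zero.mpr hX
  have hDD : diagonal d * diagonal d = (1 : Matrix n n ℝ) := by
    rw [diagonal_mul_diagonal]; simp [hd]
  have hQ1 : Q = 1 - diagonal d := by
    rw [hQ, ← diagonal_one, diagonal_sub]
  have hDX : diagonal d * X = u • diagonal d + A := by
    rw [hXd, mul_add, ← Matrix.mul_assoc, hDD, Matrix.one_mul, Matrix.mul_smul, Matrix.mul_one]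
  have hS : u • (1 : Matrix n n ℝ) + A = diagonal d * X + u • Q := by
    rw [hDX, hQ1, smul_sub]; abel
  have h1 : K * (u • (1 : Matrix n n ℝ) + A) = 1 + u • (K * Q) := by
    rw [hS, mul_add, hK, Matrix.mul_assoc, ← Matrix.mul_assoc (diagonal d), hDD, Matrix.one_mul,
      nonsing_inv_mul _ hu, Matrix.mul_smul, Matrix.mul_assoc]
  have h2 : (u • (1 : Matrix n n ℝ) + A) * K = 1 + u • (Q * K) := by
    rw [hS, add_mul, hK, Matrix.mul_assoc, ← Matrix.mul_assoc X, mul_nonsing_inv _ hu,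
      Matrix.one_mul, hDD, Matrix.smul_mul]
  have h3 : K *ᵥ v = z + u • (K *ᵥ (Q *ᵥ z)) := by
    rw [← hz, mulVec_mulVec, h1, add_mulVec, one_mulVec, smul_mulVec, mulVec_mulVec]
  have h4 : ∀ w, v ⬝ᵥ (K *ᵥ w) = z' ⬝ᵥ w + u * ((Q *ᵥ z') ⬝ᵥ (K *ᵥ w)) := by
    intro w
    rw [← hz', ← dotProduct_mulVec, mulVec_mulVec, h2, add_mulVec, one_mulVec, dotProduct_add,
      smul_mulVec, dotProduct_smul, smul_eq_mul, ← mulVec_mulVec]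
    congr 2
    rw [dotProduct_mulVec, ← mulVec_transpose, hQ, diagonal_transpose]
  rw [h3, dotProduct_add, dotProduct_smul, smul_eq_mul, h4]
  ring

theorem source_comparison_pos {A : Matrix n n ℝ} (hA : Aᵀ = -A) {u : ℝ} (hu : 1 ≤ u) (hu2 : u ≤ 2)
    {d : n → ℝ} (hd : ∀ i, d i * d i = 1)
    (hX : (u • (1 : Matrix n n ℝ) + diagonal d * A).det ≠ 0)
    {v z z' : n → ℝ} (hz : (u • (1 : Matrix n n ℝ) + A) *ᵥ z = v)
    (hz' : z' ᵥ* (u • (1 : Matrix n n ℝ) + A) = v) :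
    |(u • (1 : Matrix n n ℝ) + diagonal d * A).det *
      (v ⬝ᵥ (((u • (1 : Matrix n n ℝ) + diagonal d * A)⁻¹ * diagonal d) *ᵥ v) - v ⬝ᵥ z)| ≤
    6 * ((u • (1 : Matrix n n ℝ) + A).det * ((diagonal (fun i => 1 - d i) *ᵥ z) ⬝ᵥ
        (diagonal (fun i => 1 - d i) *ᵥ z) +
      (diagonal (fun i => 1 - d i) *ᵥ z') ⬝ᵥ (diagonal (fun i => 1 - d i) *ᵥ z'))) := by
  have hd1 : ∀ i, |d i| ≤ 1 := fun i => abs_le_one_iff_mul_self_le_one.mpr (hd i).le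
  have hp0 : 0 < (u • (1 : Matrix n n ℝ) + A).det := det_smul_one_add_skew_pos hA (by linarith)
  have hq : |(u • (1 : Matrix n n ℝ) + diagonal d * A).det| ≤
      (u • (1 : Matrix n n ℝ) + A).det := by
    have := abs_det_diagonal_add_mul_le hA (u := fun _ => u) (fun _ => by linarith) hd1
    simpa [smul_one_eq_diagonal] using this
  have hk := abs_kappa_le hA hu hd1 hX (diagonal (fun i => 1 - d i) *ᵥ z')
    (diagonal (fun i => 1 - d i) *ᵥ z)
  rw [dotProduct_modified hd hX hz hz']
  set p := (u • (1 : Matrix n n ℝ) + A).det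
  set q := (u • (1 : Matrix n n ℝ) + diagonal d * A).det
  set y := diagonal (fun i => 1 - d i) *ᵥ z with hy
  set y' := diagonal (fun i => 1 - d i) *ᵥ z' with hy'
  set κ := y' ⬝ᵥ (((u • (1 : Matrix n n ℝ) + diagonal d * A)⁻¹ * diagonal d) *ᵥ y)
  have h1 : 2 * (z' ⬝ᵥ y) = y' ⬝ᵥ y := by
    rw [hy, hy']
    simp only [dotProduct, mulVec_diagonal, mul_sum]
    refine sum_congr rfl fun i _ => ?_
    have : (1 - d i) * (1 - d i) = 2 * (1 - d i) := by have := hd i; ring_nf; nlinarith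
    linear_combination (-(z' i * z i)) * this
  have h2 := two_mul_abs_dotProduct_le y' y
  have h3 : q * (v ⬝ᵥ z + u * (z' ⬝ᵥ y) + u ^ 2 * κ - v ⬝ᵥ z) =
      q * (u / 2 * (y' ⬝ᵥ y)) + u ^ 2 * (q * κ) := by rw [← h1]; ring
  rw [h3]
  set e := y' ⬝ᵥ y' + y ⬝ᵥ y with he
  have he0 : 0 ≤ e := add_nonneg (dotProduct_self_nonneg' _) (dotProduct_self_nonneg' _)
  have h4 : |q * (u / 2 * (y' ⬝ᵥ y))| ≤ p * (e / 2) := by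
    rw [abs_mul, abs_mul, abs_of_nonneg (by linarith : (0 : ℝ) ≤ u / 2)]
    refine mul_le_mul hq ?_ (by positivity) hp0.le
    have := abs_nonneg (y' ⬝ᵥ y)
    nlinarith
  have h5 : |u ^ 2 * (q * κ)| ≤ 5 * (p * e) := by
    rw [abs_mul, abs_of_nonneg (sq_nonneg u)]
    have := abs_nonneg (q * κ)
    have hu4 : u ^ 2 ≤ 4 := by nlinarith
    nlinarith
  have h6 := abs_add_le (q * (u / 2 * (y' ⬝ᵥ y))) (u ^ 2 * (q * κ))
  have hpe : 0 ≤ p * e := mul_nonneg hp0.le he0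
  have : p * (y ⬝ᵥ y + y' ⬝ᵥ y') = p * e := by rw [he]; ring
  rw [this]
  linarith

end SourceComparison

/-- The matrix `a` bordered by a source `v`. -/
def bordered {q : ℕ} (A : Matrix (Fin q) (Fin q) ℝ) (v : Fin q → ℝ) :
    Matrix (Fin q ⊕ Unit) (Fin q ⊕ Unit) ℝ :=
  fromBlocks A (replicateCol Unit v) (-(replicateCol Unit v)ᵀ) 0

/-- `u` on the bulk and `0` on the source. -/
def bulk (q : ℕ) (u : ℝ) : Fin q ⊕ Unit → ℝ := Sum.elim (fun _ => u) fun _ => 0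

/-- The signs counting the particles at positions at least `k`. -/
def farSign (q k : ℕ) : Fin q → ℝ := fun i => if k ≤ (i : ℕ) then -1 else 1

theorem source_comparison_rate {ρ C₁ C₂ : ℝ} (hρ : 0 ≤ ρ) (hρ1 : ρ < 1) (hC₁ : 0 ≤ C₁) :
    ∃ C lam : ℝ, 0 ≤ C ∧ 1 < lam ∧ ∀ (q k : ℕ) (A : Matrix (Fin q) (Fin q) ℝ) (v : Fin q → ℝ)
      (V : ℝ), Aᵀ = -A → (∀ i j : Fin q, |A i j| ≤ C₁ * ρ ^ ((i : ℤ) - (j : ℤ)).natAbs) →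
      V ^ 2 ≤ v ⬝ᵥ v → (∀ i : Fin q, |v i| ≤ C₂ * ρ ^ (i : ℕ) * |V|) →
      lam ^ k * |(1 + A).det *
          (diagonal (bulk q 1) + diagonal (Sum.elim (farSign q k) fun _ => 1) * bordered A v).det -
        (1 + diagonal (farSign q k) * A).det * (diagonal (bulk q 1) + bordered A v).det| ≤
      C * ((1 + A).det * (diagonal (bulk q 1) + bordered A v).det) := by
  obtain ⟨lam, hlam, hρlam, hT⟩ := exists_rate (C₁ := C₁) hρ1
  set C₃ : ℝ := 4 * (C₂ ^ 2 * (1 - (ρ * lam) ^ 2)⁻¹) with hC₃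
  have hC₃0 : 0 ≤ C₃ := by
    have : 0 ≤ (1 - (ρ * lam) ^ 2)⁻¹ := by
      have : 0 ≤ ρ * lam := by positivity
      exact inv_nonneg.mpr (by nlinarith)
    positivity
  set C₄ : ℝ := 4 + (2 * (C₁ * (1 - ρ)⁻¹)) ^ 2 with hC₄
  refine ⟨6 * (8 * C₃ * C₄), lam ^ 2, by positivity, one_lt_pow₀ hlam two_ne_zero, ?_⟩
  intro q k A v V hA hAd hV hv
  have hd : ∀ i, farSign q k i * farSign q k i = 1 := fun i => by
    unfold farSign; split_ifs <;> norm_num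
  let F : ℝ → ℝ := fun u => 6 * (8 * C₃ * C₄) * ((u • (1 : Matrix (Fin q) (Fin q) ℝ) + A).det *
      (diagonal (bulk q u) + bordered A v).det) -
    (lam ^ 2) ^ k * |(u • (1 : Matrix (Fin q) (Fin q) ℝ) + A).det *
          (diagonal (bulk q u) + diagonal (Sum.elim (farSign q k) fun _ => 1) * bordered A v).det -
        (u • (1 : Matrix (Fin q) (Fin q) ℝ) + diagonal (farSign q k) * A).det *
          (diagonal (bulk q u) + bordered A v).det|
  have hFc : Continuous F := by
    have hb : Continuous fun u => diagonal (bulk q u) := by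
      refine Continuous.matrix_diagonal ?_
      refine continuous_pi fun i => ?_
      rcases i with i | i
      · exact continuous_id
      · exact continuous_const
    have h1 : ∀ B, Continuous fun u : ℝ => (u • (1 : Matrix (Fin q) (Fin q) ℝ) + B).det :=
      fun B => Continuous.matrix_det (by fun_prop)
    have h2 : ∀ B, Continuous fun u : ℝ => (diagonal (bulk q u) + B).det :=
      fun B => Continuous.matrix_det (hb.add continuous_const)
    have a1 := h1 A
    have a2 := h1 (diagonal (farSign q k) * A)
    have a3 := h2 (bordered A v)
    have a4 := h2 (diagonal (Sum.elim (farSign q k) fun _ => 1) * bordered A v)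
    fun_prop
  have hF : 0 ≤ F 1 := by
    have hlim := (hFc.tendsto 1).mono_left (nhdsWithin_le_nhds (s := Set.Ioi 1))
    refine ge_of_tendsto hlim ?_
    set M := -(diagonal (farSign q k) * A) with hM
    have hfin : {u : ℝ | u ∈ M.charpoly.roots.toFinset ∧ u ≠ 1}.Finite :=
      (M.charpoly.roots.toFinset.finite_toSet).subset fun u hu => hu.1
    have h2 : ∀ᶠ u in nhds (1 : ℝ), u < 2 := eventually_lt_nhds (by norm_num)
    filter_upwards [self_mem_nhdsWithin, nhdsWithin_le_nhds
      (hfin.isClosed.isOpen_compl.mem_nhds (show (1 : ℝ) ∈ _ from fun h => h.2 rfl)),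
      nhdsWithin_le_nhds h2] with u hu1 hu3 hu2
    have hu1' : (1 : ℝ) < u := hu1
    have hX : (u • (1 : Matrix (Fin q) (Fin q) ℝ) + diagonal (farSign q k) * A).det ≠ 0 := by
      intro h0
      apply hu3
      refine ⟨?_, hu1'.ne'⟩
      rw [Multiset.mem_toFinset, Polynomial.mem_roots M.charpoly_monic.ne_zero,
        Polynomial.IsRoot, eval_charpoly, hM, sub_neg_eq_add, ← h0, smul_one_eq_diagonal,
        scalar_apply]
    have hp0 : 0 < (u • (1 : Matrix (Fin q) (Fin q) ℝ) + A).det :=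
      det_smul_one_add_skew_pos hA (by linarith)
    set G := (u • (1 : Matrix (Fin q) (Fin q) ℝ) + A)⁻¹ with hG
    have hpu := isUnit_iff_ne_zero.mpr hp0.ne'
    have hz : (u • (1 : Matrix (Fin q) (Fin q) ℝ) + A) *ᵥ (G *ᵥ v) = v := by
      rw [mulVec_mulVec, mul_nonsing_inv _ hpu, one_mulVec]
    have hz' : (v ᵥ* G) ᵥ* (u • (1 : Matrix (Fin q) (Fin q) ℝ) + A) = v := by
      rw [vecMul_vecMul, nonsing_inv_mul _ hpu, vecMul_one]
    have hz'' : (u • (1 : Matrix (Fin q) (Fin q) ℝ) + (-A)) *ᵥ (v ᵥ* G) = v := by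
      have : u • (1 : Matrix (Fin q) (Fin q) ℝ) + (-A) =
          (u • (1 : Matrix (Fin q) (Fin q) ℝ) + A)ᵀ := by
        rw [transpose_add, hA, transpose_smul, transpose_one]
      rw [this, mulVec_transpose, hz']
    have hsrc := source_comparison_pos hA hu1'.le hu2.le hd hX hz hz'
    have ct1 := combes_thomas hρ hlam.le hρlam hC₁ hT hA hAd hV hv hu1'.le hz k
    have ct2 := combes_thomas hρ hlam.le hρlam hC₁ hT (A := -A) (by rw [transpose_neg, hA])
      (by simpa using hAd) hV hv hu1'.le hz'' k
    rw [← hC₃] at ct1 ct2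
    have hQ : ∀ w : Fin q → ℝ, (diagonal (fun i => 1 - farSign q k i) *ᵥ w) ⬝ᵥ
        (diagonal (fun i => 1 - farSign q k i) *ᵥ w) =
        4 * ∑ i : Fin q, (if k ≤ (i : ℕ) then w i else 0) ^ 2 := by
      intro w
      simp only [dotProduct, mulVec_diagonal, farSign, mul_sum]
      refine sum_congr rfl fun i _ => ?_
      split_ifs <;> ring
    rw [hQ, hQ] at hsrc
    have hvz : v ⬝ᵥ v ≤ C₄ * (v ⬝ᵥ (G *ᵥ v)) := by
      have h1 := norm_smul_one_add_skew hA u (G *ᵥ v)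
      rw [hz] at h1
      have h2 := schur_test_dist A (f := fun s => C₁ * ρ ^ s) (fun s => by positivity)
        ((hasSum_geometric_of_lt_one hρ hρ1).mul_left C₁) hAd (G *ᵥ v)
      have h3 := dotProduct_inv_mulVec hA (by linarith : 0 < u) v
      rw [← hG] at h3
      have h0 := dotProduct_self_nonneg' (G *ᵥ v)
      rw [h3, h1]
      have hu4 : u ^ 2 ≤ 4 := by nlinarith
      set N := (G *ᵥ v) ⬝ᵥ (G *ᵥ v)
      have h5 : u ^ 2 * N + (A *ᵥ (G *ᵥ v)) ⬝ᵥ (A *ᵥ (G *ᵥ v)) ≤ C₄ * N := by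
        rw [hC₄]; nlinarith
      have h6 : C₄ * N ≤ C₄ * (u * N) := by
        have : 0 ≤ C₄ := by positivity
        have : N ≤ u * N := by nlinarith
        gcongr
      linarith
    have hb1 : (diagonal (bulk q u) + bordered A v).det =
        (u • (1 : Matrix (Fin q) (Fin q) ℝ) + A).det * (v ⬝ᵥ (G *ᵥ v)) := by
      have h := det_bordered A (replicateCol Unit v) 0 u (fun _ => 1)
        (by rw [diagonal_one, Matrix.one_mul]; exact hp0.ne')
      have h1 : (diagonal (Sum.elim (fun _ : Fin q => (1 : ℝ)) fun _ : Unit => (1 : ℝ))) = 1 := by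
        ext (i | i) (j | j) <;> simp [diagonal_apply, one_apply]
      rw [diagonal_one, Matrix.one_mul, Matrix.mul_one, mul_mulVec_one_source, h1,
        Matrix.one_mul] at h
      exact h
    have hb2 : (diagonal (bulk q u) +
        diagonal (Sum.elim (farSign q k) fun _ => 1) * bordered A v).det =
        (u • (1 : Matrix (Fin q) (Fin q) ℝ) + diagonal (farSign q k) * A).det *
        (v ⬝ᵥ (((u • (1 : Matrix (Fin q) (Fin q) ℝ) + diagonal (farSign q k) * A)⁻¹ *
          diagonal (farSign q k)) *ᵥ v)) := by
      have h := det_bordered A (replicateCol Unit v) 0 u (farSign q k) hX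
      rw [mul_mulVec_one_source] at h
      exact h
    simp only [F]
    rw [hb1, hb2, sub_nonneg]
    set p := (u • (1 : Matrix (Fin q) (Fin q) ℝ) + A).det
    set r := (u • (1 : Matrix (Fin q) (Fin q) ℝ) + diagonal (farSign q k) * A).det
    set vK := v ⬝ᵥ (((u • (1 : Matrix (Fin q) (Fin q) ℝ) + diagonal (farSign q k) * A)⁻¹ *
          diagonal (farSign q k)) *ᵥ v)
    set vG := v ⬝ᵥ (G *ᵥ v)
    have e1 : p * (r * vK) - r * (p * vG) = p * (r * (vK - vG)) := by ring
    rw [e1, abs_mul, abs_of_pos hp0]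
    rw [← pow_mul]
    set L := lam ^ (2 * k)
    have hL : 0 ≤ L := by positivity
    calc L * (p * |r * (vK - vG)|) ≤ L * (p * (6 * (p * (4 * (∑ i : Fin q,
          (if k ≤ (i : ℕ) then (G *ᵥ v) i else 0) ^ 2) + 4 * ∑ i : Fin q,
          (if k ≤ (i : ℕ) then (v ᵥ* G) i else 0) ^ 2)))) := by gcongr
      _ = 24 * p ^ 2 * (L * (∑ i : Fin q, (if k ≤ (i : ℕ) then (G *ᵥ v) i else 0) ^ 2) +
          L * ∑ i : Fin q, (if k ≤ (i : ℕ) then (v ᵥ* G) i else 0) ^ 2) := by ring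
      _ ≤ 24 * p ^ 2 * (C₃ * (C₄ * vG) + C₃ * (C₄ * vG)) := by
        have := mul_le_mul_of_nonneg_left hvz hC₃0
        exact mul_le_mul_of_nonneg_left (by linarith) (by positivity)
      _ = 6 * (8 * C₃ * C₄) * (p * (p * vG)) := by ring
  have := sub_nonneg.mp hF
  simp only [one_smul] at this
  exact this

end Schonmann

namespace Schonmann

open Matrix Finset

/-- A matrix representation of the Clifford relations on a quadratic space `(V, B)`. -/
structure CliffordRep (V S : Type*) [AddCommGroup V] [Module ℝ V] [Fintype S] [DecidableEq S] where
  /-- The linear map into matrices. -/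
  c : V →ₗ[ℝ] Matrix S S ℝ
  /-- The bilinear form. -/
  B : V →ₗ[ℝ] V →ₗ[ℝ] ℝ
  symm : ∀ v w, B v w = B w v
  nondeg : ∀ v, (∀ w, B w v = 0) → v = 0
  anti : ∀ v w, c v * c w = (2 * B v w) • (1 : Matrix S S ℝ) - c w * c v

namespace CliffordRep

variable {V S : Type*} [AddCommGroup V] [Module ℝ V] [Fintype S] [DecidableEq S]
  (𝒞 : CliffordRep V S)

/-- `g` implements the linear map `R` by conjugation. -/
def Impl (g : Matrix S S ℝ) (R : V →ₗ[ℝ] V) : Prop := ∀ v, g * 𝒞.c v = 𝒞.c (R v) * g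

variable {𝒞}

theorem Impl.mul {g g' : Matrix S S ℝ} {R R' : V →ₗ[ℝ] V} (h : 𝒞.Impl g R) (h' : 𝒞.Impl g' R') :
    𝒞.Impl (g * g') (R ∘ₗ R') := fun v => by
  rw [Matrix.mul_assoc, h' v, ← Matrix.mul_assoc, h, Matrix.mul_assoc]; rfl

theorem Impl.one : 𝒞.Impl 1 LinearMap.id := fun v => by simp

theorem impl_c {v : V} (hv : 𝒞.c v * 𝒞.c v = 1) :
    𝒞.Impl (𝒞.c v) ((2 : ℝ) • (𝒞.B v).smulRight v - LinearMap.id) := fun w => by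
  rw [𝒞.anti v w]
  simp only [LinearMap.sub_apply, LinearMap.smul_apply, LinearMap.smulRight_apply,
    LinearMap.id_apply, map_sub, map_smul, sub_mul, Matrix.smul_mul, hv, smul_smul]

variable [FiniteDimensional ℝ V]

theorem Impl.two_point {g : Matrix S S ℝ} {R : V →ₗ[ℝ] V} (h : 𝒞.Impl g R) (v w : V) :
    (𝒞.c v * 𝒞.c w * g).trace + (𝒞.c (R v) * 𝒞.c w * g).trace = 2 * 𝒞.B (R v) w * g.trace := by
  have h1 : (𝒞.c v * 𝒞.c w * g).trace = (𝒞.c w * 𝒞.c (R v) * g).trace := by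
    rw [Matrix.mul_assoc, trace_mul_comm, Matrix.mul_assoc, h v, Matrix.mul_assoc]
  rw [h1, 𝒞.anti w, sub_mul, trace_sub, smul_mul, one_mul, trace_smul, 𝒞.symm w, smul_eq_mul]
  ring

theorem Impl.surjective_one_add {g : Matrix S S ℝ} {R : V →ₗ[ℝ] V} (h : 𝒞.Impl g R)
    (hg : g.trace ≠ 0) : Function.Surjective (LinearMap.id + R : V →ₗ[ℝ] V) := by
  refine LinearMap.injective_iff_surjective.mp ?_
  rw [injective_iff_map_eq_zero]
  intro v hv
  have hR : R v = -v := by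
    rw [LinearMap.add_apply, LinearMap.id_apply] at hv
    exact (neg_eq_of_add_eq_zero_right hv).symm
  refine 𝒞.nondeg v fun w => ?_
  have h2 := h.two_point v w
  rw [hR] at h2
  simp only [map_neg, neg_mul, LinearMap.neg_apply, trace_neg, add_neg_cancel] at h2
  have : 𝒞.B v w * g.trace = 0 := by linarith
  rw [𝒞.symm]
  exact (mul_eq_zero.mp this).resolve_right hg

/-- Wick's rule for four generators. -/
theorem Impl.four_point {g : Matrix S S ℝ} {R : V →ₗ[ℝ] V} (h : 𝒞.Impl g R)
    (hg : g.trace ≠ 0) (v v₁ v₂ v₃ : V) :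
    g.trace * (𝒞.c v * 𝒞.c v₁ * (𝒞.c v₂ * 𝒞.c v₃ * g)).trace =
      (𝒞.c v * 𝒞.c v₁ * g).trace * (𝒞.c v₂ * 𝒞.c v₃ * g).trace -
      (𝒞.c v * 𝒞.c v₂ * g).trace * (𝒞.c v₁ * 𝒞.c v₃ * g).trace +
      (𝒞.c v * 𝒞.c v₃ * g).trace * (𝒞.c v₁ * 𝒞.c v₂ * g).trace := by
  obtain ⟨x, rfl⟩ := h.surjective_one_add hg v
  have h4 : (𝒞.c x * 𝒞.c v₁ * (𝒞.c v₂ * 𝒞.c v₃ * g)).trace +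
      (𝒞.c (R x) * 𝒞.c v₁ * (𝒞.c v₂ * 𝒞.c v₃ * g)).trace =
      2 * 𝒞.B (R x) v₃ * (𝒞.c v₁ * 𝒞.c v₂ * g).trace -
      2 * 𝒞.B (R x) v₂ * (𝒞.c v₁ * 𝒞.c v₃ * g).trace +
      2 * 𝒞.B (R x) v₁ * (𝒞.c v₂ * 𝒞.c v₃ * g).trace := by
    have h1 : (𝒞.c x * 𝒞.c v₁ * (𝒞.c v₂ * 𝒞.c v₃ * g)).trace =
        (𝒞.c v₁ * 𝒞.c v₂ * (𝒞.c v₃ * 𝒞.c (R x)) * g).trace := by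
      rw [Matrix.mul_assoc, trace_mul_comm]
      simp only [Matrix.mul_assoc, h x]
    rw [h1, 𝒞.anti v₃ (R x), mul_sub, sub_mul, trace_sub]
    have h2 : 𝒞.c v₁ * 𝒞.c v₂ * (𝒞.c (R x) * 𝒞.c v₃) * g =
        𝒞.c v₁ * (𝒞.c v₂ * 𝒞.c (R x)) * (𝒞.c v₃ * g) := by simp only [Matrix.mul_assoc]
    rw [h2, 𝒞.anti v₂ (R x), mul_sub, sub_mul, trace_sub]
    have h3 : 𝒞.c v₁ * (𝒞.c (R x) * 𝒞.c v₂) * (𝒞.c v₃ * g) =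
        (𝒞.c v₁ * 𝒞.c (R x)) * (𝒞.c v₂ * 𝒞.c v₃ * g) := by simp only [Matrix.mul_assoc]
    rw [h3, 𝒞.anti v₁ (R x), sub_mul, trace_sub]
    simp only [Matrix.mul_smul, Matrix.smul_mul, Matrix.mul_one, Matrix.one_mul, trace_smul,
      smul_eq_mul, 𝒞.symm v₁ (R x), 𝒞.symm v₂ (R x), 𝒞.symm v₃ (R x), ← Matrix.mul_assoc]
    ring
  have e1 := h.two_point x v₁
  have e2 := h.two_point x v₂
  have e3 := h.two_point x v₃
  simp only [LinearMap.add_apply, LinearMap.id_apply, map_add, add_mul, trace_add]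
  linear_combination g.trace * h4 - (𝒞.c v₂ * 𝒞.c v₃ * g).trace * e1 +
    (𝒞.c v₁ * 𝒞.c v₃ * g).trace * e2 - (𝒞.c v₁ * 𝒞.c v₂ * g).trace * e3

variable (𝒞)

/-- Skew matrix of pair correlations of the generators `v i` in the state `g`. -/
noncomputable def pairMatrix {n : ℕ} (g : Matrix S S ℝ) (v : Fin n → V) : Matrix (Fin n) (Fin n) ℝ :=
  Matrix.of fun i j => if i < j then (𝒞.c (v i) * 𝒞.c (v j) * g).trace / g.trace
    else if j < i then -((𝒞.c (v j) * 𝒞.c (v i) * g).trace / g.trace) else 0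

/-- Trace of the product of generators against `g`. -/
def corr (g : Matrix S S ℝ) (l : List V) : ℝ := ((l.map 𝒞.c).prod * g).trace

variable {𝒞}

/-- Pfaffian structure of correlations, in squared form. -/
theorem Impl.corr_sq : ∀ (n : ℕ) (v : Fin n → V) {g : Matrix S S ℝ} {R : V →ₗ[ℝ] V},
    Even n → 𝒞.Impl g R →
    (∀ i, 𝒞.c (v i) * 𝒞.c (v i) = 1) →
    (∀ m, m ≤ n → Even m → 𝒞.corr g ((List.ofFn v).drop m) ≠ 0) →
    𝒞.corr g (List.ofFn v) ^ 2 = g.trace ^ 2 * (𝒞.pairMatrix g v).det := by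
  intro n
  induction n using Nat.twoStepInduction with
  | zero => intro v g R _ _ _ _; simp [corr]
  | one => intro v g R he; simp at he
  | more n ih _ =>
    intro v g R he hI hv hne
    have he' : Even n := by
      rcases he with ⟨r, hr⟩; exact ⟨r - 1, by omega⟩
    set w : Fin n → V := fun i => v (Fin.castAdd 2 i) with hw
    set a := v (Fin.natAdd n 0) with ha
    set b := v (Fin.natAdd n 1) with hb
    have hlist : List.ofFn v = List.ofFn w ++ [a, b] := by
      have : v = Fin.append w ![a, b] := by
        rw [← Fin.append_castAdd_natAdd (f := v)]
        congr 1
        ext i; fin_cases i <;> rfl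
      rw [this, List.ofFn_fin_append]
      simp
    set g' := 𝒞.c a * 𝒞.c b * g with hg'
    have hcorr : ∀ l : List V, 𝒞.corr g (l ++ [a, b]) = 𝒞.corr g' l := by
      intro l; simp [corr, hg', Matrix.mul_assoc]
    have hg0 : g.trace ≠ 0 := by
      have := hne (n + 2) le_rfl he
      rw [List.drop_eq_nil_of_le (by simp)] at this
      simpa [corr] using this
    have hg'0 : g'.trace ≠ 0 := by
      have := hne n (by omega) he'
      rw [hlist, List.drop_append_of_le_length (by simp), hcorr,
        List.drop_eq_nil_of_le (by simp)] at this
      simpa [corr] using this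
    have hI' : 𝒞.Impl g' _ := ((impl_c (hv (Fin.natAdd n 0))).mul
      (impl_c (hv (Fin.natAdd n 1)))).mul hI
    have hrec := ih w he' hI' (fun i => hv _) (fun m hm hme => by
      have := hne m (by omega) hme
      rwa [hlist, List.drop_append_of_le_length (by simpa using hm), hcorr] at this)
    rw [hlist, hcorr, hrec]
    -- Schur complement
    let e : Fin n ⊕ Fin 2 ≃ Fin (n + 2) := finSumFinEquiv
    set E : V → V → ℝ := fun x y => (𝒞.c x * 𝒞.c y * g).trace / g.trace with hE
    set r := E a b with hr
    have hr0 : r ≠ 0 := div_ne_zero hg'0 hg0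
    have hblocks : (𝒞.pairMatrix g v).submatrix e e = fromBlocks (𝒞.pairMatrix g w)
        (Matrix.of fun i (j : Fin 2) => if j = 0 then E (w i) a else E (w i) b)
        (-(Matrix.of fun i (j : Fin 2) => if j = 0 then E (w i) a else E (w i) b)ᵀ)
        !![0, r; -r, 0] := by
      ext (i | i) (j | j)
      · rfl
      · have : (Fin.castAdd 2 i) < (Fin.natAdd n j) := by
          rw [Fin.lt_def]; simp only [Fin.val_castAdd, Fin.val_natAdd]; omega
        fin_cases j
        · exact if_pos this
        · exact if_pos this
      · have : (Fin.castAdd 2 j) < (Fin.natAdd n i) := by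
          rw [Fin.lt_def]; simp only [Fin.val_castAdd, Fin.val_natAdd]; omega
        fin_cases i
        · exact (if_neg this.not_gt).trans (if_pos this)
        · exact (if_neg this.not_gt).trans (if_pos this)
      · have h01 : (Fin.natAdd n (0 : Fin 2)) < (Fin.natAdd n 1) := by
          rw [Fin.lt_def]; simp
        fin_cases i <;> fin_cases j <;> simp [e, pairMatrix, hr, hE, ha, hb, h01, h01.not_gt]
    have hdet : (𝒞.pairMatrix g v).det = r ^ 2 * (𝒞.pairMatrix g' w).det := by
      have hinv : (!![0, r; -r, 0] : Matrix (Fin 2) (Fin 2) ℝ) * !![0, -r⁻¹; r⁻¹, 0] = 1 := by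
        ext i j; fin_cases i <;> fin_cases j <;> simp [hr0]
      let : Invertible (!![0, r; -r, 0] : Matrix (Fin 2) (Fin 2) ℝ) :=
        invertibleOfRightInverse _ _ hinv
      rw [← det_submatrix_equiv_self e, hblocks, det_fromBlocks₂₂]
      have : ⅟(!![0, r; -r, 0] : Matrix (Fin 2) (Fin 2) ℝ) = !![0, -r⁻¹; r⁻¹, 0] :=
        invOf_eq_right_inv hinv
      rw [this, det_fin_two]
      have hd2 : (!![0, r; -r, 0] : Matrix (Fin 2) (Fin 2) ℝ) 0 0 * !![0, r; -r, 0] 1 1 -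
        (!![0, r; -r, 0] : Matrix (Fin 2) (Fin 2) ℝ) 0 1 * !![0, r; -r, 0] 1 0 = r ^ 2 := by
        simp; ring
      rw [hd2]
      congr 2
      have hpair : ∀ i j : Fin n, (𝒞.c (w i) * 𝒞.c (w j) * g').trace / g'.trace =
          E (w i) (w j) - (E (w i) a * E (w j) b - E (w i) b * E (w j) a) * r⁻¹ := by
        intro i j
        have h4 := hI.four_point hg0 (w i) (w j) a b
        rw [← hg'] at h4
        have hr' : r = g'.trace / g.trace := rfl
        rw [hr']
        simp only [hE]
        field_simp
        linear_combination h4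
      ext i j
      simp only [Matrix.sub_apply, Matrix.mul_apply, Fin.sum_univ_two, Matrix.neg_apply,
        transpose_apply, of_apply]
      simp only [pairMatrix, of_apply]
      rcases lt_trichotomy i j with hij | hij | hij
      · rw [if_pos hij, if_pos hij, hpair]
        simp
        ring
      · subst hij
        simp
        ring
      · rw [if_neg hij.not_gt, if_pos hij, if_neg hij.not_gt, if_pos hij, hpair]
        simp
        ring
    rw [hdet]
    have : r = g'.trace / g.trace := rfl
    rw [this]
    field_simp

end CliffordRep

end Schonmann

namespace Schonmann

open Matrix Finset

/-- Spin configurations on a column with rows `0, …, M`. -/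
abbrev St (M : ℕ) := Fin (M + 1) → Bool

/-- Index set of the Clifford generators of a column. -/
abbrev GenIdx (M : ℕ) := Fin (M + 1) × Bool

theorem sval_mul_self (b : Bool) : sval b * sval b = 1 := by cases b <;> simp [sval]

theorem sval_not (b : Bool) : sval (!b) = -sval b := by cases b <;> simp [sval]

theorem sval_true : sval true = 1 := rfl

theorem sval_false : sval false = -1 := rfl

theorem sval_eq (b : Bool) : sval b = 1 ∨ sval b = -1 := by cases b <;> simp [sval]

section Column

variable {M : ℕ}

/-- Spin in row `P`, with `+1` above the column. -/
def rowSpin (s : St M) (P : ℕ) : ℝ :=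
  if h : P < M + 1 then sval (s ⟨P, h⟩) else 1

theorem rowSpin_eq (s : St M) (P : ℕ) : rowSpin s P = 1 ∨ rowSpin s P = -1 := by
  unfold rowSpin; split_ifs
  · exact sval_eq _
  · exact Or.inl rfl

theorem rowSpin_mul_self (s : St M) (P : ℕ) : rowSpin s P * rowSpin s P = 1 := by
  rcases rowSpin_eq s P with h | h <;> rw [h] <;> norm_num

/-- Flip the rows `0, …, i`. -/
def flipLE (i : Fin (M + 1)) (s : St M) : St M := fun j => if j ≤ i then !s j else s j

theorem flipLE_flipLE (i : Fin (M + 1)) (s : St M) : flipLE i (flipLE i s) = s := by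
  funext j; by_cases h : j ≤ i <;> simp [flipLE, h]

theorem flipLE_comm (i j : Fin (M + 1)) (s : St M) :
    flipLE i (flipLE j s) = flipLE j (flipLE i s) := by
  funext l; by_cases h : l ≤ i <;> by_cases h' : l ≤ j <;> simp [flipLE, h, h']

theorem rowSpin_flipLE (i : Fin (M + 1)) (s : St M) (P : ℕ) :
    rowSpin (flipLE i s) P = (if P ≤ (i : ℕ) then -1 else 1) * rowSpin s P := by
  unfold rowSpin flipLE
  split_ifs with h h' h'' h''
  · rw [sval_not]; ring
  · exact absurd (Fin.le_def.mp h') h''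
  · exact absurd (Fin.le_def.mpr h'') h'
  · ring
  · omega
  · ring

/-- A signed permutation matrix. -/
def signedPerm {S : Type*} [DecidableEq S] (f : S → S) (a : S → ℝ) : Matrix S S ℝ :=
  Matrix.of fun s s' => if s' = f s then a s else 0

theorem signedPerm_mul {S : Type*} [DecidableEq S] [Fintype S] (f : S → S) (a : S → ℝ)
    (A : Matrix S S ℝ) (s s' : S) : (signedPerm f a * A) s s' = a s * A (f s) s' := by
  simp [signedPerm, Matrix.mul_apply]

theorem mul_signedPerm {S : Type*} [DecidableEq S] [Fintype S] {f : S → S}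
    (hf : ∀ s, f (f s) = s) (a : S → ℝ)
    (A : Matrix S S ℝ) (s s' : S) : (A * signedPerm f a) s s' = A s (f s') * a (f s') := by
  have : ∀ x, (s' = f x) ↔ (x = f s') := fun x => by
    constructor
    · rintro rfl; exact (hf x).symm
    · rintro rfl; exact (hf s').symm
  simp [signedPerm, Matrix.mul_apply, this]

/-- The row whose spin enters a generator. -/
def genRow (a : GenIdx M) : ℕ := a.1 + (if a.2 then 1 else 0)

/-- The square of a generator. -/
def genSq (a : GenIdx M) : ℝ := if a.2 then -1 else 1

/-- Coefficient of a generator. -/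
noncomputable def genCoeff (a : GenIdx M) (s : St M) : ℝ :=
  genSq a * (rowSpin s 0 * rowSpin s (genRow a))

/-- The Clifford generators of a column. -/
noncomputable def gen (a : GenIdx M) : Matrix (St M) (St M) ℝ :=
  signedPerm (flipLE a.1) (genCoeff a)

theorem gen_mul_apply (a b : GenIdx M) (s s' : St M) :
    (gen a * gen b) s s' = if s' = flipLE b.1 (flipLE a.1 s) then
      -(genSq a * genSq b) * (rowSpin s (genRow a) * rowSpin s (genRow b)) *
        (if genRow b ≤ (a.1 : ℕ) then -1 else 1) else 0 := by
  rw [gen, signedPerm_mul, gen, signedPerm, Matrix.of_apply]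
  split_ifs with h h' h'
  · simp only [genCoeff, rowSpin_flipLE, Nat.zero_le, if_true, h']
    linear_combination (genSq a * genSq b * rowSpin s (genRow a) * rowSpin s (genRow b)) *
      rowSpin_mul_self s 0
  · simp only [genCoeff, rowSpin_flipLE, Nat.zero_le, if_true, h', if_false]
    linear_combination (-genSq a * genSq b * rowSpin s (genRow a) * rowSpin s (genRow b)) *
      rowSpin_mul_self s 0
  · simp

theorem gen_anti (a b : GenIdx M) :
    gen a * gen b = (2 * (if a = b then genSq a else 0)) • (1 : Matrix (St M) (St M) ℝ) -
      gen b * gen a := by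
  by_cases hab : a = b
  · subst hab
    have : gen a * gen a = genSq a • (1 : Matrix (St M) (St M) ℝ) := by
      ext s s'
      rw [gen_mul_apply, flipLE_flipLE, rowSpin_mul_self, Matrix.smul_apply, Matrix.one_apply]
      simp only [eq_comm (a := s')]
      obtain ⟨i, b⟩ := a
      cases b <;> split_ifs <;> simp_all [genSq, genRow]
    rw [this, if_pos rfl, two_mul, add_smul, add_sub_cancel_right]
  · rw [if_neg hab, mul_zero, zero_smul, zero_sub]
    ext s s'
    rw [Matrix.neg_apply, gen_mul_apply, gen_mul_apply, flipLE_comm]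
    by_cases h : s' = flipLE a.1 (flipLE b.1 s)
    · rw [if_pos h, if_pos h]
      have hx : (if genRow b ≤ (a.1 : ℕ) then (-1 : ℝ) else 1) =
          -(if genRow a ≤ (b.1 : ℕ) then (-1 : ℝ) else 1) := by
        obtain ⟨i, x⟩ := a
        obtain ⟨j, y⟩ := b
        have hne : x = y → (i : ℕ) ≠ j := by
          rintro rfl h
          exact hab (by rw [Fin.ext h])
        cases x <;> cases y <;> simp only [genRow, if_true, if_false, Bool.false_eq_true] <;>
          simp at hne <;> split_ifs <;> first | (exfalso; omega) | norm_num
      rw [hx]; ring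
    · rw [if_neg h, if_neg h, neg_zero]

theorem sum_gen_mul_sum_gen (v w : GenIdx M → ℝ) :
    (∑ a, v a • gen a) * (∑ a, w a • gen a) =
      ∑ a, ∑ b, (v a * w b) • (gen a * gen b : Matrix (St M) (St M) ℝ) := by
  rw [Finset.sum_mul]
  refine sum_congr rfl fun a _ => ?_
  rw [Finset.mul_sum]
  refine sum_congr rfl fun b _ => ?_
  rw [Matrix.smul_mul, Matrix.mul_smul, smul_smul]

/-- The Clifford representation attached to a column. -/
noncomputable def columnRep (M : ℕ) : CliffordRep (GenIdx M → ℝ) (St M) where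
  c := ∑ a, (LinearMap.proj a : (GenIdx M → ℝ) →ₗ[ℝ] ℝ).smulRight (gen a)
  B := ∑ a, genSq a • (LinearMap.proj a : (GenIdx M → ℝ) →ₗ[ℝ] ℝ).smulRight
    (LinearMap.proj a : (GenIdx M → ℝ) →ₗ[ℝ] ℝ)
  symm v w := by
    simp only [LinearMap.sum_apply, LinearMap.smul_apply, LinearMap.smulRight_apply,
      LinearMap.proj_apply, smul_eq_mul]
    exact sum_congr rfl fun a _ => by ring
  nondeg v h := by
    funext a
    have := h (Pi.single a 1)
    simp only [LinearMap.sum_apply, LinearMap.smul_apply, LinearMap.smulRight_apply,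
      LinearMap.proj_apply, smul_eq_mul, Pi.single_apply, mul_ite, mul_one, mul_zero,
      ite_mul, zero_mul, one_mul,
      sum_ite_eq', sum_ite_eq, mem_univ, if_true] at this
    have hs : genSq a ≠ 0 := by unfold genSq; split_ifs <;> norm_num
    simpa [hs] using this
  anti v w := by
    simp only [LinearMap.sum_apply, LinearMap.smul_apply, LinearMap.smulRight_apply,
      LinearMap.proj_apply, smul_eq_mul]
    rw [sum_gen_mul_sum_gen, sum_gen_mul_sum_gen, sum_comm (f := fun a b =>
      (w a * v b) • (gen a * gen b)), Finset.mul_sum, sum_smul, ← sum_sub_distrib]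
    refine sum_congr rfl fun a _ => ?_
    have h1 : ∀ b, (v a * w b) • (gen a * gen b) =
        (if a = b then (2 * (genSq a * (v a * w b))) • (1 : Matrix (St M) (St M) ℝ) else 0) -
        (w b * v a) • (gen b * gen a) := by
      intro b
      rw [gen_anti a b, smul_sub, smul_smul, mul_comm (w b)]
      congr 1
      split_ifs
      · congr 1; ring
      · simp
    simp only [h1, sum_sub_distrib, sum_ite_eq, mem_univ, if_true]

theorem columnRep_c (v : GenIdx M → ℝ) : (columnRep M).c v = ∑ a, v a • gen a := by
  simp [columnRep, LinearMap.sum_apply]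

theorem columnRep_B (v w : GenIdx M → ℝ) :
    (columnRep M).B v w = ∑ a, genSq a * (v a * w a) := by
  simp [columnRep, LinearMap.sum_apply]

/-- The operator acting on each orbit of the involution `K` by `(c, s; s, c)`. -/
def hypOp {ι : Type*} (K : ι → ι) (c s : ι → ℝ) : (ι → ℝ) →ₗ[ℝ] (ι → ℝ) where
  toFun v a := c a * v a + s a * v (K a)
  map_add' v w := by funext a; simp only [Pi.add_apply]; ring
  map_smul' r v := by funext a; simp only [Pi.smul_apply, smul_eq_mul, RingHom.id_apply]; ring

theorem impl_hypOp {g : Matrix (St M) (St M) ℝ} {K : GenIdx M → GenIdx M} {c s : GenIdx M → ℝ}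
    (hK : Function.Involutive K) (hs : ∀ a, s (K a) = s a)
    (h : ∀ a, g * gen a = (c a • gen a + s a • gen (K a)) * g) :
    (columnRep M).Impl g (hypOp K c s) := by
  intro v
  rw [columnRep_c, columnRep_c, Finset.mul_sum]
  have h1 : ∑ a, hypOp K c s v a • gen a = ∑ a, v a • (c a • gen a + s a • gen (K a)) := by
    simp only [hypOp, LinearMap.coe_mk, AddHom.coe_mk, add_smul, smul_add, sum_add_distrib]
    congr 1
    · exact sum_congr rfl fun a _ => by rw [smul_smul, mul_comm]
    · rw [← Equiv.sum_comp hK.toPerm]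
      refine sum_congr rfl fun a _ => ?_
      rw [Function.Involutive.coe_toPerm, hs, hK, smul_smul, mul_comm]
  rw [h1, Finset.sum_mul]
  exact sum_congr rfl fun a _ => by rw [Matrix.mul_smul, h, Matrix.smul_mul]

/-- Vertical energy of a column with `+` above. -/
def vertE (s : St M) : ℝ := ∑ i : Fin (M + 1), rowSpin s i * rowSpin s (i + 1)

/-- Horizontal energy in the rows `1, …, M`. -/
def horE (s s' : St M) : ℝ :=
  ∑ i : Fin (M + 1), if (i : ℕ) = 0 then 0 else rowSpin s i * rowSpin s' i

theorem vertE_flipLE (i : Fin (M + 1)) (s : St M) :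
    vertE (flipLE i s) = vertE s - 2 * (rowSpin s i * rowSpin s (i + 1)) := by
  have : 2 * (rowSpin s i * rowSpin s (i + 1)) =
      ∑ j : Fin (M + 1), if j = i then 2 * (rowSpin s j * rowSpin s (j + 1)) else 0 := by simp
  rw [this, vertE, vertE, ← sum_sub_distrib]
  refine sum_congr rfl fun j _ => ?_
  rw [rowSpin_flipLE, rowSpin_flipLE]
  have : j = i ↔ (j : ℕ) = i := Fin.ext_iff
  split_ifs <;> first | (exfalso; omega) | ring

theorem horE_flipLE_right (i : Fin (M + 1)) (s s' : St M) :
    horE s (flipLE i s') = horE (flipLE i s) s' := by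
  refine sum_congr rfl fun j _ => ?_
  rw [rowSpin_flipLE, rowSpin_flipLE]
  split_ifs <;> ring

theorem horE_flipLE_succ (i i' : Fin (M + 1)) (h : (i' : ℕ) = i + 1) (s s' : St M) :
    horE (flipLE i' s) s' = horE (flipLE i s) s' - 2 * (rowSpin s i' * rowSpin s' i') := by
  have : 2 * (rowSpin s i' * rowSpin s' i') =
      ∑ j : Fin (M + 1), if j = i' then 2 * (rowSpin s j * rowSpin s' j) else 0 := by simp
  rw [this, horE, horE, ← sum_sub_distrib]
  refine sum_congr rfl fun j _ => ?_
  rw [rowSpin_flipLE, rowSpin_flipLE]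
  have : j = i' ↔ (j : ℕ) = i' := Fin.ext_iff
  split_ifs <;> first | (exfalso; omega) | ring

theorem horE_flip_zero (i : Fin (M + 1)) (h : (i : ℕ) = 0) (s s' : St M) :
    horE (flipLE i s) s' = horE s s' := by
  refine sum_congr rfl fun j _ => ?_
  rw [rowSpin_flipLE]
  split_ifs <;> first | (exfalso; omega) | ring

/-- Vertical transfer matrix. -/
noncomputable def vertMat (κ : ℝ) : Matrix (St M) (St M) ℝ :=
  diagonal fun s => Real.exp (κ * vertE s)

/-- Horizontal transfer matrix; the spin in row `0` is changed according to `w`. -/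
noncomputable def horMat (β : ℝ) (w : Bool) : Matrix (St M) (St M) ℝ :=
  Matrix.of fun s s' => if s' 0 = xor (s 0) w then Real.exp (β * horE s s') else 0

/-- The involution exchanging the two generators of a row. -/
def rowSwap (a : GenIdx M) : GenIdx M := (a.1, !a.2)

theorem rowSwap_involutive : Function.Involutive (rowSwap (M := M)) := fun a => by
  simp [rowSwap]

/-- The involution exchanging neighbouring generators of consecutive rows. -/
def linkSwap (a : GenIdx M) : GenIdx M :=
  if a.2 then (if h : (a.1 : ℕ) + 1 < M + 1 then (⟨a.1 + 1, h⟩, false) else a)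
  else (if (a.1 : ℕ) = 0 then a else (⟨a.1 - 1, by omega⟩, true))

theorem linkSwap_involutive : Function.Involutive (linkSwap (M := M)) := by
  rintro ⟨i, b⟩
  cases b
  · by_cases h : (i : ℕ) = 0
    · simp [linkSwap, h]
    · have h1 : (i : ℕ) - 1 + 1 = i := by omega
      have h2 := i.2
      simp only [linkSwap, h, if_false, Bool.false_eq_true, if_true, h1, h2, dif_pos]
  · by_cases h : (i : ℕ) + 1 < M + 1
    · simp [linkSwap, h]
    · simp [linkSwap, h]

/-- Diagonal coefficient of the horizontal rotation. -/
noncomputable def linkC (c : ℝ) (a : GenIdx M) : ℝ := if linkSwap a = a then 1 else c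

/-- Off-diagonal coefficient of the horizontal rotation. -/
noncomputable def linkS (s : ℝ) (a : GenIdx M) : ℝ := if linkSwap a = a then 0 else s

theorem linkS_linkSwap (s : ℝ) (a : GenIdx M) : linkS s (linkSwap a) = linkS s a := by
  simp [linkS, linkSwap_involutive a, eq_comm]

theorem linkC_linkSwap (s : ℝ) (a : GenIdx M) : linkC s (linkSwap a) = linkC s a := by
  simp [linkC, linkSwap_involutive a, eq_comm]

theorem impl_vertMat (κ : ℝ) : (columnRep M).Impl (vertMat κ)
    (hypOp rowSwap (fun _ => Real.cosh (2 * κ)) fun _ => -Real.sinh (2 * κ)) := by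
  refine impl_hypOp rowSwap_involutive (fun _ => rfl) fun a => ?_
  ext s s'
  rw [vertMat, diagonal_mul, mul_diagonal]
  simp only [Matrix.add_apply, Matrix.smul_apply, gen, signedPerm, Matrix.of_apply, rowSwap,
    smul_eq_mul]
  split_ifs with h
  · subst h
    rw [vertE_flipLE]
    obtain ⟨i, b⟩ := a
    have hx : Real.exp (κ * (vertE s - 2 * (rowSpin s i * rowSpin s (i + 1)))) =
        Real.exp (κ * vertE s) * Real.exp (-(2 * κ * (rowSpin s i * rowSpin s (i + 1)))) := by
      rw [← Real.exp_add]; ring_nf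
    have hl : Real.exp (-(2 * κ * (rowSpin s i * rowSpin s (i + 1)))) *
        (Real.cosh (2 * κ) + Real.sinh (2 * κ) * (rowSpin s i * rowSpin s (i + 1))) = 1 := by
      have h1 : rowSpin s i * rowSpin s (i + 1) = 1 ∨ rowSpin s i * rowSpin s (i + 1) = -1 := by
        rcases rowSpin_eq s i with h1 | h1 <;> rcases rowSpin_eq s (i + 1) with h2 | h2 <;>
          simp [h1, h2]
      rcases h1 with h1 | h1
      · rw [h1, mul_one, mul_one, Real.cosh_add_sinh, ← Real.exp_add]; simp
      · rw [h1, mul_neg_one, mul_neg_one, ← sub_eq_add_neg, Real.cosh_sub_sinh,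
          ← Real.exp_add]; simp
    simp only [hx]
    cases b <;>
      simp only [genCoeff, genRow, genSq, Bool.not_true, Bool.not_false, if_true,
        if_false, Bool.false_eq_true, add_zero]
    · linear_combination (-(Real.exp (κ * vertE s) * rowSpin s 0 * rowSpin s i)) * hl +
        Real.exp (κ * vertE s) * Real.exp (-(2 * κ * (rowSpin s i * rowSpin s (i + 1)))) *
        rowSpin s 0 * Real.sinh (2 * κ) * rowSpin s (i + 1) * rowSpin_mul_self s i
    · linear_combination (Real.exp (κ * vertE s) * rowSpin s 0 * rowSpin s (i + 1)) * hl -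
        Real.exp (κ * vertE s) * Real.exp (-(2 * κ * (rowSpin s i * rowSpin s (i + 1)))) *
        rowSpin s 0 * Real.sinh (2 * κ) * rowSpin s i * rowSpin_mul_self s (i + 1)
  · simp only [h, if_false, mul_zero, add_zero, zero_mul]

theorem exp_link {β X : ℝ} (hX : X = 1 ∨ X = -1) :
    Real.exp (2 * β * X) = Real.cosh (2 * β) + Real.sinh (2 * β) * X := by
  rcases hX with rfl | rfl
  · rw [mul_one, mul_one, Real.cosh_add_sinh]
  · rw [mul_neg_one, mul_neg_one, ← sub_eq_add_neg, Real.cosh_sub_sinh]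

theorem impl_horMat {β : ℝ} (hβ : 0 < β) : (columnRep M).Impl (horMat β false)
    (hypOp linkSwap (linkC (Real.cosh (2 * β) / Real.sinh (2 * β)))
      (linkS (1 / Real.sinh (2 * β)))) := by
  have hsh : Real.sinh (2 * β) ≠ 0 := (Real.sinh_pos_iff.mpr (by linarith)).ne'
  refine impl_hypOp linkSwap_involutive (linkS_linkSwap _) fun a => ?_
  have key : ∀ s s' : St M, ∀ i i' : Fin (M + 1), (i' : ℕ) = i + 1 →
      Real.exp (β * horE (flipLE i s) s') = Real.exp (β * horE (flipLE i' s) s') *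
        (Real.cosh (2 * β) + Real.sinh (2 * β) * (rowSpin s i' * rowSpin s' i')) := by
    intro s s' i i' h
    have hX : rowSpin s i' * rowSpin s' i' = 1 ∨ rowSpin s i' * rowSpin s' i' = -1 := by
      rcases rowSpin_eq s i' with h1 | h1 <;> rcases rowSpin_eq s' i' with h2 | h2 <;>
          simp [h1, h2]
    rw [← exp_link hX, horE_flipLE_succ i i' h, ← Real.exp_add]
    congr 1; ring
  have hcs := Real.cosh_sq (2 * β)
  generalize Real.sinh (2 * β) = S at *
  generalize Real.cosh (2 * β) = C at *
  ext s s'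
  rw [gen, mul_signedPerm (flipLE_flipLE a.1), add_mul, Matrix.add_apply, Matrix.smul_mul,
    Matrix.smul_mul, Matrix.smul_apply, Matrix.smul_apply, gen, signedPerm_mul, signedPerm_mul]
  simp only [horMat, Matrix.of_apply, Bool.xor_false, smul_eq_mul, horE_flipLE_right]
  have e1 : ∀ (i : Fin (M + 1)) (s : St M), flipLE i s 0 = !s 0 := fun i s => by simp [flipLE]
  simp only [e1]
  by_cases h0 : s' 0 = !s 0
  swap
  · have h0' : (!s' 0) ≠ s 0 := fun h => h0 (by rw [← h, Bool.not_not])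
    simp only [h0, h0', if_false, mul_zero, zero_mul, add_zero]
  have h0' : (!s' 0) = s 0 := by rw [h0, Bool.not_not]
  simp only [h0, Bool.not_not, if_true]
  have hr0 : rowSpin s' 0 = - rowSpin s 0 := by simp [rowSpin, h0, sval_not]
  obtain ⟨i, b⟩ := a
  cases b
  · by_cases hi : (i : ℕ) = 0
    · have hl : linkSwap (i, false) = (i, false) := by simp [linkSwap, hi]
      simp only [linkC, linkS, hl, if_true, genCoeff, genRow, genSq, Bool.false_eq_true, if_false,
        add_zero, rowSpin_flipLE, hi, le_refl, hr0]
      linear_combination 0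
    · obtain ⟨i', hi'⟩ : ∃ i' : Fin (M + 1), (i : ℕ) = i' + 1 := ⟨⟨i - 1, by omega⟩, by
        simp only; omega⟩
      have hl : linkSwap (i, false) = (i', true) := by
        simp only [linkSwap, hi, if_false, Bool.false_eq_true]
        ext <;> simp [hi']
      have hne : ((i', true) : GenIdx M) ≠ (i, false) := by simp
      simp only [linkC, linkS, hl, hne, if_true, genCoeff, genRow, genSq, Bool.false_eq_true,
        if_false, add_zero, rowSpin_flipLE, le_refl, hr0, Nat.zero_le, ← hi', key s s' i' i hi']
      field_simp
      linear_combination (rowSpin s 0 * rowSpin s' i * S) * rowSpin_mul_self s i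
  · by_cases hi : (i : ℕ) + 1 < M + 1
    · have hl : linkSwap (i, true) = (⟨i + 1, hi⟩, false) := by simp [linkSwap, hi]
      have hne : ((⟨i + 1, hi⟩, false) : GenIdx M) ≠ (i, true) := by simp
      simp only [linkC, linkS, hl, hne, if_true, genCoeff, genRow, genSq, Bool.false_eq_true,
        if_false, add_zero, rowSpin_flipLE, hr0, Nat.zero_le,
        key s s' i ⟨i + 1, hi⟩ rfl]
      field_simp
      rw [if_neg (Nat.not_succ_le_self _)]
      linear_combination (S * rowSpin s' (i + 1) * C *
        rowSpin s 0) * rowSpin_mul_self s (i + 1) - (S ^ 2 *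
        rowSpin s (i + 1) * rowSpin s 0) * rowSpin_mul_self s' (i + 1) +
        (rowSpin s (i + 1) * rowSpin s 0) * hcs
    · have hl : linkSwap (i, true) = (i, true) := by simp [linkSwap, hi]
      have hM : (i : ℕ) + 1 = M + 1 := by omega
      have hg : ∀ s : St M, rowSpin s (M + 1) = 1 := fun s => by simp [rowSpin]
      simp only [linkC, linkS, hl, if_true, genCoeff, genRow, genSq, hM, rowSpin_flipLE, hr0, hg,
        Nat.zero_le]
      simp [mul_comm]

end Column

end Schonmann

namespace Schonmann

open Matrix Finset

section CliffordProducts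

variable {V S : Type*} [AddCommGroup V] [Module ℝ V] [Fintype S] [DecidableEq S]
  {𝒞 : CliffordRep V S}

namespace CliffordRep

theorem c_mul_self (v : V) : 𝒞.c v * 𝒞.c v = 𝒞.B v v • (1 : Matrix S S ℝ) := by
  have h := 𝒞.anti v v
  have h2 : (2 : ℝ) • (𝒞.c v * 𝒞.c v) = (2 : ℝ) • (𝒞.B v v • (1 : Matrix S S ℝ)) := by
    rw [smul_smul, two_smul]
    nth_rewrite 1 [h]
    abel
  exact smul_right_injective _ (two_ne_zero) h2

theorem Impl.isometry {g : Matrix S S ℝ} {R : V →ₗ[ℝ] V} (h : 𝒞.Impl g R) (hg : g ≠ 0) (v : V) :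
    𝒞.B (R v) (R v) = 𝒞.B v v := by
  have h1 : 𝒞.c (R v) * 𝒞.c (R v) * g = g * (𝒞.c v * 𝒞.c v) := by
    rw [Matrix.mul_assoc, ← h v, ← Matrix.mul_assoc, ← h v, Matrix.mul_assoc]
  rw [c_mul_self, c_mul_self, Matrix.smul_mul, Matrix.one_mul, Matrix.mul_smul,
    Matrix.mul_one] at h1
  exact smul_left_injective ℝ hg h1

/-- Moving insertions of a generator through a product of implementers. -/
theorem prod_insertions : ∀ (n : ℕ) (T : Fin n → Matrix S S ℝ) (R : Fin n → V →ₗ[ℝ] V) (e : V),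
    (∀ j, 𝒞.Impl (T j) (R j)) → (∀ j, T j ≠ 0) →
    ∃ (ψ : Fin n → V) (R' : V →ₗ[ℝ] V), 𝒞.Impl (List.ofFn T).prod R' ∧
      (∀ j, 𝒞.B (ψ j) (ψ j) = 𝒞.B e e) ∧ ∀ w : Fin n → Bool,
      (List.ofFn fun j => T j * (if w j then 𝒞.c e else 1)).prod =
        (((List.finRange n).filter fun j => w j).map fun j => 𝒞.c (ψ j)).prod *
          (List.ofFn T).prod := by
  intro n
  induction n with
  | zero =>
    intro T R e _ _
    exact ⟨Fin.elim0, LinearMap.id, by simpa using Impl.one, fun j => j.elim0, fun w => by simp⟩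
  | succ n ih =>
    intro T R e hI hT
    obtain ⟨ψ, R', h1, h2, h3⟩ := ih (fun j => T j.succ) (fun j => R j.succ) e
      (fun j => hI _) (fun j => hT _)
    refine ⟨Fin.cons (R 0 e) fun j => R 0 (ψ j), R 0 ∘ₗ R', ?_, ?_, ?_⟩
    · rw [List.ofFn_succ, List.prod_cons]
      exact (hI 0).mul h1
    · intro j
      refine Fin.cases ?_ (fun j => ?_) j
      · exact (hI 0).isometry (hT 0) e
      · rw [Fin.cons_succ, (hI 0).isometry (hT 0), h2]
    · intro w
      rw [List.ofFn_succ, List.prod_cons, h3, List.ofFn_succ, List.prod_cons, List.finRange_succ]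
      have hmove : ∀ l : List (Fin n), T 0 * (l.map fun j => 𝒞.c (ψ j)).prod =
          (l.map fun j => 𝒞.c (R 0 (ψ j))).prod * T 0 := by
        intro l
        induction l with
        | nil => simp
        | cons a l ihl =>
          rw [List.map_cons, List.prod_cons, ← Matrix.mul_assoc, hI 0, Matrix.mul_assoc, ihl,
            List.map_cons, List.prod_cons, Matrix.mul_assoc]
      have hrest : (((List.finRange n).map Fin.succ).filter fun j => w j).map (fun j => 𝒞.c
          ((Fin.cons (R 0 e) fun j => R 0 (ψ j) : Fin (n + 1) → V) j)) =
          ((List.finRange n).filter fun j => w j.succ).map fun j => 𝒞.c (R 0 (ψ j)) := by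
        rw [List.filter_map, List.map_map]
        rfl
      by_cases h0 : w 0
      · rw [List.filter_cons_of_pos h0, List.map_cons, List.prod_cons, hrest, if_pos h0, hI 0,
          Fin.cons_zero, Matrix.mul_assoc, Matrix.mul_assoc]
        congr 1
        rw [← Matrix.mul_assoc, hmove, Matrix.mul_assoc]
      · rw [List.filter_cons_of_neg h0, hrest, if_neg h0, Matrix.mul_one, ← Matrix.mul_assoc,
          hmove, Matrix.mul_assoc]

/-- Pfaffian structure of the correlations of a sorted selection of generators. -/
theorem Impl.corr_filter_sq [FiniteDimensional ℝ V] {n : ℕ} {ψ : Fin n → V}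
    {g : Matrix S S ℝ} {R : V →ₗ[ℝ] V}
    (hI : 𝒞.Impl g R) (hψ : ∀ i, 𝒞.B (ψ i) (ψ i) = 1)
    (hne : ∀ W : Finset (Fin n), Even W.card →
      𝒞.corr g (((List.finRange n).filter fun j => j ∈ W).map ψ) ≠ 0)
    (W : Finset (Fin n)) (hW : Even W.card) :
    𝒞.corr g (((List.finRange n).filter fun j => j ∈ W).map ψ) ^ 2 =
      g.trace ^ 2 * ((𝒞.pairMatrix g ψ).submatrix (Subtype.val : W → Fin n) Subtype.val).det := by
  set l := (List.finRange n).filter fun j => j ∈ W with hl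
  have hsorted : l.SortedLT := by
    rw [hl, List.sortedLT_iff_pairwise]
    exact (List.pairwise_lt_finRange n).filter _
  have hmem : ∀ j, j ∈ l ↔ j ∈ W := fun j => by simp [hl]
  have hnodup : l.Nodup := hsorted.nodup
  have htof : l.toFinset = W := by ext j; simp [hmem]
  have hlen : l.length = W.card := by rw [← htof, List.toFinset_card_of_nodup hnodup]
  have hof : l.map ψ = List.ofFn fun i : Fin l.length => ψ (l.get i) := by
    have h := congrArg (List.map ψ) (List.ofFn_get l)
    rw [List.map_ofFn] at h
    exact h.symm
  rw [hof, hI.corr_sq _ _ (by rwa [hlen]) fun i => by rw [c_mul_self, hψ, one_smul]]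
  · congr 1
    let e : Fin l.length ≃ W := (hnodup.getEquiv l).trans
      (Equiv.subtypeEquivRight fun j => hmem j)
    rw [← det_submatrix_equiv_self e]
    congr 1
    ext i j
    have hmono : StrictMono l.get := hsorted.strictMono_get
    have he : ∀ i, ((e i : W) : Fin n) = l.get i := fun i => rfl
    simp only [pairMatrix, submatrix_apply, of_apply, he, hmono.lt_iff_lt]
  · intro m hm hme
    have hdrop : (l.drop m) = (List.finRange n).filter fun j => j ∈ (l.drop m).toFinset := by
      refine List.Perm.eq_of_pairwise (le := (· < ·)) (fun a b _ _ h h' => absurd h h'.not_gt) ?_ ?_ ?_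
      · exact (List.sortedLT_iff_pairwise.mp hsorted).sublist (List.drop_sublist _ _)
      · exact (List.pairwise_lt_finRange n).filter _
      · rw [List.perm_ext_iff_of_nodup (hnodup.sublist (List.drop_sublist _ _))
          ((List.nodup_finRange n).filter _)]
        intro j; simp
    rw [← hof, ← List.map_drop, hdrop]
    refine hne _ ?_
    rw [List.toFinset_card_of_nodup (hnodup.sublist (List.drop_sublist _ _)), List.length_drop,
      hlen]
    exact (Nat.even_sub (by omega)).mpr ⟨fun _ => hme, fun _ => hW⟩

end CliffordRep

end CliffordProducts

/-- Entries of a product of matrices as a sum over paths. -/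
theorem prod_ofFn_apply {S : Type*} [Fintype S] [DecidableEq S] :
    ∀ (n : ℕ) (A : Fin (n + 1) → Matrix S S ℝ) (a b : S), (List.ofFn A).prod a b =
      ∑ s : Fin n → S, ∏ j : Fin (n + 1), A j ((Fin.cons a s : Fin (n + 1) → S) j)
        ((Fin.snoc s b : Fin (n + 1) → S) j) := by
  intro n
  induction n with
  | zero => intro A a b; simp [Fin.snoc]
  | succ n ih =>
    intro A a b
    rw [List.ofFn_succ, List.prod_cons, Matrix.mul_apply]
    rw [← (Fin.consEquiv fun _ => S).sum_comp, Fintype.sum_prod_type]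
    refine sum_congr rfl fun c _ => ?_
    rw [ih, Finset.mul_sum]
    refine sum_congr rfl fun s _ => ?_
    rw [Fin.prod_univ_succ (n := n + 1)]
    have h : (Fin.snoc (Fin.consEquiv (fun _ => S) (c, s)) b : Fin (n + 2) → S) =
        Fin.cons c (Fin.snoc s b : Fin (n + 1) → S) :=
      (Fin.cons_snoc_eq_snoc_cons (β := S) c s b).symm
    rw [h]
    rfl

/-- The trace of a product of matrices as a sum over closed paths. -/
theorem trace_prod_ofFn {S : Type*} [Fintype S] [DecidableEq S] (m : ℕ)
    (A : Fin (m + 1) → Matrix S S ℝ) : (List.ofFn A).prod.trace =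
      ∑ s : Fin (m + 1) → S, ∏ j, A j (s j) (s (j + 1)) := by
  rw [← (Fin.consEquiv fun _ => S).sum_comp, Fintype.sum_prod_type, Matrix.trace]
  refine sum_congr rfl fun a _ => ?_
  rw [Matrix.diag_apply, prod_ofFn_apply]
  refine sum_congr rfl fun s _ => prod_congr rfl fun j _ => ?_
  congr 1
  simp only [Fin.consEquiv_apply]
  refine Fin.lastCases ?_ (fun j => ?_) j
  · rw [Fin.snoc_last, Fin.last_add_one, Fin.cons_zero]
  · rw [Fin.snoc_castSucc, Fin.coeSucc_eq_succ, Fin.cons_succ]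

end Schonmann

namespace Schonmann

open Matrix Finset

section Walls

variable {m : ℕ}

/-- The row of spins, starting with `+`, whose sign changes are at `W`. -/
def signOf (W : Finset (Fin (m + 1))) (j : Fin (m + 1)) : Bool :=
  decide (Even (W.filter fun i => i < j).card)

/-- The positions of the sign changes of a cyclic row of spins. -/
def wallSet (x : Fin (m + 1) → Bool) : Finset (Fin (m + 1)) :=
  univ.filter fun j => x (j + 1) ≠ x j

theorem signOf_zero (W : Finset (Fin (m + 1))) : signOf W 0 = true := by simp [signOf]

theorem sval_signOf (W : Finset (Fin (m + 1))) (j : Fin (m + 1)) :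
    sval (signOf W j) = ∏ i ∈ W, if i < j then -1 else 1 := by
  rw [prod_ite, prod_const, prod_const_one, mul_one, signOf]
  by_cases h : Even (W.filter fun i => i < j).card
  · rw [decide_eq_true h, h.neg_one_pow, sval_true]
  · rw [decide_eq_false h, (Nat.not_even_iff_odd.mp h).neg_one_pow, sval_false]

theorem sval_injective : Function.Injective sval := by
  intro a b h
  cases a <;> cases b <;> simp [sval] at h ⊢ <;> norm_num at h

theorem sval_signOf_add_one {W : Finset (Fin (m + 1))} (hW : Even W.card) (j : Fin (m + 1)) :
    sval (signOf W (j + 1)) = sval (signOf W j) * if j ∈ W then -1 else 1 := by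
  have hj : (if j ∈ W then (-1 : ℝ) else 1) = ∏ i ∈ W, if i = j then -1 else 1 := by
    rw [prod_ite_eq']
  rw [sval_signOf, sval_signOf, hj, ← prod_mul_distrib]
  refine Fin.lastCases ?_ (fun j => ?_) j
  · rw [Fin.last_add_one]
    have h1 : ∏ i ∈ W, (if i < (0 : Fin (m + 1)) then (-1 : ℝ) else 1) = 1 :=
      prod_eq_one fun i _ => by simp
    have h2 : ∏ i ∈ W, ((if i < Fin.last m then (-1 : ℝ) else 1) *
        if i = Fin.last m then -1 else 1) = ∏ i ∈ W, (-1 : ℝ) := by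
      refine prod_congr rfl fun i _ => ?_
      rcases (Fin.le_last i).lt_or_eq with h | h
      · simp [h, h.ne]
      · simp [h]
    rw [h1, h2, prod_const, hW.neg_one_pow]
  · refine prod_congr rfl fun i _ => ?_
    have e : (j.castSucc + 1 : Fin (m + 1)) = j.succ := Fin.coeSucc_eq_succ
    have e1 : i < j.succ ↔ (i : ℕ) < j + 1 := by rw [Fin.lt_def, Fin.val_succ]
    have e2 : i < j.castSucc ↔ (i : ℕ) < j := by rw [Fin.lt_def, Fin.val_castSucc]
    have e3 : i = j.castSucc ↔ (i : ℕ) = j := by rw [Fin.ext_iff, Fin.val_castSucc]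
    rw [e]
    simp only [e1, e2, e3]
    split_ifs <;> first | (exfalso; omega) | norm_num

theorem wallSet_signOf {W : Finset (Fin (m + 1))} (hW : Even W.card) :
    wallSet (signOf W) = W := by
  ext j
  rw [wallSet, mem_filter]
  have h := sval_signOf_add_one hW j
  have h0 := sval_mul_self (signOf W j)
  constructor
  · rintro ⟨_, h1⟩
    by_contra h2
    rw [if_neg h2, mul_one] at h
    exact h1 (sval_injective h)
  · intro h2
    refine ⟨mem_univ _, fun h1 => ?_⟩
    rw [if_pos h2, h1] at h
    rcases sval_eq (signOf W j) with h3 | h3 <;> rw [h3] at h <;> norm_num at h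

theorem sval_add_one (x : Fin (m + 1) → Bool) (j : Fin (m + 1)) :
    sval (x (j + 1)) = sval (x j) * if j ∈ wallSet x then -1 else 1 := by
  by_cases h : x (j + 1) = x j
  · rw [if_neg (by simp [wallSet, h]), h, mul_one]
  · rw [if_pos (by simp [wallSet, h]), Bool.eq_not.mpr h, sval_not]; ring

theorem even_card_wallSet (x : Fin (m + 1) → Bool) : Even (wallSet x).card := by
  have h1 : ∏ j, sval (x (j + 1)) = ∏ j, sval (x j) :=
    Equiv.prod_comp (Equiv.addRight (1 : Fin (m + 1))) fun j => sval (x j)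
  have h2 : ∏ j, (if j ∈ wallSet x then (-1 : ℝ) else 1) = (-1) ^ (wallSet x).card := by
    rw [prod_ite_mem, univ_inter, prod_const]
  simp only [sval_add_one, prod_mul_distrib, h2] at h1
  have h3 : ∏ j, sval (x j) ≠ 0 := prod_ne_zero_iff.mpr fun j _ => by
    rcases sval_eq (x j) with h | h <;> rw [h] <;> norm_num
  have h4 : (-1 : ℝ) ^ (wallSet x).card = 1 := by
    have : (∏ j, sval (x j)) * (-1 : ℝ) ^ (wallSet x).card = (∏ j, sval (x j)) * 1 := by
      rw [h1, mul_one]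
    exact mul_left_cancel₀ h3 this
  by_contra h
  rw [(Nat.not_even_iff_odd.mp h).neg_one_pow] at h4
  norm_num at h4

theorem signOf_wallSet {x : Fin (m + 1) → Bool} (hx : x 0 = true) : signOf (wallSet x) = x := by
  funext j
  refine Fin.induction (motive := fun j => signOf (wallSet x) j = x j) ?_ (fun j ih => ?_) j
  · rw [signOf_zero, hx]
  · apply sval_injective
    have e : (j.castSucc + 1 : Fin (m + 1)) = j.succ := Fin.coeSucc_eq_succ
    rw [← e, sval_signOf_add_one (even_card_wallSet x), sval_add_one, ih]

end Walls

section Partition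

variable {m M : ℕ}

/-- Boltzmann weight of a cyclic sequence of columns. -/
noncomputable def pathW (β : ℝ) (κ : Fin (m + 1) → ℝ) (s : Fin (m + 1) → St M) : ℝ :=
  Real.exp (∑ j, (κ j * vertE (s j) + β * horE (s j) (s (j + 1))))

theorem pathW_pos (β : ℝ) (κ : Fin (m + 1) → ℝ) (s : Fin (m + 1) → St M) : 0 < pathW β κ s :=
  Real.exp_pos _

/-- Partition function with prescribed sign changes in row `0`. -/
noncomputable def wallZ (M : ℕ) (β : ℝ) (κ : Fin (m + 1) → ℝ) (w : Fin (m + 1) → Bool) : ℝ :=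
  ∑ s : Fin (m + 1) → St M, if ∀ j, s (j + 1) 0 = xor (s j 0) (w j) then pathW β κ s else 0

/-- Partition function with prescribed spins in row `0`. -/
noncomputable def rowZ (M : ℕ) (β : ℝ) (κ : Fin (m + 1) → ℝ) (x : Fin (m + 1) → Bool) : ℝ :=
  ∑ s : Fin (m + 1) → St M, if ∀ j, s j 0 = x j then pathW β κ s else 0

/-- Partition function with prescribed spins in row `0` and column `0` frozen to `+`. -/
noncomputable def rowZPlus (M : ℕ) (β : ℝ) (x : Fin (m + 1) → Bool) : ℝ :=
  ∑ s : Fin (m + 1) → St M,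
    if (s 0 = fun _ => true) ∧ ∀ j, s j 0 = x j then pathW β (fun _ => β) s else 0

theorem rowZ_pos (β : ℝ) (κ : Fin (m + 1) → ℝ) (x : Fin (m + 1) → Bool) :
    0 < rowZ M β κ x := by
  refine sum_pos' (fun s _ => ?_) ⟨fun j _ => x j, mem_univ _, ?_⟩
  · split_ifs
    · exact (pathW_pos _ _ _).le
    · exact le_rfl
  · rw [if_pos fun _ => rfl]; exact pathW_pos _ _ _

theorem rowZPlus_pos (β : ℝ) {x : Fin (m + 1) → Bool} (hx : x 0 = true) :
    0 < rowZPlus M β x := by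
  refine sum_pos' (fun s _ => ?_) ⟨fun j _ => x j, mem_univ _, ?_⟩
  · split_ifs
    · exact (pathW_pos _ _ _).le
    · exact le_rfl
  · rw [if_pos ⟨funext fun _ => hx, fun _ => rfl⟩]; exact pathW_pos _ _ _

theorem wallZ_eq (β : ℝ) (κ : Fin (m + 1) → ℝ) {W : Finset (Fin (m + 1))} (hW : Even W.card) :
    wallZ M β κ (fun j => decide (j ∈ W)) =
      rowZ M β κ (signOf W) + rowZ M β κ fun j => !signOf W j := by
  rw [wallZ, rowZ, rowZ, ← sum_add_distrib]
  refine sum_congr rfl fun s _ => ?_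
  have hstep : ∀ j, signOf W (j + 1) = xor (signOf W j) (decide (j ∈ W)) := by
    intro j
    have : j ∈ W ↔ signOf W (j + 1) ≠ signOf W j := by
      conv_lhs => rw [← wallSet_signOf hW]
      simp [wallSet]
    by_cases h : j ∈ W
    · rw [decide_eq_true h, Bool.xor_true, Bool.eq_not.mpr (this.mp h)]
    · rw [decide_eq_false h, Bool.xor_false]
      by_contra h'; exact h (this.mpr h')
  have hexcl : ¬((∀ j, s j 0 = signOf W j) ∧ ∀ j, s j 0 = !signOf W j) := by
    rintro ⟨h1, h2⟩
    have := (h1 0).symm.trans (h2 0)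
    simp at this
  have hiff : (∀ j, s (j + 1) 0 = xor (s j 0) (decide (j ∈ W))) ↔
      (∀ j, s j 0 = signOf W j) ∨ ∀ j, s j 0 = !signOf W j := by
    constructor
    · intro h
      have hind : ∀ b : Bool, s 0 0 = xor b (signOf W 0) → ∀ j, s j 0 = xor b (signOf W j) := by
        intro b hb j
        refine Fin.induction (motive := fun j => s j 0 = xor b (signOf W j)) hb
          (fun j ih => ?_) j
        have e : (j.castSucc + 1 : Fin (m + 1)) = j.succ := Fin.coeSucc_eq_succ
        rw [← e, h, hstep, ih, Bool.xor_assoc]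
      cases h0 : s 0 0
      · right
        intro j
        rw [hind true (by rw [h0, signOf_zero]; rfl) j, Bool.true_xor]
      · left
        intro j
        rw [hind false (by rw [h0, signOf_zero]; rfl) j, Bool.false_xor]
    · rintro (h | h) j
      · rw [h, h, hstep]
      · rw [h, h, hstep, Bool.not_xor]
  by_cases h1 : ∀ j, s j 0 = signOf W j
  · have h2 : ¬ ∀ j, s j 0 = !signOf W j := fun h2 => hexcl ⟨h1, h2⟩
    rw [if_pos (hiff.mpr (Or.inl h1)), if_pos h1, if_neg h2, add_zero]
  · by_cases h2 : ∀ j, s j 0 = !signOf W j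
    · rw [if_pos (hiff.mpr (Or.inr h2)), if_neg h1, if_pos h2, zero_add]
    · rw [if_neg fun h => (hiff.mp h).elim h1 h2, if_neg h1, if_neg h2, add_zero]

theorem wallZ_pos (β : ℝ) (κ : Fin (m + 1) → ℝ) {W : Finset (Fin (m + 1))} (hW : Even W.card) :
    0 < wallZ M β κ fun j => decide (j ∈ W) := by
  rw [wallZ_eq β κ hW]
  exact add_pos (rowZ_pos _ _ _) (rowZ_pos _ _ _)

/-- The vector of the generator flipping row `0`. -/
noncomputable def flipVec (M : ℕ) : GenIdx M → ℝ := Pi.single (0, false) 1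

theorem columnRep_flipVec : (columnRep M).c (flipVec M) = gen (0, false) := by
  rw [columnRep_c]
  simp [flipVec, Pi.single_apply]

theorem columnRep_B_flipVec (v : GenIdx M → ℝ) : (columnRep M).B v (flipVec M) = v (0, false) := by
  rw [columnRep_B]
  simp [flipVec, Pi.single_apply, genSq]

/-- Transfer matrix of a column. -/
noncomputable def colMat (M : ℕ) (β κ : ℝ) : Matrix (St M) (St M) ℝ :=
  vertMat κ * horMat β false

theorem horMat_mul (β : ℝ) (w : Bool) : (horMat β w : Matrix (St M) (St M) ℝ) =
    horMat β false * (if w then (columnRep M).c (flipVec M) else 1) := by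
  cases w
  · simp
  · rw [if_pos rfl, columnRep_flipVec]
    ext s s'
    rw [gen, mul_signedPerm (flipLE_flipLE _), horMat, horMat, Matrix.of_apply, Matrix.of_apply]
    have hc : genCoeff (0, false) (flipLE 0 s') = 1 := by
      simp [genCoeff, genSq, genRow, rowSpin_mul_self]
    rw [hc, mul_one, horE_flipLE_right, horE_flip_zero _ rfl]
    have : flipLE 0 s' 0 = !s' 0 := by simp [flipLE]
    rw [this, Bool.xor_true, Bool.xor_false]
    congr 1
    simp only [eq_iff_iff]
    constructor
    · intro h; rw [h, Bool.not_not]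
    · intro h; rw [← h, Bool.not_not]

theorem colMat_mul_apply (β κ : ℝ) (w : Bool) (s s' : St M) :
    (colMat M β κ * (if w then (columnRep M).c (flipVec M) else 1)) s s' =
      if s' 0 = xor (s 0) w then Real.exp (κ * vertE s + β * horE s s') else 0 := by
  rw [colMat, Matrix.mul_assoc, ← horMat_mul, vertMat, diagonal_mul, horMat, Matrix.of_apply,
    mul_ite, mul_zero, ← Real.exp_add]

theorem trace_prod_colMat (β : ℝ) (κ : Fin (m + 1) → ℝ) (w : Fin (m + 1) → Bool) :
    (List.ofFn fun j => colMat M β (κ j) *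
      (if w j then (columnRep M).c (flipVec M) else 1)).prod.trace = wallZ M β κ w := by
  rw [trace_prod_ofFn, wallZ]
  refine sum_congr rfl fun s _ => ?_
  simp only [colMat_mul_apply]
  by_cases h : ∀ j, s (j + 1) 0 = xor (s j 0) (w j)
  · rw [if_pos h, pathW, Real.exp_sum]
    exact prod_congr rfl fun j _ => if_pos (h j)
  · rw [if_neg h]
    push Not at h
    obtain ⟨j, hj⟩ := h
    exact prod_eq_zero (mem_univ j) (if_neg hj)

theorem colMat_ne_zero (β κ : ℝ) : colMat M β κ ≠ 0 := by
  intro h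
  have h1 := colMat_mul_apply (M := M) β κ false (fun _ => true) fun _ => true
  rw [h] at h1
  simp only [Bool.false_eq_true, if_false, Matrix.zero_mul, Matrix.zero_apply, Bool.xor_false,
    if_true] at h1
  exact (Real.exp_pos _).ne h1

theorem impl_colMat {β : ℝ} (hβ : 0 < β) (κ : ℝ) : (columnRep M).Impl (colMat M β κ)
    (hypOp rowSwap (fun _ => Real.cosh (2 * κ)) (fun _ => -Real.sinh (2 * κ)) ∘ₗ
      hypOp linkSwap (linkC (Real.cosh (2 * β) / Real.sinh (2 * β)))
        (linkS (1 / Real.sinh (2 * β)))) :=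
  (impl_vertMat κ).mul (impl_horMat hβ)

/-- Skew matrix built from the two-wall ratios of a function of finite sets. -/
noncomputable def skewRatio (F : Finset (Fin (m + 1)) → ℝ) : Matrix (Fin (m + 1)) (Fin (m + 1)) ℝ :=
  Matrix.of fun i j => if i < j then F {i, j} / F ∅ else if j < i then -(F {i, j} / F ∅) else 0

theorem skewRatio_transpose (F : Finset (Fin (m + 1)) → ℝ) :
    (skewRatio F)ᵀ = -skewRatio F := by
  ext i j
  simp only [skewRatio, transpose_apply, of_apply, Matrix.neg_apply, pair_comm j i]
  rcases lt_trichotomy i j with h | h | h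
  · rw [if_neg h.not_gt, if_pos h, if_pos h]
  · subst h; simp
  · rw [if_pos h, if_neg h.not_gt, if_pos h, neg_neg]

theorem filter_finRange_pair {n : ℕ} {i j : Fin n} (h : i < j) :
    ((List.finRange n).filter fun l => decide (l ∈ ({i, j} : Finset (Fin n)))) = [i, j] := by
  refine List.Perm.eq_of_pairwise (le := (· < ·))
    (fun a b _ _ h h' => absurd h h'.not_gt) ?_ ?_ ?_
  · exact (List.pairwise_lt_finRange n).filter _
  · simp [h]
  · rw [List.perm_ext_iff_of_nodup ((List.nodup_finRange n).filter _) (by simp [h.ne])]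
    intro l; simp

theorem wallZ_sq {β : ℝ} (hβ : 0 < β) (κ : Fin (m + 1) → ℝ) (W : Finset (Fin (m + 1)))
    (hW : Even W.card) : wallZ M β κ (fun j => decide (j ∈ W)) ^ 2 =
      wallZ M β κ (fun _ => false) ^ 2 *
      ((skewRatio fun W => wallZ M β κ fun j => decide (j ∈ W)).submatrix
        (Subtype.val : W → _) Subtype.val).det := by
  obtain ⟨ψ, R, hI, hB, hprod⟩ := CliffordRep.prod_insertions (𝒞 := columnRep M) (m + 1)
    (fun j => colMat M β (κ j)) _ (flipVec M) (fun j => impl_colMat hβ (κ j))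
    fun j => colMat_ne_zero _ _
  set g := (List.ofFn fun j => colMat M β (κ j)).prod with hg
  have hcorr : ∀ W : Finset (Fin (m + 1)), (columnRep M).corr g
      (((List.finRange (m + 1)).filter fun j => j ∈ W).map ψ) =
      wallZ M β κ fun j => decide (j ∈ W) := by
    intro W
    have := hprod fun j => decide (j ∈ W)
    rw [← trace_prod_colMat, this, CliffordRep.corr, List.map_map]
    rfl
  have htr : g.trace = wallZ M β κ fun _ => false := by
    rw [← trace_prod_colMat]; simp [hg]
  have hψ : ∀ j, (columnRep M).B (ψ j) (ψ j) = 1 := fun j => by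
    rw [hB, columnRep_B_flipVec]; simp [flipVec]
  have hpair : (columnRep M).pairMatrix g ψ =
      skewRatio fun W => wallZ M β κ fun j => decide (j ∈ W) := by
    have h2 : ∀ i j, i < j → ((columnRep M).c (ψ i) * (columnRep M).c (ψ j) * g).trace =
        wallZ M β κ fun l => decide (l ∈ ({i, j} : Finset (Fin (m + 1)))) := by
      intro i j h
      rw [← hcorr, filter_finRange_pair h]
      simp [CliffordRep.corr]
    ext i j
    simp only [CliffordRep.pairMatrix, skewRatio, of_apply, htr, notMem_empty, decide_false]
    split_ifs with h h'
    · rw [h2 i j h]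
    · rw [h2 j i h', pair_comm]
    · rfl
  rw [← hcorr, hI.corr_filter_sq hψ (fun W hW => ?_) W hW, htr, hpair]
  rw [hcorr]
  exact (wallZ_pos _ _ hW).ne'

end Partition

end Schonmann

namespace Schonmann

open Matrix Finset

section Freezing

variable {m M : ℕ}

theorem rowSpin_mul_le (s : St M) (i j : ℕ) : rowSpin s i * rowSpin s j ≤ 1 := by
  rcases rowSpin_eq s i with h1 | h1 <;> rcases rowSpin_eq s j with h2 | h2 <;>
    rw [h1, h2] <;> norm_num

theorem vertE_top : vertE (fun _ => true : St M) = M + 1 := by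
  have h : ∀ P, rowSpin (fun _ => true : St M) P = 1 := fun P => by
    unfold rowSpin; split_ifs <;> rfl
  simp [vertE, h]

theorem vertE_lt {s : St M} (hs : s ≠ fun _ => true) : vertE s < M + 1 := by
  have hsum : ∑ _i : Fin (M + 1), (1 : ℝ) = M + 1 := by simp
  rw [← hsum]
  by_contra hcon
  apply hs
  have hall : ∀ i : Fin (M + 1), rowSpin s i * rowSpin s (i + 1) = 1 := by
    intro i
    by_contra h
    exact hcon (sum_lt_sum (fun j _ => rowSpin_mul_le s j (j + 1))
      ⟨i, mem_univ _, lt_of_le_of_ne (rowSpin_mul_le s i (i + 1)) h⟩)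
  have hone : ∀ n, n ≤ M + 1 → rowSpin s (M + 1 - n) = 1 := by
    intro n
    induction n with
    | zero => intro _; simp [rowSpin]
    | succ n ih =>
      intro hn
      have h := hall ⟨M + 1 - (n + 1), by omega⟩
      simp only at h
      rw [show M + 1 - (n + 1) + 1 = M + 1 - n by omega, ih (by omega), mul_one] at h
      exact h
  funext i
  have h := hone (M + 1 - i) (by omega)
  rw [show M + 1 - (M + 1 - (i : ℕ)) = i by omega, rowSpin, dif_pos i.2] at h
  exact sval_injective (h.trans sval_true.symm)

/-- Couplings with an additional field `K` on column `0`. -/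
noncomputable def freezeK (m : ℕ) (β K : ℝ) : Fin (m + 1) → ℝ := fun j => β + if j = 0 then K else 0

theorem pathW_freezeK (β K : ℝ) (s : Fin (m + 1) → St M) :
    pathW β (freezeK m β K) s = pathW β (fun _ => β) s * Real.exp (K * vertE (s 0)) := by
  rw [pathW, pathW, ← Real.exp_add]
  congr 1
  have : K * vertE (s 0) = ∑ j, if j = 0 then K * vertE (s j) else 0 := by simp
  rw [this, ← sum_add_distrib]
  refine sum_congr rfl fun j _ => ?_
  rw [freezeK]
  split_ifs <;> ring

theorem tendsto_rowZ_freezeK (β : ℝ) (x : Fin (m + 1) → Bool) :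
    Filter.Tendsto (fun K => rowZ M β (freezeK m β K) x * Real.exp (-(K * (M + 1)))) Filter.atTop
      (nhds (rowZPlus M β x)) := by
  simp only [rowZ, Finset.sum_mul]
  refine tendsto_finsetSum _ fun s _ => ?_
  by_cases hx : ∀ j, s j 0 = x j
  · simp only [hx, implies_true, if_true, and_true, pathW_freezeK, mul_assoc, ← Real.exp_add]
    by_cases h0 : s 0 = fun _ => true
    · simp only [h0, if_true, vertE_top, add_neg_cancel, Real.exp_zero, mul_one]
      exact tendsto_const_nhds
    · simp only [h0, if_false]
      rw [← mul_zero (pathW β (fun _ => β) s)]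
      refine Filter.Tendsto.const_mul _ ?_
      have h1 : ∀ K, K * vertE (s 0) + -(K * (M + 1)) = -(K * (M + 1 - vertE (s 0))) :=
        fun K => by ring
      simp only [h1]
      refine Real.tendsto_exp_neg_atTop_nhds_zero.comp ?_
      exact Filter.tendsto_id.atTop_mul_const (sub_pos.mpr (vertE_lt h0))
  · simp only [hx, if_false, and_false, zero_mul]
    exact tendsto_const_nhds

theorem rowZPlus_eq_zero (β : ℝ) {x : Fin (m + 1) → Bool} (hx : x 0 = false) :
    rowZPlus M β x = 0 := by
  refine sum_eq_zero fun s _ => if_neg ?_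
  rintro ⟨h1, h2⟩
  have := h2 0
  rw [h1, hx] at this
  simp at this

theorem tendsto_wallZ_freezeK (β : ℝ) {W : Finset (Fin (m + 1))} (hW : Even W.card) :
    Filter.Tendsto (fun K => wallZ M β (freezeK m β K) (fun j => decide (j ∈ W)) *
      Real.exp (-(K * (M + 1)))) Filter.atTop (nhds (rowZPlus M β (signOf W))) := by
  simp only [wallZ_eq β _ hW, add_mul]
  have h := (tendsto_rowZ_freezeK (M := M) β (signOf W)).add
    (tendsto_rowZ_freezeK (M := M) β fun j => !signOf W j)
  rwa [rowZPlus_eq_zero (x := fun j => !signOf W j) β (by rw [signOf_zero]; rfl), add_zero] at h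

/-- Squared Pfaffian structure of the partition functions with row `0` prescribed. -/
theorem rowZPlus_sq {β : ℝ} (hβ : 0 < β) (W : Finset (Fin (m + 1))) (hW : Even W.card) :
    rowZPlus M β (signOf W) ^ 2 = rowZPlus M β (fun _ : Fin (m + 1) => true) ^ 2 *
      ((skewRatio fun W : Finset (Fin (m + 1)) => rowZPlus M β (signOf W)).submatrix
        (Subtype.val : W → _) Subtype.val).det := by
  have hemp : signOf (∅ : Finset (Fin (m + 1))) = fun _ => true := by funext j; simp [signOf]
  have hconst : (fun _ => false : Fin (m + 1) → Bool) =
      fun j => decide (j ∈ (∅ : Finset (Fin (m + 1)))) := by simp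
  have hT := fun {W : Finset (Fin (m + 1))} => tendsto_wallZ_freezeK (M := M) β (W := W)
  have hT0 := hT (W := ∅) (by simp)
  rw [hemp] at hT0
  have hp0 : 0 < rowZPlus M β (fun _ : Fin (m + 1) => true) := rowZPlus_pos β rfl
  have hentry : ∀ i j : Fin (m + 1), Filter.Tendsto (fun K => skewRatio (fun W =>
      wallZ M β (freezeK m β K) fun j => decide (j ∈ W)) i j) Filter.atTop
      (nhds (skewRatio (fun W : Finset (Fin (m + 1)) => rowZPlus M β (signOf W)) i j)) := by
    have hr : ∀ i j : Fin (m + 1), i ≠ j → Filter.Tendsto (fun K => wallZ M β (freezeK m β K)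
        (fun l => decide (l ∈ ({i, j} : Finset (Fin (m + 1))))) /
        wallZ M β (freezeK m β K) (fun l => decide (l ∈ (∅ : Finset (Fin (m + 1))))))
        Filter.atTop (nhds (rowZPlus M β (signOf {i, j}) /
          rowZPlus M β (signOf (∅ : Finset (Fin (m + 1)))))) := by
      intro i j hij
      rw [hemp]
      have h := (hT (W := {i, j}) (by rw [card_pair hij]; exact even_two)).div hT0 hp0.ne'
      refine h.congr fun K => ?_
      exact mul_div_mul_right _ _ (Real.exp_pos _).ne'
    intro i j
    simp only [skewRatio, of_apply]
    rcases lt_trichotomy i j with h | h | h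
    · simp only [h, if_true]; exact hr i j h.ne
    · subst h; simp
    · simp only [h, h.not_gt, if_true, if_false]; exact (hr i j h.ne').neg
  have hdet : Filter.Tendsto (fun K => ((skewRatio fun W =>
      wallZ M β (freezeK m β K) fun j => decide (j ∈ W)).submatrix
        (Subtype.val : W → Fin (m + 1)) (Subtype.val : W → Fin (m + 1))).det) Filter.atTop
      (nhds ((skewRatio fun W : Finset (Fin (m + 1)) => rowZPlus M β (signOf W)).submatrix
        (Subtype.val : W → Fin (m + 1)) (Subtype.val : W → Fin (m + 1))).det) := by
    have hm : Filter.Tendsto (fun K => (skewRatio fun W =>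
      wallZ M β (freezeK m β K) fun j => decide (j ∈ W)).submatrix
        (Subtype.val : W → Fin (m + 1)) (Subtype.val : W → Fin (m + 1))) Filter.atTop
      (nhds ((skewRatio fun W : Finset (Fin (m + 1)) => rowZPlus M β (signOf W)).submatrix
        (Subtype.val : W → Fin (m + 1)) (Subtype.val : W → Fin (m + 1)))) :=
      tendsto_pi_nhds.mpr fun i => tendsto_pi_nhds.mpr fun j => hentry i.1 j.1
    exact ((Continuous.matrix_det continuous_id).tendsto _).comp hm
  refine tendsto_nhds_unique ((hT hW).pow 2) (((hT0.pow 2).mul hdet).congr fun K => ?_)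
  rw [mul_pow, mul_pow, wallZ_sq hβ (freezeK m β K) W hW, hconst]
  ring

end Freezing

end Schonmann

namespace Schonmann

open Matrix Finset

section Spectral

variable {ι : Type*} [Fintype ι]

theorem exists_orthonormal_eigenbasis [DecidableEq ι] (f : (ι → ℝ) →ₗ[ℝ] (ι → ℝ))
    (hf : ∀ v w, f v ⬝ᵥ w = v ⬝ᵥ f w) :
    ∃ (b : ι → ι → ℝ) (μ : ι → ℝ), (∀ i, f (b i) = μ i • b i) ∧ (∀ i, b i ⬝ᵥ b i = 1) ∧
      ∀ v, v = ∑ i, (b i ⬝ᵥ v) • b i := by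
  set A := LinearMap.toMatrix' f with hA
  have hmul : ∀ v, A *ᵥ v = f v := fun v => LinearMap.toMatrix'_mulVec f v
  have hH : A.IsHermitian := by
    ext i j
    rw [conjTranspose_apply, star_trivial, hA, LinearMap.toMatrix'_apply,
      LinearMap.toMatrix'_apply]
    have := hf (Pi.single i 1) (Pi.single j 1)
    simpa [dotProduct_single, single_dotProduct] using this
  refine ⟨fun i => (hH.eigenvectorBasis i).ofLp, hH.eigenvalues, fun i => ?_, fun i => ?_,
    fun v => ?_⟩
  · rw [← hmul, hH.mulVec_eigenvectorBasis]
  · have := hH.eigenvectorBasis.orthonormal.1 i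
    have h2 : inner ℝ (hH.eigenvectorBasis i) (hH.eigenvectorBasis i) = (1 : ℝ) := by
      rw [real_inner_self_eq_norm_sq, this, one_pow]
    rw [EuclideanSpace.inner_eq_star_dotProduct, star_trivial] at h2
    exact h2
  · have := hH.eigenvectorBasis.sum_repr' (WithLp.toLp 2 v)
    have h2 := congrArg WithLp.ofLp this
    rw [WithLp.ofLp_sum] at h2
    refine h2.symm.trans (sum_congr rfl fun i _ => ?_)
    rw [WithLp.ofLp_smul, EuclideanSpace.inner_eq_star_dotProduct, star_trivial, dotProduct_comm]

theorem hypOp_dotProduct {K : ι → ι} (hK : Function.Involutive K) {c s : ι → ℝ}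
    (hs : ∀ a, s (K a) = s a) (v w : ι → ℝ) : hypOp K c s v ⬝ᵥ w = v ⬝ᵥ hypOp K c s w := by
  simp only [hypOp, LinearMap.coe_mk, AddHom.coe_mk, dotProduct, add_mul, mul_add, sum_add_distrib]
  congr 1
  · exact sum_congr rfl fun a _ => by ring
  · rw [← Equiv.sum_comp (hK.toPerm K)]
    refine sum_congr rfl fun a _ => ?_
    simp only [Function.Involutive.coe_toPerm, hK a, hs]
    ring

theorem hypOp_hypOp {K : ι → ι} (hK : Function.Involutive K) {c s c' s' : ι → ℝ}
    (hs : ∀ a, s' (K a) = s' a) (hc : ∀ a, c' (K a) = c' a) (v : ι → ℝ) :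
    hypOp K c s (hypOp K c' s' v) =
      hypOp K (fun a => c a * c' a + s a * s' a) (fun a => c a * s' a + s a * c' a) v := by
  funext a
  simp only [hypOp, LinearMap.coe_mk, AddHom.coe_mk, hK a, hs, hc]
  ring

theorem hypOp_one_zero {K : ι → ι} (v : ι → ℝ) :
    hypOp K (fun _ => 1) (fun _ => 0) v = v := by
  funext a; simp [hypOp]

/-- An operator `A - x` with spectrum in `(-y, y)` cannot agree with `y` times an isometry. -/
theorem eq_zero_of_hypOp_sub {J L : ι → ι} (hJ : Function.Involutive J)
    (hL : Function.Involutive L) {c s : ι → ℝ} (hc : ∀ a, c (L a) = c a) (hs : ∀ a, s (L a) = s a)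
    {x y : ℝ} (h1 : ∀ a, (c a + s a - x) ^ 2 < y ^ 2) (h2 : ∀ a, (c a - s a - x) ^ 2 < y ^ 2)
    {z : ι → ℝ} (hz : ∀ a, c a * z a + s a * z (L a) - x * z a = y * z (J a)) : z = 0 := by
  have e1 : ∑ a, (y * z (J a)) ^ 2 = ∑ a, y ^ 2 * z a ^ 2 := by
    rw [← Equiv.sum_comp (hJ.toPerm J)]
    exact sum_congr rfl fun a _ => by simp only [Function.Involutive.coe_toPerm, hJ a]; ring
  simp only [← hz] at e1
  have e2 : ∀ f : ι → ℝ, ∑ a, f (L a) = ∑ a, f a := fun f => Equiv.sum_comp (hL.toPerm L) f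
  have e3 : ∑ a, (y ^ 2 * (z a ^ 2 + z (L a) ^ 2) - (c a * z a + s a * z (L a) - x * z a) ^ 2 -
      (c a * z (L a) + s a * z a - x * z (L a)) ^ 2) = 0 := by
    have h3 := e2 fun a => (c a * z a + s a * z (L a) - x * z a) ^ 2
    have h4 := e2 fun a => y ^ 2 * z a ^ 2
    simp only [hc, hs, hL _] at h3 h4
    simp only [sum_sub_distrib, mul_add, sum_add_distrib, h3, h4, e1]
    ring
  have e4 : ∀ a, y ^ 2 * (z a ^ 2 + z (L a) ^ 2) - (c a * z a + s a * z (L a) - x * z a) ^ 2 -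
      (c a * z (L a) + s a * z a - x * z (L a)) ^ 2 =
      (y ^ 2 - (c a + s a - x) ^ 2) * (z a + z (L a)) ^ 2 / 2 +
      (y ^ 2 - (c a - s a - x) ^ 2) * (z a - z (L a)) ^ 2 / 2 := fun a => by ring
  simp only [e4] at e3
  have hnn : ∀ a, 0 ≤ (y ^ 2 - (c a + s a - x) ^ 2) * (z a + z (L a)) ^ 2 / 2 ∧
      0 ≤ (y ^ 2 - (c a - s a - x) ^ 2) * (z a - z (L a)) ^ 2 / 2 := fun a =>
    ⟨by have := (sub_pos.mpr (h1 a)).le; positivity,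
      by have := (sub_pos.mpr (h2 a)).le; positivity⟩
  rw [sum_eq_zero_iff_of_nonneg fun a _ => add_nonneg (hnn a).1 (hnn a).2] at e3
  funext a
  have h0 := e3 a (mem_univ a)
  have h5 : (y ^ 2 - (c a + s a - x) ^ 2) * (z a + z (L a)) ^ 2 = 0 := by
    linarith [(hnn a).1, (hnn a).2]
  have h6 : (y ^ 2 - (c a - s a - x) ^ 2) * (z a - z (L a)) ^ 2 = 0 := by
    linarith [(hnn a).1, (hnn a).2]
  have h7 : z a + z (L a) = 0 :=
    pow_eq_zero_iff two_ne_zero |>.mp ((mul_eq_zero.mp h5).resolve_left (sub_pos.mpr (h1 a)).ne')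
  have h8 : z a - z (L a) = 0 :=
    pow_eq_zero_iff two_ne_zero |>.mp ((mul_eq_zero.mp h6).resolve_left (sub_pos.mpr (h2 a)).ne')
  show z a = 0
  linarith

end Spectral

/-- The decay rate of the disorder correlations. -/
noncomputable def decayRate (β : ℝ) : ℝ := Real.exp (-(2 * β)) / Real.tanh β

theorem tanh_pos {β : ℝ} (hβ : 0 < β) : 0 < Real.tanh β := by
  rw [Real.tanh_eq_sinh_div_cosh]
  exact div_pos (Real.sinh_pos_iff.mpr hβ) (Real.cosh_pos _)

theorem decayRate_pos {β : ℝ} (hβ : 0 < β) : 0 < decayRate β :=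
  div_pos (Real.exp_pos _) (tanh_pos hβ)

theorem betaCrit_pos : 0 < betaCrit := by
  refine div_pos (Real.log_pos ?_) two_pos
  have := Real.sqrt_pos.mpr (show (0 : ℝ) < 2 by norm_num)
  linarith

theorem decayRate_lt_one {β : ℝ} (hβ : betaCrit < β) : decayRate β < 1 := by
  have h0 : 0 < β := betaCrit_pos.trans hβ
  have hs : 0 < Real.sqrt 2 := Real.sqrt_pos.mpr (by norm_num)
  have hs2 : Real.sqrt 2 ^ 2 = 2 := Real.sq_sqrt (by norm_num)
  have h1 : 1 + Real.sqrt 2 < Real.exp (2 * β) := by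
    rw [← Real.log_lt_iff_lt_exp (by positivity)]
    unfold betaCrit at hβ; linarith
  have h2 : Real.exp (2 * β) = Real.exp β ^ 2 := by rw [← Real.exp_nat_mul]; norm_num
  have hE := Real.exp_pos β
  rw [decayRate, div_lt_one (tanh_pos h0), Real.exp_neg, Real.tanh_eq_sinh_div_cosh,
    inv_eq_one_div, div_lt_div_iff₀ (Real.exp_pos _) (Real.cosh_pos _), Real.sinh_eq, Real.cosh_eq,
    one_mul, Real.exp_neg]
  set E := Real.exp β
  rw [h2] at h1 ⊢
  have h3 : E * E⁻¹ = 1 := mul_inv_cancel₀ hE.ne'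
  have h4 : (E ^ 2 + 1) < (E ^ 2 - 1) * E ^ 2 := by nlinarith
  have h5 : 0 < E⁻¹ := inv_pos.mpr hE
  have h6 : E + E⁻¹ = (E ^ 2 + 1) * E⁻¹ := by
    rw [add_mul, pow_two, mul_assoc, h3, mul_one, one_mul]
  have h7 : E - E⁻¹ = (E ^ 2 - 1) * E⁻¹ := by
    rw [sub_mul, pow_two, mul_assoc, h3, mul_one, one_mul]
  rw [h6, h7]
  nlinarith [mul_lt_mul_of_pos_right h4 h5]

end Schonmann

namespace Schonmann

open Matrix Finset

section Gap

variable {M : ℕ}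

theorem hypOp_pos {ι : Type*} [Fintype ι] {J : ι → ι} (hJ : Function.Involutive J) {c s : ℝ}
    (hs : 0 ≤ s) (hcs : s < c) {w : ι → ℝ} (hw : w ≠ 0) :
    0 < w ⬝ᵥ hypOp J (fun _ => c) (fun _ => -s) w := by
  have e1 : ∑ a, w (J a) ^ 2 = ∑ a, w a ^ 2 := Equiv.sum_comp (hJ.toPerm J) fun a => w a ^ 2
  obtain ⟨a, ha⟩ := Function.ne_iff.mp hw
  have h1 : 0 < ∑ a, w a ^ 2 :=
    sum_pos' (fun a _ => sq_nonneg _) ⟨a, mem_univ a, by have : w a ≠ 0 := ha; positivity⟩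
  have h2 : ∑ a, ((c - s / 2) * w a ^ 2 - s / 2 * w (J a) ^ 2) ≤
      w ⬝ᵥ hypOp J (fun _ => c) (fun _ => -s) w := by
    refine sum_le_sum fun a _ => ?_
    simp only [hypOp, LinearMap.coe_mk, AddHom.coe_mk]
    nlinarith [mul_nonneg hs (sq_nonneg (w a - w (J a)))]
  rw [sum_sub_distrib, ← mul_sum, ← mul_sum, e1] at h2
  nlinarith [mul_pos (sub_pos.mpr hcs) h1]

theorem coth_two_mul {β : ℝ} (hβ : 0 < β) : Real.cosh (2 * β) / Real.sinh (2 * β) =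
    (1 / Real.tanh β + Real.tanh β) / 2 := by
  have h1 := (Real.sinh_pos_iff.mpr hβ).ne'
  have h2 := (Real.cosh_pos β).ne'
  rw [Real.cosh_two_mul, Real.sinh_two_mul, Real.tanh_eq_sinh_div_cosh]
  field_simp

theorem one_div_sinh_two_mul {β : ℝ} (hβ : 0 < β) : 1 / Real.sinh (2 * β) =
    (1 / Real.tanh β - Real.tanh β) / 2 := by
  have h1 := (Real.sinh_pos_iff.mpr hβ).ne'
  have h2 := (Real.cosh_pos β).ne'
  have h3 := Real.cosh_sq β
  rw [Real.sinh_two_mul, Real.tanh_eq_sinh_div_cosh]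
  field_simp
  linarith

theorem tanh_lt_one (β : ℝ) : Real.tanh β < 1 := by
  rw [Real.tanh_eq_sinh_div_cosh, div_lt_one (Real.cosh_pos _)]
  exact Real.sinh_lt_cosh β

/-- The spectral gap of the rotation induced by a homogeneous column. -/
theorem gap_of_eigen {β : ℝ} (hβ : 0 < β) {μ : ℝ} (h1 : decayRate β < μ)
    (h2 : μ < (decayRate β)⁻¹) {w z : GenIdx M → ℝ}
    (hz : z = hypOp rowSwap (fun _ => Real.cosh (2 * β)) (fun _ => -Real.sinh (2 * β)) w)
    (hw : hypOp linkSwap (linkC (Real.cosh (2 * β) / Real.sinh (2 * β)))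
        (linkS (1 / Real.sinh (2 * β))) z = μ • w) : w = 0 := by
  set ch := Real.cosh (2 * β)
  set sh := Real.sinh (2 * β)
  have hcs : ch ^ 2 - sh ^ 2 = 1 := Real.cosh_sq_sub_sinh_sq _
  have hwz : w = hypOp rowSwap (fun _ => ch) (fun _ => sh) z := by
    rw [hz, hypOp_hypOp rowSwap_involutive (fun _ => rfl) fun _ => rfl]
    have e1 : ch * ch + sh * -sh = 1 := by linarith
    have e2 : ch * -sh + sh * ch = 0 := by ring
    simp only [e1, e2, hypOp_one_zero]
  suffices hz0 : z = 0 by rw [hwz, hz0, map_zero]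
  have hμ : 0 < μ := (decayRate_pos hβ).trans h1
  have ht := tanh_pos hβ
  have ht1 := tanh_lt_one β
  have hE : 0 < Real.exp (2 * β) := Real.exp_pos _
  have hEe : ch + sh = Real.exp (2 * β) := Real.cosh_add_sinh _
  have hEm : ch - sh = (Real.exp (2 * β))⁻¹ := by rw [← Real.exp_neg]; exact Real.cosh_sub_sinh _
  have g1 : 1 < μ * Real.exp (2 * β) * Real.tanh β := by
    rw [decayRate, Real.exp_neg, inv_eq_one_div, div_div, div_lt_iff₀ (by positivity)] at h1
    linarith
  have g2 : μ < Real.exp (2 * β) * Real.tanh β := by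
    rw [decayRate, Real.exp_neg] at h2
    refine h2.trans_eq ?_
    field_simp
  have key : ∀ κ : ℝ, Real.tanh β ≤ κ → κ ≤ 1 / Real.tanh β →
      (κ - μ * ch) ^ 2 < (μ * sh) ^ 2 := by
    intro κ hκ1 hκ2
    have e : (κ - μ * ch) ^ 2 - (μ * sh) ^ 2 =
        (κ - μ * Real.exp (2 * β)) * (κ - μ * (Real.exp (2 * β))⁻¹) := by
      rw [← hEm, ← hEe]; ring
    have p1 : κ < μ * Real.exp (2 * β) :=
      hκ2.trans_lt (by rw [div_lt_iff₀ ht]; exact g1)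
    have p2 : μ * (Real.exp (2 * β))⁻¹ < κ := by
      refine lt_of_lt_of_le ?_ hκ1
      rw [← div_eq_mul_inv, div_lt_iff₀ hE]
      linarith
    nlinarith [mul_pos (sub_pos.mpr p1) (sub_pos.mpr p2)]
  have hinv : Real.tanh β ≤ 1 / Real.tanh β := by
    rw [le_div_iff₀ ht]; nlinarith
  have hκ : ∀ a : GenIdx M, (linkC (ch / sh) a + linkS (1 / sh) a = 1 ∨
      linkC (ch / sh) a + linkS (1 / sh) a = 1 / Real.tanh β) ∧
      (linkC (ch / sh) a - linkS (1 / sh) a = 1 ∨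
      linkC (ch / sh) a - linkS (1 / sh) a = Real.tanh β) := by
    intro a
    have e1 := coth_two_mul hβ
    have e2 := one_div_sinh_two_mul hβ
    unfold linkC linkS
    split_ifs
    · simp
    · rw [e1, e2]
      exact ⟨Or.inr (by ring), Or.inr (by ring)⟩
  have h11 : 1 ≤ 1 / Real.tanh β := by rw [le_div_iff₀ ht]; linarith
  refine eq_zero_of_hypOp_sub rowSwap_involutive linkSwap_involutive (linkC_linkSwap (ch / sh))
    (linkS_linkSwap (1 / sh)) (x := μ * ch) (y := μ * sh) (fun a => ?_) (fun a => ?_) fun a => ?_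
  · rcases (hκ a).1 with h | h <;> rw [h]
    · exact key _ ht1.le h11
    · exact key _ hinv le_rfl
  · rcases (hκ a).2 with h | h <;> rw [h]
    · exact key _ ht1.le h11
    · exact key _ le_rfl hinv
  · have := congrFun hw a
    rw [hwz] at this
    simp only [hypOp, LinearMap.coe_mk, AddHom.coe_mk, Pi.smul_apply, smul_eq_mul] at this
    linarith

theorem linkSwap_zero : linkSwap ((0, false) : GenIdx M) = (0, false) := by simp [linkSwap]

theorem hypOp_linkSwap_flipVec (c s : ℝ) :
    hypOp linkSwap (linkC c) (linkS s) (flipVec M) = flipVec M := by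
  funext a
  simp only [hypOp, LinearMap.coe_mk, AddHom.coe_mk, flipVec, Pi.single_apply, linkC, linkS]
  by_cases h : a = (0, false)
  · subst h; simp [linkSwap_zero]
  · have h2 : linkSwap a ≠ (0, false) := fun h3 => h (by
      rw [← linkSwap_involutive a, h3, linkSwap_zero])
    simp [h, h2]

/-- Explicit inversion of `1 + R ^ N` on the orbit of the flip generator, where `R` is the
rotation induced by a homogeneous column. -/
theorem exists_solve_one_add_pow {β : ℝ} (hβ : 0 < β) {n N : ℕ} (hn : n ≤ N) :
    ∃ v : GenIdx M → ℝ,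
      v + ((hypOp rowSwap (fun _ => Real.cosh (2 * β)) (fun _ => -Real.sinh (2 * β)) ∘ₗ
        hypOp linkSwap (linkC (Real.cosh (2 * β) / Real.sinh (2 * β)))
        (linkS (1 / Real.sinh (2 * β)))) ^ N) v =
      ((hypOp rowSwap (fun _ => Real.cosh (2 * β)) (fun _ => -Real.sinh (2 * β)) ∘ₗ
        hypOp linkSwap (linkC (Real.cosh (2 * β) / Real.sinh (2 * β)))
        (linkS (1 / Real.sinh (2 * β)))) ^ n) (flipVec M) ∧
      v (0, false) ≤ max (decayRate β ^ n) (decayRate β ^ (N - n)) := by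
  set Bop : (GenIdx M → ℝ) →ₗ[ℝ] (GenIdx M → ℝ) :=
    hypOp rowSwap (fun _ => Real.cosh (2 * β)) (fun _ => -Real.sinh (2 * β)) with hBop
  set A : (GenIdx M → ℝ) →ₗ[ℝ] (GenIdx M → ℝ) :=
    hypOp linkSwap (linkC (Real.cosh (2 * β) / Real.sinh (2 * β)))
      (linkS (1 / Real.sinh (2 * β))) with hA
  set t := Real.tanh β with ht
  have ht0 : 0 < t := tanh_pos hβ
  set c' := (Real.sqrt (1 / t) + Real.sqrt t) / 2 with hc'
  set s' := (Real.sqrt (1 / t) - Real.sqrt t) / 2 with hs'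
  have q1 : Real.sqrt (1 / t) ^ 2 = 1 / t := Real.sq_sqrt (by positivity)
  have q2 : Real.sqrt t ^ 2 = t := Real.sq_sqrt ht0.le
  have q3 : Real.sqrt (1 / t) * Real.sqrt t = 1 := by
    rw [← Real.sqrt_mul (by positivity), one_div, inv_mul_cancel₀ ht0.ne', Real.sqrt_one]
  set Ah : (GenIdx M → ℝ) →ₗ[ℝ] (GenIdx M → ℝ) := hypOp linkSwap (linkC c') (linkS s') with hAh
  set Ai : (GenIdx M → ℝ) →ₗ[ℝ] (GenIdx M → ℝ) := hypOp linkSwap (linkC c') (linkS (-s')) with hAi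
  have hAA : ∀ v, Ah (Ah v) = A v := by
    intro v
    rw [hAh, hypOp_hypOp linkSwap_involutive (linkS_linkSwap _) (linkC_linkSwap _), hA]
    congr 2 <;> funext a
    · unfold linkC linkS; split_ifs
      · ring
      · rw [coth_two_mul hβ, ← ht, hc', hs']; linear_combination (1 / 2) * q1 + (1 / 2) * q2
    · unfold linkC linkS; split_ifs
      · ring
      · rw [one_div_sinh_two_mul hβ, ← ht, hc', hs']
        linear_combination (1 / 2) * q1 - (1 / 2) * q2
  have hinv1 : ∀ v, Ai (Ah v) = v := by
    intro v
    rw [hAi, hAh, hypOp_hypOp linkSwap_involutive (linkS_linkSwap _) (linkC_linkSwap _)]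
    conv_rhs => rw [← hypOp_one_zero (K := linkSwap) v]
    congr 2 <;> funext a
    · unfold linkC linkS; split_ifs
      · ring
      · rw [hc', hs']; linear_combination q3
    · unfold linkC linkS; split_ifs <;> ring
  have hinv2 : ∀ v, Ah (Ai v) = v := by
    intro v
    rw [hAi, hAh, hypOp_hypOp linkSwap_involutive (linkS_linkSwap _) (linkC_linkSwap _)]
    conv_rhs => rw [← hypOp_one_zero (K := linkSwap) v]
    congr 2 <;> funext a
    · unfold linkC linkS; split_ifs
      · ring
      · rw [hc', hs']; linear_combination q3
    · unfold linkC linkS; split_ifs <;> ring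
  have hAsym : ∀ v w, Ah v ⬝ᵥ w = v ⬝ᵥ Ah w :=
    hypOp_dotProduct linkSwap_involutive (linkS_linkSwap _)
  have hBsym : ∀ v w, Bop v ⬝ᵥ w = v ⬝ᵥ Bop w :=
    hypOp_dotProduct rowSwap_involutive fun _ => rfl
  obtain ⟨b, μ, hb, hb1, hsum⟩ := exists_orthonormal_eigenbasis (Ah ∘ₗ Bop ∘ₗ Ah) fun v w => by
    simp only [LinearMap.comp_apply, hAsym, hBsym]
  simp only [LinearMap.comp_apply] at hb
  have hbne : ∀ i, Ah (b i) ≠ 0 := fun i h => by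
    have := hb1 i
    rw [← hinv1 (b i), h, map_zero, zero_dotProduct] at this
    exact zero_ne_one this
  have hμpos : ∀ i, 0 < μ i := by
    intro i
    have h1 : μ i = Ah (b i) ⬝ᵥ Bop (Ah (b i)) := by
      rw [hAsym, hb, dotProduct_smul, hb1, smul_eq_mul, mul_one]
    rw [h1]
    exact hypOp_pos rowSwap_involutive (Real.sinh_pos_iff.mpr (by linarith)).le
      (Real.sinh_lt_cosh _) (hbne i)
  have hgap : ∀ i, μ i ≤ decayRate β ∨ (decayRate β)⁻¹ ≤ μ i := by
    intro i
    by_contra! h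
    refine hbne i (gap_of_eigen hβ h.1 h.2 rfl ?_)
    rw [← hA, ← hBop, ← hAA, hb, map_smul]
  have hR : ∀ i, (Bop ∘ₗ A) (Ai (b i)) = μ i • Ai (b i) := by
    intro i
    rw [LinearMap.comp_apply, ← hAA, hinv2, ← map_smul, ← hb, hinv1]
  have hRn : ∀ k i, ((Bop ∘ₗ A) ^ k) (Ai (b i)) = μ i ^ k • Ai (b i) := by
    intro k i
    induction k with
    | zero => simp
    | succ k ih => rw [pow_succ, Module.End.mul_apply, hR, map_smul, ih, smul_smul, pow_succ']
  have he : flipVec M = ∑ i, (b i ⬝ᵥ flipVec M) • Ai (b i) := by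
    conv_lhs => rw [← hypOp_linkSwap_flipVec (M := M) c' (-s'), ← hAi, hsum (flipVec M), map_sum]
    simp only [map_smul]
  have hden : ∀ i, 0 < 1 + μ i ^ N := fun i => by have := hμpos i; positivity
  refine ⟨∑ i, ((b i ⬝ᵥ flipVec M) * (μ i ^ n / (1 + μ i ^ N))) • Ai (b i), ?_, ?_⟩
  · conv_rhs => rw [he]
    rw [map_sum, map_sum, ← sum_add_distrib]
    refine sum_congr rfl fun i _ => ?_
    rw [map_smul, map_smul, hRn, hRn, smul_smul, smul_smul, ← add_smul]
    congr 1
    have := (hden i).ne'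
    field_simp
  · have hflip : ∀ v : GenIdx M → ℝ, v (0, false) = v ⬝ᵥ flipVec M := fun v => by
      simp [flipVec, dotProduct_single]
    have hAe : ∀ i, Ai (b i) ⬝ᵥ flipVec M = b i ⬝ᵥ flipVec M := fun i => by
      rw [hAi, hypOp_dotProduct linkSwap_involutive (linkS_linkSwap _), hypOp_linkSwap_flipVec]
    refine (hflip _).trans_le ?_
    rw [sum_dotProduct]
    simp only [smul_dotProduct, smul_eq_mul, hAe]
    have hone : ∑ i, (b i ⬝ᵥ flipVec M) ^ 2 = 1 := by
      have h1 : flipVec M ⬝ᵥ flipVec M = 1 := by rw [← hflip]; simp [flipVec]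
      nth_rewrite 1 [hsum (flipVec M)] at h1
      rw [sum_dotProduct] at h1
      simpa only [smul_dotProduct, smul_eq_mul, ← pow_two] using h1
    have hρ := decayRate_pos hβ
    have hbd : ∀ i, μ i ^ n / (1 + μ i ^ N) ≤ max (decayRate β ^ n) (decayRate β ^ (N - n)) := by
      intro i
      have hp := hμpos i
      rcases hgap i with h | h
      · refine le_max_of_le_left ?_
        rw [div_le_iff₀ (hden i)]
        have h1 := pow_le_pow_left₀ hp.le h n
        have : 0 ≤ decayRate β ^ n * μ i ^ N := by positivity
        nlinarith
      · refine le_max_of_le_right ?_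
        rw [div_le_iff₀ (hden i)]
        have h1 : 1 ≤ decayRate β * μ i := by
          rw [inv_eq_one_div, div_le_iff₀ hρ] at h; linarith
        have h2 := one_le_pow₀ h1 (n := N - n)
        rw [mul_pow] at h2
        have h3 : μ i ^ N = μ i ^ n * μ i ^ (N - n) := by rw [← pow_add, Nat.add_sub_cancel' hn]
        have h4 : 0 < decayRate β ^ (N - n) := by positivity
        have h5 : 0 < μ i ^ n := by positivity
        rw [h3]
        nlinarith [mul_le_mul_of_nonneg_left h2 h5.le]
    calc ∑ i, b i ⬝ᵥ flipVec M * (μ i ^ n / (1 + μ i ^ N)) * b i ⬝ᵥ flipVec M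
        ≤ ∑ i, (b i ⬝ᵥ flipVec M) ^ 2 * max (decayRate β ^ n) (decayRate β ^ (N - n)) := by
          refine sum_le_sum fun i _ => ?_
          nlinarith [mul_le_mul_of_nonneg_left (hbd i) (sq_nonneg (b i ⬝ᵥ flipVec M))]
      _ = _ := by rw [← sum_mul, hone, one_mul]

end Gap

end Schonmann

namespace Schonmann

open Matrix Finset

theorem CliffordRep.Impl.pow {V S : Type*} [AddCommGroup V] [Module ℝ V] [Fintype S]
    [DecidableEq S] {𝒞 : CliffordRep V S} {g : Matrix S S ℝ} {R : V →ₗ[ℝ] V} (h : 𝒞.Impl g R)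
    (n : ℕ) : 𝒞.Impl (g ^ n) (R ^ n) := by
  intro v
  induction n with
  | zero => simp
  | succ n ih => rw [pow_succ', pow_succ', Matrix.mul_assoc, ih, ← Matrix.mul_assoc, h,
      Matrix.mul_assoc]; rfl

theorem prod_ofFn_last {S : Type*} [Fintype S] [DecidableEq S] (T F : Matrix S S ℝ) (n : ℕ) :
    (List.ofFn fun j : Fin (n + 1) => T * if (j : ℕ) = n then F else 1).prod = T ^ (n + 1) * F := by
  rw [List.ofFn_succ', List.concat_eq_append, List.prod_append]
  have : (fun j : Fin n => T * if (j.castSucc : ℕ) = n then F else 1) = fun _ => T := by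
    funext j
    rw [if_neg (by have := j.2; rw [Fin.val_castSucc]; omega), mul_one]
  rw [this, List.ofFn_const, List.prod_replicate]
  simp [pow_succ, Matrix.mul_assoc]

theorem prod_ofFn_two {S : Type*} [Fintype S] [DecidableEq S] (T F : Matrix S S ℝ) (p q : ℕ) :
    (List.ofFn fun j : Fin (p + 1 + (q + 1)) =>
      T * if (j : ℕ) = p ∨ (j : ℕ) = p + 1 + q then F else 1).prod =
      T ^ (p + 1) * F * (T ^ (q + 1) * F) := by
  rw [List.ofFn_add, List.prod_append, ← prod_ofFn_last, ← prod_ofFn_last]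
  congr 3 <;> funext j <;> congr 1
  · have := j.2
    simp only [Fin.val_castLE]
    congr 1
    simp only [eq_iff_iff]; omega
  · have := j.2
    simp only [Fin.val_natAdd]
    congr 1
    simp only [eq_iff_iff]; omega

section Decay

variable {M : ℕ}

theorem trace_two_flips_le {β : ℝ} (hβ : 0 < β) (a b : ℕ)
    (h0 : 0 ≤ (colMat M β β ^ (a + b)).trace) :
    (colMat M β β ^ a * (columnRep M).c (flipVec M) *
      (colMat M β β ^ b * (columnRep M).c (flipVec M))).trace ≤
      2 * max (decayRate β ^ a) (decayRate β ^ b) * (colMat M β β ^ (a + b)).trace := by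
  obtain ⟨v, hv, hle⟩ := exists_solve_one_add_pow (M := M) hβ (Nat.le_add_right a b)
  have hI := impl_colMat (M := M) hβ β
  set R := hypOp rowSwap (fun _ => Real.cosh (2 * β)) (fun _ => -Real.sinh (2 * β)) ∘ₗ
      hypOp linkSwap (linkC (Real.cosh (2 * β) / Real.sinh (2 * β)))
        (linkS (1 / Real.sinh (2 * β))) with hR
  set e := flipVec M
  have h1 : (colMat M β β ^ a * (columnRep M).c e * (colMat M β β ^ b * (columnRep M).c e)).trace
      = ((columnRep M).c e * (columnRep M).c ((R ^ a) e) * colMat M β β ^ (a + b)).trace := by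
    rw [(hI.pow a) e, ← Matrix.mul_assoc, trace_mul_comm, Matrix.mul_assoc, Matrix.mul_assoc,
      ← pow_add]
  have h2 := (hI.pow (a + b)).two_point v e
  rw [← Matrix.trace_add, ← Matrix.add_mul, ← Matrix.add_mul, ← map_add, hv] at h2
  have h3 : (R ^ (a + b)) v = (R ^ a) e - v := by rw [← hv]; abel
  rw [h1, (columnRep M).anti, Matrix.sub_mul, Matrix.trace_sub, Matrix.smul_mul, Matrix.one_mul,
    Matrix.trace_smul, h2, h3, (columnRep M).symm e, map_sub, LinearMap.sub_apply, smul_eq_mul,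
    columnRep_B_flipVec v]
  rw [Nat.add_sub_cancel_left] at hle
  nlinarith [mul_le_mul_of_nonneg_right hle h0]

theorem wallZ_two_le {β : ℝ} (hβ : 0 < β) (p q : ℕ) :
    wallZ (m := p + 1 + q) M β (fun _ => β) (fun j => decide ((j : ℕ) = p ∨ (j : ℕ) = p + 1 + q)) ≤
      2 * max (decayRate β ^ (p + 1)) (decayRate β ^ (q + 1)) *
        wallZ (m := p + 1 + q) M β (fun _ => β) fun _ => false := by
  have h0 : (colMat M β β ^ (p + 1 + (q + 1))).trace =
      wallZ (m := p + 1 + q) M β (fun _ => β) fun _ => false := by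
    rw [← trace_prod_colMat]
    simp only [Bool.false_eq_true, if_false, mul_one, List.ofFn_const, List.prod_replicate]
    rfl
  have h1 := trace_two_flips_le (M := M) hβ (p + 1) (q + 1)
    (by
      rw [h0]
      have := (wallZ_pos (m := p + 1 + q) (M := M) β (fun _ => β) (W := ∅) (by simp)).le
      simpa using this)
  rw [h0, ← prod_ofFn_two] at h1
  rw [← trace_prod_colMat]
  refine le_trans (le_of_eq ?_) h1
  simp only [decide_eq_true_eq]
  rfl

theorem pathW_comp_add {m : ℕ} (β κ : ℝ) (s : Fin (m + 1) → St M) (a : Fin (m + 1)) :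
    pathW β (fun _ => κ) (fun j => s (j + a)) = pathW β (fun _ => κ) s := by
  unfold pathW
  congr 1
  refine Eq.trans (sum_congr rfl fun j _ => ?_) (Equiv.sum_comp (Equiv.addRight a) fun j =>
    κ * vertE (s j) + β * horE (s j) (s (j + 1)))
  simp only [Equiv.coe_addRight, add_right_comm j 1 a]

theorem wallZ_comp_add {m : ℕ} (β κ : ℝ) (w : Fin (m + 1) → Bool) (a : Fin (m + 1)) :
    wallZ M β (fun _ => κ) (fun j => w (j + a)) = wallZ M β (fun _ => κ) w := by
  unfold wallZ
  rw [← Equiv.sum_comp ((Equiv.addRight a).symm.arrowCongr (Equiv.refl (St M)))]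
  refine sum_congr rfl fun s _ => ?_
  have e : ((Equiv.addRight a).symm.arrowCongr (Equiv.refl (St M))) s = fun j => s (j + a) := by
    funext j; simp [Equiv.arrowCongr]
  rw [e, pathW_comp_add]
  congr 1
  simp only [eq_iff_iff]
  constructor
  · intro h j
    have := h (j - a)
    rwa [add_right_comm, sub_add_cancel] at this
  · intro h j
    have := h (j + a)
    rwa [add_right_comm] at this

/-- Exponential decay of the two-wall ratio on the cylinder. -/
theorem wallZ_pair_le {m : ℕ} {β : ℝ} (hβ : 0 < β) {i j : Fin (m + 1)} (hij : i < j) :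
    wallZ M β (fun _ => β) (fun l => decide (l ∈ ({i, j} : Finset (Fin (m + 1))))) ≤
      2 * max (decayRate β ^ ((j : ℕ) - i)) (decayRate β ^ (m + 1 - ((j : ℕ) - i))) *
        wallZ (m := m) M β (fun _ => β) fun _ => false := by
  have hij' : (i : ℕ) < j := hij
  have hj := j.2
  obtain ⟨q, hq⟩ : ∃ q, (j : ℕ) - i = q + 1 := ⟨(j : ℕ) - i - 1, by omega⟩
  obtain ⟨p, hp⟩ : ∃ p, m = p + 1 + q := ⟨m - q - 1, by omega⟩
  subst hp
  rw [hq, show p + 1 + q + 1 - (q + 1) = p + 1 by omega, max_comm]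
  refine le_trans (le_of_eq ?_) (wallZ_two_le hβ p q)
  rw [← wallZ_comp_add β β _ (j + 1)]
  congr 1
  funext l
  congr 1
  simp only [mem_insert, mem_singleton, eq_iff_iff]
  have hl := l.2
  have hval : ∀ l : Fin (p + 1 + q + 1), ((l + (j + 1) : Fin (p + 1 + q + 1)) : ℕ) =
      if (l : ℕ) + j + 1 < p + 1 + q + 1 then (l : ℕ) + j + 1 else (l : ℕ) + j + 1 - (p + 1 + q + 1) := by
    intro l
    have hl := l.2
    rw [← add_assoc, Fin.val_add, Fin.val_add, Fin.val_one']
    have h1 : 1 % (p + 1 + q + 1) = 1 := Nat.mod_eq_of_lt (by omega)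
    rw [h1, Nat.mod_add_mod]
    split_ifs with h
    · exact Nat.mod_eq_of_lt h
    · rw [Nat.mod_eq_sub_mod (by omega), Nat.mod_eq_of_lt (by omega)]
  rw [Fin.ext_iff, Fin.ext_iff, hval]
  split_ifs <;> omega

end Decay

end Schonmann

namespace Schonmann

open Matrix Finset

theorem four_events {α : Type*} [DistribLattice α] [Fintype α] {w₁ w₂ w₃ w₄ : α → ℝ}
    (h₁ : ∀ a, 0 ≤ w₁ a) (h₂ : ∀ a, 0 ≤ w₂ a) (h₃ : ∀ a, 0 ≤ w₃ a) (h₄ : ∀ a, 0 ≤ w₄ a)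
    (hw : ∀ a b, w₁ a * w₂ b ≤ w₃ (a ⊓ b) * w₄ (a ⊔ b))
    {p₁ p₂ p₃ p₄ : α → Prop} [DecidablePred p₁] [DecidablePred p₂] [DecidablePred p₃]
    [DecidablePred p₄] (hp : ∀ a b, p₁ a → p₂ b → p₃ (a ⊓ b) ∧ p₄ (a ⊔ b)) :
    (∑ a, if p₁ a then w₁ a else 0) * (∑ a, if p₂ a then w₂ a else 0) ≤
      (∑ a, if p₃ a then w₃ a else 0) * ∑ a, if p₄ a then w₄ a else 0 := by
  refine four_functions_theorem_univ _ _ _ _ (fun a => ?_) (fun a => ?_) (fun a => ?_)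
    (fun a => ?_) fun a b => ?_
  · dsimp only; split_ifs; exacts [h₁ a, le_rfl]
  · dsimp only; split_ifs; exacts [h₂ a, le_rfl]
  · dsimp only; split_ifs; exacts [h₃ a, le_rfl]
  · dsimp only; split_ifs; exacts [h₄ a, le_rfl]
  · by_cases ha : p₁ a
    · by_cases hb : p₂ b
      · rw [if_pos ha, if_pos hb, if_pos (hp a b ha hb).1, if_pos (hp a b ha hb).2]
        exact hw a b
      · rw [if_neg hb, mul_zero]
        split_ifs <;> first | exact mul_nonneg (h₃ _) (h₄ _) | simp
    · rw [if_neg ha, zero_mul]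
      split_ifs <;> first | exact mul_nonneg (h₃ _) (h₄ _) | simp

theorem sval_pair_le (a a' b b' : Bool) : sval a * sval a' + sval b * sval b' ≤
    sval (a ⊓ b) * sval (a' ⊓ b') + sval (a ⊔ b) * sval (a' ⊔ b') := by
  cases a <;> cases a' <;> cases b <;> cases b' <;> norm_num [sval]

section Supermodular

variable {m M : ℕ}

theorem rowSpin_pair_le (a b a' b' : St M) (P Q : ℕ) :
    rowSpin a P * rowSpin a' Q + rowSpin b P * rowSpin b' Q ≤
      rowSpin (a ⊓ b) P * rowSpin (a' ⊓ b') Q + rowSpin (a ⊔ b) P * rowSpin (a' ⊔ b') Q := by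
  have h : ∀ s : St M, ∀ P, rowSpin s P = sval (if h : P < M + 1 then s ⟨P, h⟩ else true) := by
    intro s P; unfold rowSpin; split_ifs <;> rfl
  have hinf : ∀ s t : St M, ∀ P, rowSpin (s ⊓ t) P = sval ((if h : P < M + 1 then s ⟨P, h⟩ else true)
      ⊓ (if h : P < M + 1 then t ⟨P, h⟩ else true)) := by
    intro s t P; rw [h]; split_ifs <;> rfl
  have hsup : ∀ s t : St M, ∀ P, rowSpin (s ⊔ t) P = sval ((if h : P < M + 1 then s ⟨P, h⟩ else true)
      ⊔ (if h : P < M + 1 then t ⟨P, h⟩ else true)) := by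
    intro s t P; rw [h]; split_ifs <;> rfl
  rw [hinf, hinf, hsup, hsup, h a, h a', h b, h b']
  exact sval_pair_le _ _ _ _

theorem vertE_supermodular (a b : St M) : vertE a + vertE b ≤ vertE (a ⊓ b) + vertE (a ⊔ b) := by
  simp only [vertE, ← sum_add_distrib]
  exact sum_le_sum fun i _ => rowSpin_pair_le _ _ _ _ _ _

theorem horE_supermodular (a a' b b' : St M) :
    horE a a' + horE b b' ≤ horE (a ⊓ b) (a' ⊓ b') + horE (a ⊔ b) (a' ⊔ b') := by
  simp only [horE, ← sum_add_distrib]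
  refine sum_le_sum fun i _ => ?_
  split_ifs
  · simp
  · exact rowSpin_pair_le _ _ _ _ _ _

theorem pathW_supermodular {β : ℝ} (hβ : 0 ≤ β) (a b : Fin (m + 1) → St M) :
    pathW β (fun _ => β) a * pathW β (fun _ => β) b ≤
      pathW β (fun _ => β) (a ⊓ b) * pathW β (fun _ => β) (a ⊔ b) := by
  simp only [pathW, ← Real.exp_add, ← sum_add_distrib, Real.exp_le_exp, Pi.inf_apply, Pi.sup_apply]
  refine sum_le_sum fun j _ => ?_
  have h1 := mul_le_mul_of_nonneg_left (vertE_supermodular (a j) (b j)) hβ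
  have h2 := mul_le_mul_of_nonneg_left (horE_supermodular (a j) (a (j + 1)) (b j) (b (j + 1))) hβ
  linarith

/-- Reversal of all the spins of a column. -/
def flipSt (s : St M) : St M := fun i => !s i

theorem rowSpin_flipSt {s : St M} {P : ℕ} (h : P < M + 1) : rowSpin (flipSt s) P = -rowSpin s P := by
  rw [rowSpin, rowSpin, dif_pos h, dif_pos h, flipSt, sval_not]

theorem horE_flipSt (s s' : St M) : horE (flipSt s) (flipSt s') = horE s s' := by
  refine sum_congr rfl fun i _ => ?_
  rw [rowSpin_flipSt i.2, rowSpin_flipSt i.2, neg_mul_neg]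

theorem vertE_flip_supermodular (a b : St M) :
    vertE a + vertE (flipSt b) ≤ vertE (flipSt (a ⊓ b)) + vertE (a ⊔ b) := by
  simp only [vertE, ← sum_add_distrib]
  refine sum_le_sum fun i _ => ?_
  have hi := i.2
  by_cases h : (i : ℕ) + 1 < M + 1
  · rw [rowSpin_flipSt hi, rowSpin_flipSt hi, rowSpin_flipSt h, rowSpin_flipSt h, neg_mul_neg,
      neg_mul_neg]
    exact rowSpin_pair_le _ _ _ _ _ _
  · have e : ∀ s : St M, rowSpin s (i + 1) = 1 := fun s => by rw [rowSpin, dif_neg h]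
    rw [rowSpin_flipSt hi, rowSpin_flipSt hi]
    simp only [e, mul_one]
    simp only [rowSpin, dif_pos hi, Pi.inf_apply, Pi.sup_apply]
    rcases ha : a ⟨i, hi⟩ <;> rcases hb : b ⟨i, hi⟩ <;> norm_num [sval]

theorem rowZ_false_le {β : ℝ} (hβ : 0 ≤ β) :
    rowZ (m := m) M β (fun _ => β) (fun _ => false) ≤
      rowZ (m := m) M β (fun _ => β) fun _ => true := by
  have hflip : ∀ c : Bool, (∑ s : Fin (m + 1) → St M, if ∀ j, s j 0 = c then
      pathW β (fun _ => β) (fun j => flipSt (s j)) else 0) =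
      rowZ (m := m) M β (fun _ => β) (fun _ => !c) := by
    intro c
    have hinv : Function.Involutive fun (s : Fin (m + 1) → St M) j => flipSt (s j) := fun s => by
      funext j i; simp [flipSt]
    rw [rowZ, ← Equiv.sum_comp (hinv.toPerm _)]
    refine sum_congr rfl fun s _ => ?_
    have hs2 : (fun j => flipSt (flipSt (s j))) = s := hinv s
    simp only [Function.Involutive.coe_toPerm, hs2]
    refine if_congr ?_ rfl rfl
    simp [flipSt]
  have h := four_events (α := Fin (m + 1) → St M) (w₁ := pathW β fun _ => β)
    (w₂ := fun s => pathW β (fun _ => β) fun j => flipSt (s j))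
    (w₃ := fun s => pathW β (fun _ => β) fun j => flipSt (s j)) (w₄ := pathW β fun _ => β)
    (fun s => (pathW_pos _ _ _).le) (fun s => (pathW_pos _ _ _).le) (fun s => (pathW_pos _ _ _).le)
    (fun s => (pathW_pos _ _ _).le)
    (fun a b => by
      simp only [pathW, ← Real.exp_add, ← sum_add_distrib, Real.exp_le_exp, Pi.inf_apply,
        Pi.sup_apply, horE_flipSt]
      refine sum_le_sum fun j _ => ?_
      have h1 := mul_le_mul_of_nonneg_left (vertE_flip_supermodular (a j) (b j)) hβ
      have h2 := mul_le_mul_of_nonneg_left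
        (horE_supermodular (a j) (a (j + 1)) (b j) (b (j + 1))) hβ
      linarith)
    (p₁ := fun s => ∀ j, s j 0 = false) (p₂ := fun s => ∀ j, s j 0 = true)
    (p₃ := fun s => ∀ j, s j 0 = false) (p₄ := fun s => ∀ j, s j 0 = true)
    (fun a b ha hb => ⟨fun j => by simp [ha j], fun j => by simp [hb j]⟩)
  rw [hflip, hflip] at h
  have h0 := rowZ_pos (m := m) (M := M) β (fun _ => β) fun _ => true
  have h1 := rowZ_pos (m := m) (M := M) β (fun _ => β) fun _ => false
  change rowZ (m := m) M β (fun _ => β) (fun _ => false) * rowZ (m := m) M β (fun _ => β) (fun _ => false)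
    ≤ rowZ (m := m) M β (fun _ => β) (fun _ => true) * rowZ (m := m) M β (fun _ => β) (fun _ => true) at h
  nlinarith

theorem rowZPlus_mul_rowZ_le {β : ℝ} (hβ : 0 ≤ β) (x : Fin (m + 1) → Bool) :
    rowZPlus M β x * rowZ (m := m) M β (fun _ => β) (fun _ => true) ≤
      rowZ (m := m) M β (fun _ => β) x * rowZPlus M β fun _ : Fin (m + 1) => true := by
  refine four_events
    (w₁ := pathW β fun _ => β) (w₂ := pathW β fun _ => β) (w₃ := pathW β fun _ => β)
    (w₄ := pathW β fun _ => β) (fun s => (pathW_pos _ _ _).le) (fun s => (pathW_pos _ _ _).le)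
    (fun s => (pathW_pos _ _ _).le) (fun s => (pathW_pos _ _ _).le) (pathW_supermodular hβ) ?_
  rintro a b ⟨ha0, ha⟩ hb
  refine ⟨fun j => by simp [ha j, hb j], ?_, fun j => by simp [hb j]⟩
  funext i
  simp [ha0]

/-- Adding a column. -/
theorem rowZPlus_snoc {β : ℝ} {y : ℕ → Bool} (hy : y (m + 1) = true) :
    (∑ s : Fin (m + 2) → St M, if (s 0 = fun _ => true) ∧ (s (Fin.last _) = fun _ => true) ∧
        ∀ j, s j 0 = y j then pathW β (fun _ => β) s else 0) =
      Real.exp (β * (M + 1) + β * M) * rowZPlus M β (fun j : Fin (m + 1) => y j) := by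
  rw [rowZPlus, mul_sum]
  symm
  refine Fintype.sum_of_injective
    (fun s : Fin (m + 1) → St M => (Fin.snoc s fun _ => true : Fin (m + 2) → St M)) ?_ _ _ ?_ ?_
  · intro s t h
    funext j
    have := congrFun h j.castSucc
    simpa using this
  · intro s hs
    rw [if_neg]
    rintro ⟨-, h2, -⟩
    exact hs ⟨Fin.init s, by rw [← h2]; exact Fin.snoc_init_self s⟩
  · intro s
    have h0 : (Fin.snoc s (fun _ => true) : Fin (m + 2) → St M) 0 = s 0 := by
      rw [← Fin.castSucc_zero, Fin.snoc_castSucc]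
    by_cases hs : s 0 = fun _ => true
    · have hc : ((s 0 = fun _ => true) ∧ ∀ j : Fin (m + 1), s j 0 = y j) ↔
          ((Fin.snoc s (fun _ => true) : Fin (m + 2) → St M) 0 = fun _ => true) ∧
          ((Fin.snoc s (fun _ => true) : Fin (m + 2) → St M) (Fin.last _) = fun _ => true) ∧
          ∀ j : Fin (m + 2), (Fin.snoc s (fun _ => true) : Fin (m + 2) → St M) j 0 = y j := by
        rw [h0, Fin.snoc_last]
        refine ⟨fun h => ⟨h.1, rfl, fun j => ?_⟩, fun h => ⟨h.1, fun j => ?_⟩⟩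
        · refine Fin.lastCases ?_ (fun i => ?_) j
          · rw [Fin.snoc_last, Fin.val_last, hy]
          · rw [Fin.snoc_castSucc, Fin.val_castSucc]; exact h.2 i
        · have := h.2.2 j.castSucc
          rwa [Fin.snoc_castSucc, Fin.val_castSucc] at this
      rw [mul_ite, mul_zero]
      refine if_congr hc ?_ rfl
      rw [pathW, pathW, ← Real.exp_add, Fin.sum_univ_castSucc (n := m + 1), Fin.snoc_last,
        Fin.last_add_one, h0, hs, vertE_top]
      have hp : horE (fun _ => true : St M) (fun _ => true) = M := by
        have : ∀ P, rowSpin (fun _ => true : St M) P = 1 := fun P => by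
          unfold rowSpin; split_ifs <;> rfl
        simp only [horE, this, mul_one]
        rw [Fin.sum_univ_succ]
        simp
      rw [hp, add_comm]
      congr 2
      refine sum_congr rfl fun i _ => ?_
      rw [Fin.snoc_castSucc]
      congr 3
      refine Fin.lastCases ?_ (fun k => ?_) i
      · rw [Fin.last_add_one, hs, Fin.coeSucc_eq_succ, Fin.succ_last, Fin.snoc_last]
      · rw [Fin.coeSucc_eq_succ, Fin.coeSucc_eq_succ, ← Fin.castSucc_succ,
          Fin.snoc_castSucc]
    · rw [if_neg fun h => hs h.1, if_neg fun h => hs (h0 ▸ h.1), mul_zero]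

theorem rowSpin_snoc (s : St M) (P : ℕ) :
    rowSpin (Fin.snoc s true : St (M + 1)) P = rowSpin s P := by
  unfold rowSpin
  by_cases h : P < M + 1
  · rw [dif_pos h, dif_pos (by omega)]
    have e : (⟨P, by omega⟩ : Fin (M + 2)) = (⟨P, h⟩ : Fin (M + 1)).castSucc := rfl
    rw [e, Fin.snoc_castSucc]
  · rw [dif_neg h]
    by_cases h' : P < M + 1 + 1
    · have e : (⟨P, h'⟩ : Fin (M + 2)) = Fin.last _ := Fin.ext (show P = M + 1 by omega)
      rw [dif_pos h', e, Fin.snoc_last, sval_true]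
    · rw [dif_neg h']

/-- Adding a row. -/
theorem rowZPlus_succ {β : ℝ} (x : Fin (m + 1) → Bool) :
    (∑ s : Fin (m + 1) → St (M + 1), if (s 0 = fun _ => true) ∧ (∀ j, s j (Fin.last _) = true) ∧
        ∀ j, s j 0 = x j then pathW β (fun _ => β) s else 0) =
      Real.exp ((m + 1) * (2 * β)) * rowZPlus M β x := by
  rw [rowZPlus, mul_sum]
  symm
  refine Fintype.sum_of_injective
    (fun (s : Fin (m + 1) → St M) j => (Fin.snoc (s j) true : St (M + 1))) ?_ _ _ ?_ ?_
  · intro s t h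
    funext j i
    have := congrFun (congrFun h j) i.castSucc
    simpa using this
  · intro s hs
    rw [if_neg]
    rintro ⟨-, h2, -⟩
    exact hs ⟨fun j => Fin.init (s j), funext fun j => by
      rw [← h2 j]; exact Fin.snoc_init_self (s j)⟩
  · intro s
    have h0 : ∀ j, (Fin.snoc (s j) true : St (M + 1)) 0 = s j 0 := fun j => by
      rw [← Fin.castSucc_zero, Fin.snoc_castSucc]
    have hs : ((Fin.snoc (s 0) true : St (M + 1)) = fun _ => true) ↔ s 0 = fun _ => true := by
      constructor
      · intro h; funext i
        have := congrFun h i.castSucc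
        simpa using this
      · intro h; rw [h]; funext i
        refine Fin.lastCases (by rw [Fin.snoc_last]) (fun i => by rw [Fin.snoc_castSucc]) i
    simp only [Fin.snoc_last, h0, hs, true_and, implies_true, mul_ite, mul_zero]
    refine if_congr Iff.rfl ?_ rfl
    rw [pathW, pathW, ← Real.exp_add]
    have e : ((m : ℝ) + 1) * (2 * β) = ∑ _j : Fin (m + 1), 2 * β := by simp
    rw [e, ← sum_add_distrib]
    congr 1
    refine sum_congr rfl fun j _ => ?_
    simp only [vertE, horE, rowSpin_snoc]
    rw [Fin.sum_univ_castSucc (n := M + 1), Fin.sum_univ_castSucc (n := M + 1)]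
    have e1 : ∀ (s : St M) (P : ℕ), M + 1 ≤ P → rowSpin s P = 1 := fun s P h => by
      rw [rowSpin, dif_neg (by omega)]
    simp only [Fin.val_castSucc, Fin.val_last]
    rw [e1 _ _ le_rfl, e1 _ _ le_rfl, e1 _ _ (Nat.le_succ _), if_neg (by omega)]
    ring

/-- The sequence of spins with a segment of minus spins at `i + 1, …, j`. -/
def seg (i j : ℕ) (c : ℕ) : Bool := decide (¬ (i < c ∧ c ≤ j))

/-- Normalised row partition function with a segment of minus spins. -/
noncomputable def segRatio (β : ℝ) (m M i j : ℕ) : ℝ :=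
  rowZPlus M β (fun c : Fin (m + 1) => seg i j c) / rowZPlus M β fun _ : Fin (m + 1) => true

theorem segRatio_pos (β : ℝ) (m M i j : ℕ) : 0 < segRatio β m M i j :=
  div_pos (rowZPlus_pos β (by simp [seg])) (rowZPlus_pos β rfl)

theorem segRatio_le_succ_right {β : ℝ} (hβ : 0 ≤ β) {i j : ℕ} (hj : j ≤ m) :
    segRatio β m M i j ≤ segRatio β (m + 1) M i j := by
  rw [segRatio, segRatio, div_le_div_iff₀ (rowZPlus_pos β rfl) (rowZPlus_pos β rfl)]
  have h1 := rowZPlus_snoc (M := M) (m := m) (β := β) (y := seg i j) (by simp [seg]; omega)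
  have h2 := rowZPlus_snoc (M := M) (m := m) (β := β) (y := fun _ => true) rfl
  have h3 := four_events (α := Fin (m + 2) → St M)
    (w₁ := pathW β fun _ => β) (w₂ := pathW β fun _ => β) (w₃ := pathW β fun _ => β)
    (w₄ := pathW β fun _ => β) (fun s => (pathW_pos _ _ _).le)
    (fun s => (pathW_pos _ _ _).le) (fun s => (pathW_pos _ _ _).le) (fun s => (pathW_pos _ _ _).le)
    (pathW_supermodular hβ) (p₁ := fun s => (s 0 = fun _ => true) ∧
      (s (Fin.last _) = fun _ => true) ∧ ∀ j', s j' 0 = seg i j j')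
    (p₂ := fun s => (s 0 = fun _ => true) ∧ ∀ j, s j 0 = true)
    (p₃ := fun s => (s 0 = fun _ => true) ∧ ∀ j', s j' 0 = seg i j j')
    (p₄ := fun s => (s 0 = fun _ => true) ∧ (s (Fin.last _) = fun _ => true) ∧ ∀ j, s j 0 = true)
    (by
      rintro a b ⟨ha0, ha1, ha⟩ ⟨hb0, hb⟩
      refine ⟨⟨?_, fun j => by simp [ha j, hb j]⟩, ?_, ?_, fun j => by simp [hb j]⟩
      · funext l; simp [ha0, hb0]
      · funext l; simp [ha0]
      · funext l; simp [ha1])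
  rw [h1, h2] at h3
  change _ * rowZPlus M β (fun _ : Fin (m + 1 + 1) => true) ≤
    rowZPlus M β (fun c : Fin (m + 1 + 1) => seg i j c) * _ at h3
  have hK := Real.exp_pos (β * (M + 1) + β * M)
  refine le_of_mul_le_mul_left ?_ hK
  linarith

theorem segRatio_le_succ_row {β : ℝ} (hβ : 0 ≤ β) (i j : ℕ) :
    segRatio β m M i j ≤ segRatio β m (M + 1) i j := by
  rw [segRatio, segRatio, div_le_div_iff₀ (rowZPlus_pos β rfl) (rowZPlus_pos β rfl)]
  have h1 := rowZPlus_succ (M := M) (m := m) (β := β) fun c => seg i j c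
  have h2 := rowZPlus_succ (M := M) (m := m) (β := β) fun _ => true
  have h3 := four_events (α := Fin (m + 1) → St (M + 1))
    (w₁ := pathW β fun _ => β) (w₂ := pathW β fun _ => β) (w₃ := pathW β fun _ => β)
    (w₄ := pathW β fun _ => β) (fun s => (pathW_pos _ _ _).le)
    (fun s => (pathW_pos _ _ _).le) (fun s => (pathW_pos _ _ _).le) (fun s => (pathW_pos _ _ _).le)
    (pathW_supermodular hβ) (p₁ := fun s => (s 0 = fun _ => true) ∧
      (∀ j, s j (Fin.last _) = true) ∧ ∀ j', s j' 0 = seg i j j')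
    (p₂ := fun s => (s 0 = fun _ => true) ∧ ∀ j, s j 0 = true)
    (p₃ := fun s => (s 0 = fun _ => true) ∧ ∀ j', s j' 0 = seg i j j')
    (p₄ := fun s => (s 0 = fun _ => true) ∧ (∀ j, s j (Fin.last _) = true) ∧ ∀ j, s j 0 = true)
    (by
      rintro a b ⟨ha0, ha1, ha⟩ ⟨hb0, hb⟩
      refine ⟨⟨?_, fun j => by simp [ha j, hb j]⟩, ?_, ?_, fun j => by simp [hb j]⟩
      · funext l; simp [ha0, hb0]
      · funext l; simp [ha0]
      · intro l; simp [ha1])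
  rw [h1, h2] at h3
  change _ * rowZPlus (M + 1) β (fun _ : Fin (m + 1) => true) ≤
    rowZPlus (M + 1) β (fun c : Fin (m + 1) => seg i j c) * _ at h3
  have hK := Real.exp_pos ((m + 1) * (2 * β))
  refine le_of_mul_le_mul_left ?_ hK
  linarith

theorem segRatio_mono {β : ℝ} (hβ : 0 ≤ β) {m m' M M' i j : ℕ} (hj : j ≤ m) (hm : m ≤ m')
    (hM : M ≤ M') : segRatio β m M i j ≤ segRatio β m' M' i j := by
  have h1 : segRatio β m M i j ≤ segRatio β m' M i j := by
    induction m', hm using Nat.le_induction with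
    | base => exact le_rfl
    | succ m' h ih => exact ih.trans (segRatio_le_succ_right hβ (hj.trans h))
  refine h1.trans ?_
  induction M', hM using Nat.le_induction with
  | base => exact le_rfl
  | succ M' h ih => exact ih.trans (segRatio_le_succ_row hβ i j)

theorem signOf_pair {i j : Fin (m + 1)} (hij : i < j) :
    signOf ({i, j} : Finset (Fin (m + 1))) = fun c : Fin (m + 1) => seg i j c := by
  funext c
  apply sval_injective
  rw [sval_signOf, prod_pair hij.ne]
  have h' : (i : ℕ) < j := hij
  simp only [Fin.lt_def, seg, sval]
  split_ifs <;> simp_all <;> omega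

/-- Exponential decay of the ratios with a segment of minus spins. -/
theorem segRatio_le {β : ℝ} (hβ : betaCrit < β) {i j : ℕ} (hij : i < j) (hj : j ≤ m) :
    segRatio β m M i j ≤ 4 * decayRate β ^ (j - i) := by
  have h0 : 0 < β := betaCrit_pos.trans hβ
  refine (segRatio_mono h0.le hj (show m ≤ 2 * m by omega) le_rfl).trans ?_
  let i' : Fin (2 * m + 1) := ⟨i, by omega⟩
  let j' : Fin (2 * m + 1) := ⟨j, by omega⟩
  have hij' : i' < j' := hij
  have h1 := wallZ_pair_le (M := M) h0 hij'
  have he : Even ({i', j'} : Finset (Fin (2 * m + 1))).card := by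
    rw [card_pair hij'.ne]; exact even_two
  have hw0 := wallZ_eq (m := 2 * m) (M := M) β (fun _ => β) (W := ∅) (by simp)
  have hs0 : signOf (∅ : Finset (Fin (2 * m + 1))) = fun _ => true := by funext j; simp [signOf]
  simp only [notMem_empty, decide_false, hs0, Bool.not_true] at hw0
  rw [wallZ_eq β _ he, signOf_pair hij', hw0] at h1
  have h2 := rowZ_false_le (m := 2 * m) (M := M) h0.le
  have h3 := rowZPlus_mul_rowZ_le (m := 2 * m) (M := M) h0.le fun c => seg i j c
  have hA := rowZ_pos (m := 2 * m) (M := M) β (fun _ => β) fun _ => true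
  have hN := rowZ_pos (m := 2 * m) (M := M) β (fun _ => β) fun c => !seg i j c
  have hP := rowZPlus_pos (m := 2 * m) (M := M) β (x := fun _ => true) rfl
  have hmax : max (decayRate β ^ ((j' : ℕ) - i')) (decayRate β ^ (2 * m + 1 - ((j' : ℕ) - i'))) =
      decayRate β ^ (j - i) := by
    refine max_eq_left (pow_le_pow_of_le_one (decayRate_pos h0).le (decayRate_lt_one hβ).le ?_)
    show j - i ≤ 2 * m + 1 - (j - i)
    omega
  rw [hmax] at h1
  have hρ := pow_pos (decayRate_pos h0) (j - i)
  change rowZ M β (fun _ => β) (fun c : Fin (2 * m + 1) => seg i j c) +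
    rowZ M β (fun _ => β) (fun c : Fin (2 * m + 1) => !seg i j c) ≤ _ at h1
  have h4 : rowZ M β (fun _ => β) (fun c : Fin (2 * m + 1) => seg i j c) ≤
      4 * decayRate β ^ (j - i) * rowZ (m := 2 * m) M β (fun _ => β) fun _ => true := by
    nlinarith
  rw [segRatio, div_le_iff₀ hP]
  refine le_of_mul_le_mul_right ?_ hA
  refine h3.trans ?_
  nlinarith [mul_le_mul_of_nonneg_right h4 hP.le]

end Supermodular

end Schonmann

namespace Schonmann

open Matrix Finset

section RowWeight

variable {m M : ℕ}

/-- Unnormalised law of row `0` of the strip with plus boundary conditions. -/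
noncomputable def rowW (β : ℝ) (M : ℕ) (x : Fin (m + 1) → Bool) : ℝ :=
  Real.exp (β * ∑ j, sval (x j) * sval (x (j + 1))) * rowZPlus M β x ^ 2

/-- The skew matrix describing the sign changes in row `0`. -/
noncomputable def wallM (β : ℝ) (m M : ℕ) : Matrix (Fin (m + 1)) (Fin (m + 1)) ℝ :=
  Real.exp (-(2 * β)) • skewRatio fun W : Finset (Fin (m + 1)) => rowZPlus M β (signOf W)

/-- Weight of the all-plus row. -/
noncomputable def rowK (β : ℝ) (m M : ℕ) : ℝ :=
  Real.exp (β * (m + 1)) * rowZPlus M β (fun _ : Fin (m + 1) => true) ^ 2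

theorem rowK_pos (β : ℝ) (m M : ℕ) : 0 < rowK β m M :=
  mul_pos (Real.exp_pos _) (pow_pos (rowZPlus_pos β rfl) 2)

theorem wallM_transpose (β : ℝ) (m M : ℕ) : (wallM β m M)ᵀ = -wallM β m M := by
  rw [wallM, transpose_smul, skewRatio_transpose, smul_neg]

theorem det_skew_eq_zero_of_odd {n : Type*} [Fintype n] [DecidableEq n] {A : Matrix n n ℝ}
    (hA : Aᵀ = -A) (hn : Odd (Fintype.card n)) : A.det = 0 := by
  have h := det_transpose A
  rw [hA, det_neg, hn.neg_one_pow] at h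
  linarith

theorem rowW_signOf {β : ℝ} (hβ : 0 < β) {W : Finset (Fin (m + 1))} (hW : Even W.card) :
    rowW β M (signOf W) = rowK β m M *
      ((wallM β m M).submatrix (Subtype.val : W → _) Subtype.val).det := by
  have hsum : ∑ j, sval (signOf W j) * sval (signOf W (j + 1)) = (m + 1) - 2 * W.card := by
    have : ∀ j : Fin (m + 1), sval (signOf W j) * sval (signOf W (j + 1)) =
        1 - if j ∈ W then 2 else 0 := by
      intro j
      rw [sval_signOf_add_one hW, ← mul_assoc, sval_mul_self]
      split_ifs <;> norm_num
    simp only [this, sum_sub_distrib, sum_ite_mem, univ_inter, sum_const, card_univ, Fintype.card_fin]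
    simp
    ring
  rw [rowW, hsum, rowZPlus_sq hβ W hW, wallM, submatrix_smul, Pi.smul_apply, Pi.smul_apply,
    det_smul, Fintype.card_coe, rowK, ← Real.exp_nat_mul]
  have : β * ((m : ℝ) + 1 - 2 * W.card) = β * (m + 1) + W.card * (-(2 * β)) := by ring
  rw [this, Real.exp_add]
  ring

theorem sum_mul_rowW {β : ℝ} (hβ : 0 < β) (φ : (Fin (m + 1) → Bool) → ℝ) :
    ∑ x, φ x * rowW β M x = rowK β m M * ∑ W : Finset (Fin (m + 1)), (φ (signOf W) *
      ((wallM β m M).submatrix (Subtype.val : W → _) Subtype.val).det) := by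
  have h1 : ∑ x, φ x * rowW β M x = ∑ x with x 0 = true, φ x * rowW β M x := by
    symm
    refine sum_subset (filter_subset _ _) fun x _ hx => ?_
    have : x 0 = false := by simpa using hx
    rw [rowW, rowZPlus_eq_zero β this]; ring
  have h2 : ∑ W : Finset (Fin (m + 1)), (φ (signOf W) *
      ((wallM β m M).submatrix (Subtype.val : W → _) Subtype.val).det) =
      ∑ W : Finset (Fin (m + 1)) with Even W.card, (φ (signOf W) *
      ((wallM β m M).submatrix (Subtype.val : W → _) Subtype.val).det) := by
    symm
    refine sum_subset (filter_subset _ _) fun W _ hW => ?_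
    rw [det_skew_eq_zero_of_odd (transpose_submatrix_skew (wallM_transpose β m M) _), mul_zero]
    rw [Fintype.card_coe]
    simpa using hW
  rw [h1, h2, mul_sum]
  refine sum_nbij' wallSet signOf ?_ ?_ ?_ ?_ ?_
  · intro x _; simpa using even_card_wallSet x
  · intro W _; simp [signOf_zero]
  · intro x hx; exact signOf_wallSet (by simpa using hx)
  · intro W hW; exact wallSet_signOf (by simpa using hW)
  · intro x hx
    have hx : x 0 = true := by simpa using hx
    have h := rowW_signOf (M := M) hβ (even_card_wallSet x)
    rw [signOf_wallSet hx] at h ⊢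
    rw [h]; ring

theorem sum_mul_rowW_eq_det {ι : Type*} [Fintype ι] [DecidableEq ι] {β : ℝ} (hβ : 0 < β)
    (e : ι ↪ Fin (m + 1)) (u d : ι → ℝ) (φ : (Fin (m + 1) → Bool) → ℝ)
    (h0 : ∀ W : Finset (Fin (m + 1)), Even W.card → (∃ i ∈ W, ∀ j, e j ≠ i) → φ (signOf W) = 0)
    (h1 : ∀ V : Finset ι, Even V.card →
      φ (signOf (V.map e)) = (∏ i ∈ Vᶜ, u i) * ∏ i ∈ V, d i) :
    ∑ x, φ x * rowW β M x = rowK β m M *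
      (diagonal u + diagonal d * (wallM β m M).submatrix e e).det := by
  rw [sum_mul_rowW hβ, det_diagonal_add_mul]
  congr 1
  symm
  refine Fintype.sum_of_injective (Finset.map e) (map_injective e) _ _ ?_ ?_
  · intro W hW
    by_cases he : Even W.card
    · rw [h0 W he, zero_mul]
      by_contra! hc
      refine hW ⟨W.preimage e e.injective.injOn, ?_⟩
      ext i
      simp only [Finset.mem_map, Finset.mem_preimage]
      refine ⟨?_, fun hi => ?_⟩
      · rintro ⟨a, ha, rfl⟩; exact ha
      · obtain ⟨j, hj⟩ := hc i hi
        exact ⟨j, hj ▸ hi, hj⟩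
    · rw [det_skew_eq_zero_of_odd (transpose_submatrix_skew (wallM_transpose β m M) _), mul_zero]
      rw [Fintype.card_coe]
      simpa using he
  · intro V
    by_cases he : Even V.card
    · rw [h1 V he, ← det_submatrix_equiv_self (Equiv.ofBijective
        (fun i : V => (⟨e i, mem_map_of_mem e i.2⟩ : V.map e)) ⟨fun a b h => ?_, fun a => ?_⟩)]
      · rfl
      · exact Subtype.ext (e.injective (congrArg Subtype.val h))
      · obtain ⟨i, hi, h⟩ := mem_map.mp a.2
        exact ⟨⟨i, hi⟩, Subtype.ext h⟩
    · have ho : ∀ (A : Matrix ι ι ℝ), Aᵀ = -A →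
          (A.submatrix (Subtype.val : V → ι) Subtype.val).det = 0 := fun A hA =>
        det_skew_eq_zero_of_odd (transpose_submatrix_skew hA _) (by
          rw [Fintype.card_coe]; simpa using he)
      rw [ho _ (transpose_submatrix_skew (wallM_transpose β m M) _),
        det_skew_eq_zero_of_odd (transpose_submatrix_skew (wallM_transpose β m M) _), mul_zero,
        mul_zero]
      rw [Fintype.card_coe, card_map]
      simpa using he

end RowWeight

end Schonmann

namespace Schonmann

open Matrix Finset Filter Topology

section Influence

variable {m M : ℕ}

theorem wallM_of_lt (β : ℝ) {i j : Fin (m + 1)} (hij : i < j) :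
    wallM β m M i j = Real.exp (-(2 * β)) * segRatio β m M i j := by
  have hemp : signOf (∅ : Finset (Fin (m + 1))) = fun _ => true := by funext j; simp [signOf]
  rw [wallM, Matrix.smul_apply, smul_eq_mul, skewRatio, of_apply, if_pos hij, hemp, signOf_pair hij]
  rfl

theorem wallM_swap (β : ℝ) (i j : Fin (m + 1)) : wallM β m M i j = -wallM β m M j i := by
  have := congrFun (congrFun (wallM_transpose β m M) j) i
  simpa using this

theorem abs_wallM_le {β : ℝ} (hβ : betaCrit < β) (i j : Fin (m + 1)) :
    |wallM β m M i j| ≤ 4 * decayRate β ^ ((i : ℤ) - (j : ℤ)).natAbs := by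
  have key : ∀ i j : Fin (m + 1), i < j →
      |wallM β m M i j| ≤ 4 * decayRate β ^ ((i : ℤ) - (j : ℤ)).natAbs := by
    intro i j hij
    have h0 : 0 < β := betaCrit_pos.trans hβ
    have hl : (i : ℕ) < j := hij
    have h1 := segRatio_le (m := m) (M := M) hβ hl (by omega)
    have h2 := segRatio_pos β m M i j
    have h3 : Real.exp (-(2 * β)) ≤ 1 := Real.exp_le_one_iff.mpr (by linarith)
    rw [wallM_of_lt β hij, abs_of_pos (mul_pos (Real.exp_pos _) h2)]
    have : ((i : ℤ) - (j : ℤ)).natAbs = j - i := by omega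
    rw [this]
    nlinarith
  rcases lt_trichotomy i j with h | h | h
  · exact key i j h
  · subst h
    have : wallM β m M i i = 0 := by have := wallM_swap (M := M) β i i; linarith
    rw [this, abs_zero]
    have := (decayRate_pos (betaCrit_pos.trans hβ)).le
    positivity
  · rw [wallM_swap, abs_neg]
    refine (key j i h).trans_eq ?_
    congr 2
    omega

/-- The spins in columns `1, …, r` are all equal to `b`. -/
def LeftEvt (r : ℕ) (b : Bool) (x : Fin (m + 1) → Bool) : Prop :=
  ∀ c : Fin (m + 1), 1 ≤ (c : ℕ) → (c : ℕ) ≤ r → x c = b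

instance (r : ℕ) (b : Bool) (x : Fin (m + 1) → Bool) : Decidable (LeftEvt r b x) :=
  inferInstanceAs (Decidable (∀ _, _))

/-- Partition functions with frozen spins in columns `1, …, r`. -/
noncomputable def leftZ (β : ℝ) (M r : ℕ) (b : Bool) (φ : (Fin (m + 1) → Bool) → ℝ) : ℝ :=
  ∑ x, (if LeftEvt r b x then φ x else 0) * rowW β M x

/-- The walls to the right of the frozen segment. -/
def bulkEmb {r q : ℕ} (h : m + 1 = r + q) : Fin q ↪ Fin (m + 1) :=
  ⟨fun i => ⟨r + i, by omega⟩, fun i j hij => Fin.ext (by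
    have := congrArg Fin.val hij; simp only at this; omega)⟩

/-- The walls to the right of the frozen segment, and the wall `0`. -/
def sourceEmb {r q : ℕ} (h : m + 1 = r + q) (hr : 1 ≤ r) : Fin q ⊕ Unit ↪ Fin (m + 1) :=
  ⟨Sum.elim (bulkEmb h) fun _ => 0, by
    rintro (i | i) (j | j) hij
    · exact congrArg Sum.inl ((bulkEmb h).injective hij)
    · have : r + (i : ℕ) = 0 := congrArg Fin.val hij
      omega
    · have : 0 = r + (j : ℕ) := congrArg Fin.val hij
      omega
    · rfl⟩

theorem signOf_succ_ne {W : Finset (Fin (m + 1))} (hW : Even W.card) {i : Fin (m + 1)} (hi : i ∈ W) :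
    signOf W (i + 1) ≠ signOf W i := by
  rw [← wallSet_signOf hW] at hi
  simpa [wallSet] using hi

theorem val_add_one_of_lt {i : Fin (m + 1)} (h : (i : ℕ) < m) : ((i + 1 : Fin (m + 1)) : ℕ) = i + 1 :=
  Fin.val_add_one_of_lt (Fin.lt_def.mpr (by simpa using h))

theorem leftZ_true_eq {β : ℝ} (hβ : 0 < β) {r q : ℕ} (h : m + 1 = r + q) (hq : 1 ≤ q) (d : Fin q → ℝ)
    (φ : (Fin (m + 1) → Bool) → ℝ)
    (hφ : ∀ V : Finset (Fin q), Even V.card → φ (signOf (V.map (bulkEmb h))) = ∏ i ∈ V, d i) :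
    leftZ β M r true φ = rowK β m M *
      (1 + diagonal d * (wallM β m M).submatrix (bulkEmb h) (bulkEmb h)).det := by
  have e1 : (1 : Matrix (Fin q) (Fin q) ℝ) = diagonal fun _ => 1 := rfl
  rw [leftZ, e1]
  refine sum_mul_rowW_eq_det hβ (bulkEmb h) _ _ _ ?_ ?_
  · rintro W hW ⟨i, hi, hne⟩
    rw [if_neg]
    intro hL
    have hir : (i : ℕ) < r := by
      by_contra! hc
      exact hne ⟨i - r, by omega⟩ (Fin.ext (show r + (i - r) = i by omega))
    refine signOf_succ_ne hW hi ?_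
    have hv := val_add_one_of_lt (i := i) (m := m) (by omega)
    rw [hL (i + 1) (by omega) (by omega)]
    rcases Nat.eq_zero_or_pos (i : ℕ) with h0 | h0
    · have : i = 0 := Fin.ext h0
      rw [this, signOf_zero]
    · rw [hL i h0 hir.le]
  · intro V hV
    rw [if_pos, hφ V hV]
    · simp
    · intro c _ hc
      apply sval_injective
      rw [sval_signOf, sval_true, prod_map]
      refine prod_eq_one fun i _ => if_neg ?_
      rw [Fin.lt_def]
      show ¬ (r + (i : ℕ) < c)
      omega

theorem leftZ_false_eq {β : ℝ} (hβ : 0 < β) {r q : ℕ} (h : m + 1 = r + q) (hq : 1 ≤ q) (hr : 1 ≤ r)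
    (d : Fin q ⊕ Unit → ℝ) (φ : (Fin (m + 1) → Bool) → ℝ)
    (hφ : ∀ V : Finset (Fin q ⊕ Unit), Even V.card →
      φ (signOf (V.map (sourceEmb h hr))) = ∏ i ∈ V, d i) :
    leftZ β M r false φ = rowK β m M * (diagonal (bulk q 1) + diagonal d *
      (wallM β m M).submatrix (sourceEmb h hr) (sourceEmb h hr)).det := by
  rw [leftZ]
  refine sum_mul_rowW_eq_det hβ (sourceEmb h hr) _ _ _ ?_ ?_
  · rintro W hW ⟨i, hi, hne⟩
    rw [if_neg]
    intro hL
    have hir : (i : ℕ) < r := by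
      by_contra! hc
      exact hne (Sum.inl ⟨i - r, by omega⟩) (Fin.ext (show r + (i - r) = i by omega))
    have h0 : 1 ≤ (i : ℕ) := by
      by_contra! hc
      exact hne (Sum.inr ()) (Fin.ext (show 0 = (i : ℕ) by omega))
    refine signOf_succ_ne hW hi ?_
    have hv := val_add_one_of_lt (i := i) (m := m) (by omega)
    rw [hL (i + 1) (by omega) (by omega), hL i h0 hir.le]
  · intro V hV
    have key : ∀ c : Fin (m + 1), 1 ≤ (c : ℕ) → (c : ℕ) ≤ r →
        sval (signOf (V.map (sourceEmb h hr)) c) = if Sum.inr () ∈ V then -1 else 1 := by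
      intro c hc1 hc
      have : (if Sum.inr () ∈ V then (-1 : ℝ) else 1) =
          ∏ i ∈ V, if i = Sum.inr () then -1 else 1 := by rw [prod_ite_eq']
      rw [sval_signOf, prod_map, this]
      refine prod_congr rfl fun i _ => ?_
      rcases i with i | i
      · rw [if_neg, if_neg (by simp)]
        rw [Fin.lt_def]
        show ¬ (r + (i : ℕ) < c)
        omega
      · rw [if_pos, if_pos rfl]
        rw [Fin.lt_def]
        show 0 < (c : ℕ)
        omega
    by_cases hV0 : Sum.inr () ∈ V
    · rw [if_pos, hφ V hV]
      · rw [prod_eq_one (s := Vᶜ), one_mul]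
        rintro (i | i) hi
        · rfl
        · exact absurd hV0 (mem_compl.mp hi)
      · intro c h1 h2
        apply sval_injective
        rw [key c h1 h2, if_pos hV0, sval_false]
    · rw [if_neg, prod_eq_zero (i := Sum.inr ()) (mem_compl.mpr hV0), zero_mul]
      · rfl
      · intro hL
        have h1 := key ⟨1, by omega⟩ le_rfl hr
        rw [if_neg hV0, hL ⟨1, by omega⟩ le_rfl hr, sval_false] at h1
        norm_num at h1

theorem submatrix_sourceEmb (β : ℝ) {r q : ℕ} (h : m + 1 = r + q) (hr : 1 ≤ r) :
    (wallM β m M).submatrix (sourceEmb h hr) (sourceEmb h hr) =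
      bordered ((wallM β m M).submatrix (bulkEmb h) (bulkEmb h))
        fun i => wallM β m M (bulkEmb h i) 0 := by
  ext i j
  rcases i with i | i <;> rcases j with j | j
  · rfl
  · rfl
  · exact wallM_swap _ _ _
  · have := wallM_swap (M := M) β (0 : Fin (m + 1)) 0
    show wallM β m M 0 0 = 0
    linarith

theorem prod_eq_of_eq_neg {ι : Type*} {V : Finset ι} (hV : Even V.card) {f g : ι → ℝ}
    (hfg : ∀ i ∈ V, f i = -g i) : ∏ i ∈ V, f i = ∏ i ∈ V, g i := by
  have : ∀ i ∈ V, f i = -1 * g i := fun i hi => by rw [hfg i hi]; ring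
  rw [prod_congr rfl this, prod_mul_distrib, prod_const, hV.neg_one_pow, one_mul]

theorem sval_site_bulk {r q : ℕ} (h : m + 1 = r + q) {k : ℕ} {c : Fin (m + 1)} (hc : (c : ℕ) = r + k)
    {V : Finset (Fin q)} (hV : Even V.card) :
    sval (signOf (V.map (bulkEmb h)) c) = ∏ i ∈ V, farSign q k i := by
  rw [sval_signOf, prod_map]
  refine prod_eq_of_eq_neg hV fun i _ => ?_
  have : (bulkEmb h i < c) ↔ ¬ (k ≤ (i : ℕ)) := by
    rw [Fin.lt_def, hc]
    show r + (i : ℕ) < r + k ↔ _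
    omega
  rw [farSign, if_congr this rfl rfl]
  split_ifs <;> norm_num

theorem sval_site_source {r q : ℕ} (h : m + 1 = r + q) (hr : 1 ≤ r) {k : ℕ} {c : Fin (m + 1)}
    (hc : (c : ℕ) = r + k) {V : Finset (Fin q ⊕ Unit)} (hV : Even V.card) :
    sval (signOf (V.map (sourceEmb h hr)) c) =
      ∏ i ∈ V, Sum.elim (farSign q k) (fun _ => 1) i := by
  rw [sval_signOf, prod_map]
  refine prod_eq_of_eq_neg hV fun i _ => ?_
  rcases i with i | i
  · have : (sourceEmb h hr (Sum.inl i) < c) ↔ ¬ (k ≤ (i : ℕ)) := by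
      rw [Fin.lt_def, hc]
      show r + (i : ℕ) < r + k ↔ _
      omega
    rw [if_congr this rfl rfl, Sum.elim_inl, farSign]
    split_ifs <;> norm_num
  · have : sourceEmb h hr (Sum.inr i) < c := by
      rw [Fin.lt_def, hc]
      show 0 < r + k
      omega
    rw [if_pos this, Sum.elim_inr]

/-- A sequence dominated by `ρ ^ r` has infinitely many indices from which it decays at least at
any slower exponential rate. -/
theorem exists_record {g : ℕ → ℝ} {ρ ρ' C : ℝ} (hρ : 0 < ρ) (hρ' : ρ < ρ')
    (hg : ∀ r, 0 < g r) (hgC : ∀ r, 1 ≤ r → g r ≤ C * ρ ^ r) (N : ℕ) :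
    ∃ r, N ≤ r ∧ ∀ j, g (r + j) ≤ ρ' ^ j * g r := by
  have hρ0 : 0 < ρ' := hρ.trans hρ'
  have hlim : Tendsto (fun r => g r / ρ' ^ r) atTop (𝓝 0) := by
    have h1 : Tendsto (fun r : ℕ => C * (ρ / ρ') ^ r) atTop (𝓝 0) := by
      have := (tendsto_pow_atTop_nhds_zero_of_lt_one (div_pos hρ hρ0).le
        ((div_lt_one hρ0).mpr hρ')).const_mul C
      simpa using this
    refine tendsto_of_tendsto_of_tendsto_of_le_of_le' tendsto_const_nhds h1
      (Eventually.of_forall fun r => (div_pos (hg r) (pow_pos hρ0 r)).le) ?_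
    filter_upwards [eventually_ge_atTop 1] with r hr
    rw [div_pow, mul_div_assoc']
    exact div_le_div_of_nonneg_right (hgC r hr) (pow_pos hρ0 r).le
  obtain ⟨N', hN'⟩ := eventually_atTop.mp
    (hlim.eventually (gt_mem_nhds (div_pos (hg N) (pow_pos hρ0 N))))
  obtain ⟨r, hr, hmax⟩ := exists_max_image (Finset.Icc N (N + N')) (fun r => g r / ρ' ^ r)
    ⟨N, by simp⟩
  rw [Finset.mem_Icc] at hr
  refine ⟨r, hr.1, fun j => ?_⟩
  have hle : g (r + j) / ρ' ^ (r + j) ≤ g r / ρ' ^ r := by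
    by_cases hj : r + j ≤ N + N'
    · exact hmax _ (by rw [Finset.mem_Icc]; omega)
    · exact (hN' (r + j) (by omega)).le.trans (hmax N (by simp))
  rw [div_le_div_iff₀ (pow_pos hρ0 _) (pow_pos hρ0 _), pow_add] at hle
  refine le_of_mul_le_mul_right ?_ (pow_pos hρ0 r)
  linarith

/-- Exponential decay of the influence of the frozen segment. -/
theorem exists_row_influence_le {β : ℝ} (hβ : betaCrit < β) :
    ∃ C lam : ℝ, 0 ≤ C ∧ 1 < lam ∧ ∀ k N : ℕ, ∃ r m M : ℕ, N ≤ r ∧ N ≤ M ∧ r + k + N ≤ m ∧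
      ∀ c : Fin (m + 1), (c : ℕ) = r + k →
        lam ^ k * |leftZ (m := m) β M r true (fun _ => 1) * leftZ (m := m) β M r false (fun x => sval (x c)) -
          leftZ (m := m) β M r true (fun x => sval (x c)) * leftZ (m := m) β M r false fun _ => 1| ≤
        C * (leftZ (m := m) β M r true (fun _ => 1) * leftZ (m := m) β M r false fun _ => 1) := by
  have h0 : 0 < β := betaCrit_pos.trans hβ
  obtain ⟨ρ', hρρ', hρ'1⟩ := exists_between (decayRate_lt_one hβ)
  have hρ := decayRate_pos h0
  obtain ⟨C, lam, hC, hlam, hmain⟩ := source_comparison_rate (C₁ := 4) (C₂ := 2)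
    (hρ.trans hρρ').le hρ'1 (by norm_num)
  refine ⟨C, lam, hC, hlam, fun k N => ?_⟩
  let S : ℕ → Set ℝ := fun r => {y | ∃ m M, r ≤ m ∧ y = segRatio β m M 0 r}
  have hb : ∀ r, 1 ≤ r → ∀ y ∈ S r, y ≤ 4 * decayRate β ^ r := by
    rintro r hr y ⟨m, M, hm, rfl⟩
    exact segRatio_le hβ hr hm
  have hbdd : ∀ r, 1 ≤ r → BddAbove (S r) := fun r hr => ⟨_, hb r hr⟩
  have hmem : ∀ r, segRatio β r 0 0 r ∈ S r := fun r => ⟨r, 0, le_rfl, rfl⟩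
  let g : ℕ → ℝ := fun r => sSup (S (r + 1))
  have hgpos : ∀ r, 0 < g r := fun r =>
    (segRatio_pos β _ _ _ _).trans_le (le_csSup (hbdd _ (by omega)) (hmem (r + 1)))
  obtain ⟨r', hr', hrec⟩ := exists_record (C := 4 * decayRate β) hρ hρρ' hgpos (fun r _ => by
    have := csSup_le ⟨_, hmem (r + 1)⟩ (hb (r + 1) (by omega))
    rw [pow_succ] at this
    show sSup (S (r + 1)) ≤ _
    linarith) N
  set r := r' + 1 with hr
  have hr1 : 1 ≤ r := by omega
  obtain ⟨y, ⟨m₀, M₀, hm₀, rfl⟩, hy⟩ := exists_lt_of_lt_csSup ⟨_, hmem r⟩ (half_lt_self (hgpos r'))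
  set m := m₀ + r + k + N with hm
  set M := M₀ + N with hM
  refine ⟨r, m, M, by omega, by omega, by omega, fun c hc => ?_⟩
  obtain ⟨q, hq⟩ : ∃ q, m + 1 = r + q := ⟨m + 1 - r, by omega⟩
  have hq1 : 1 ≤ q := by omega
  have e1 : leftZ (m := m) β M r true (fun _ => 1) = rowK β m M *
      (1 + (wallM β m M).submatrix (bulkEmb hq) (bulkEmb hq)).det := by
    have := leftZ_true_eq (M := M) h0 hq hq1 (fun _ => 1) (fun _ => 1) fun V _ => by simp
    rwa [diagonal_one, one_mul] at this
  have e2 : leftZ (m := m) β M r true (fun x => sval (x c)) = rowK β m M *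
      (1 + diagonal (farSign q k) * (wallM β m M).submatrix (bulkEmb hq) (bulkEmb hq)).det :=
    leftZ_true_eq h0 hq hq1 _ _ fun V hV => sval_site_bulk hq hc hV
  have e3 : leftZ (m := m) β M r false (fun _ => 1) = rowK β m M * (diagonal (bulk q 1) +
      bordered ((wallM β m M).submatrix (bulkEmb hq) (bulkEmb hq))
        fun i => wallM β m M (bulkEmb hq i) 0).det := by
    have := leftZ_false_eq (M := M) h0 hq hq1 hr1 (fun _ => 1) (fun _ => 1) fun V _ => by simp
    rwa [diagonal_one, one_mul, submatrix_sourceEmb] at this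
  have e4 : leftZ (m := m) β M r false (fun x => sval (x c)) = rowK β m M * (diagonal (bulk q 1) +
      diagonal (Sum.elim (farSign q k) fun _ => 1) *
      bordered ((wallM β m M).submatrix (bulkEmb hq) (bulkEmb hq))
        fun i => wallM β m M (bulkEmb hq i) 0).det := by
    rw [← submatrix_sourceEmb β hq hr1]
    exact leftZ_false_eq h0 hq hq1 hr1 _ _ fun V hV => sval_site_source hq hr1 hc hV
  have hcol : ∀ i : Fin q, |wallM β m M (bulkEmb hq i) 0| =
      Real.exp (-(2 * β)) * segRatio β m M 0 (r + i) := by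
    intro i
    have hlt : (0 : Fin (m + 1)) < bulkEmb hq i := by
      rw [Fin.lt_def]; show 0 < r + (i : ℕ); omega
    rw [wallM_swap, abs_neg, wallM_of_lt β hlt,
      abs_of_pos (mul_pos (Real.exp_pos _) (segRatio_pos _ _ _ _ _))]
    rfl
  have ht := Real.exp_pos (-(2 * β))
  have hhalf : g r' / 2 < segRatio β m M 0 r :=
    hy.trans_le (segRatio_mono h0.le hm₀ (by omega) (by omega))
  have hmm := hmain q k ((wallM β m M).submatrix (bulkEmb hq) (bulkEmb hq))
    (fun i => wallM β m M (bulkEmb hq i) 0) (Real.exp (-(2 * β)) * segRatio β m M 0 r)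
    (transpose_submatrix_skew (wallM_transpose β m M) _)
    (fun i j => by
      refine (abs_wallM_le hβ _ _).trans ?_
      have : (((bulkEmb hq i : Fin (m + 1)) : ℤ) - ((bulkEmb hq j : Fin (m + 1)) : ℤ)) = (i : ℤ) - j := by
        show ((r + (i : ℕ) : ℕ) : ℤ) - ((r + (j : ℕ) : ℕ) : ℤ) = _
        push_cast; ring
      rw [this]
      gcongr)
    (by
      let i0 : Fin q := ⟨0, hq1⟩
      have h1 := hcol i0
      have h2 : ∀ i ∈ (univ : Finset (Fin q)), 0 ≤ wallM β m M (bulkEmb hq i) 0 *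
        wallM β m M (bulkEmb hq i) 0 := fun i _ => mul_self_nonneg _
      refine le_trans ?_ (single_le_sum h2 (mem_univ i0))
      rw [← sq, ← sq_abs (wallM β m M (bulkEmb hq i0) 0), h1]
      exact le_rfl)
    (fun i => by
      rw [hcol i, abs_of_pos (mul_pos ht (segRatio_pos _ _ _ _ _))]
      have h3 : segRatio β m M 0 (r + i) ≤ ρ' ^ (i : ℕ) * g r' := by
        refine le_trans ?_ (hrec i)
        have : r' + (i : ℕ) + 1 = r + i := by omega
        show _ ≤ sSup (S (r' + i + 1))
        rw [this]
        exact le_csSup (hbdd _ (by omega)) ⟨m, M, by omega, rfl⟩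
      have h4 : 0 < ρ' ^ (i : ℕ) := pow_pos (hρ.trans hρρ') _
      have h5 : segRatio β m M 0 (r + i) ≤ ρ' ^ (i : ℕ) * (2 * segRatio β m M 0 r) :=
        h3.trans (mul_le_mul_of_nonneg_left (by linarith) h4.le)
      calc _ ≤ Real.exp (-(2 * β)) * (ρ' ^ (i : ℕ) * (2 * segRatio β m M 0 r)) :=
            mul_le_mul_of_nonneg_left h5 ht.le
        _ = _ := by ring)
  rw [e1, e2, e3, e4]
  have hK := rowK_pos β m M
  have hK2 := mul_pos hK hK
  have e5 : ∀ a b c d : ℝ, rowK β m M * a * (rowK β m M * b) - rowK β m M * c * (rowK β m M * d) =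
      rowK β m M * rowK β m M * (a * b - c * d) := fun a b c d => by ring
  rw [e5, abs_mul, abs_of_pos hK2]
  nlinarith [mul_le_mul_of_nonneg_left hmm hK2.le]

end Influence

end Schonmann

namespace Schonmann

open Matrix Finset Filter Topology MeasureTheory

/-- Interaction energy along the edges leaving the sites of `B` to the right or upwards. -/
noncomputable def fwdE (B : Finset (ℤ × ℤ)) (ω : Cfg2) : ℝ :=
  ∑ x ∈ B, ((sval (ω x) * sval (ω (x + (1, 0))) - 1) + (sval (ω x) * sval (ω (x + (0, 1))) - 1))

theorem sum_fwd_eq {Λ B : Finset (ℤ × ℤ)} (e : ℤ × ℤ) (hB : Λ ⊆ B) (hBe : ∀ x ∈ Λ, x - e ∈ B)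
    {F : ℤ × ℤ → ℤ × ℤ → ℝ} (hF : ∀ x y, F x y = F y x) (hF0 : ∀ x y, x ∉ Λ → y ∉ Λ → F x y = 0) :
    ∑ x ∈ Λ, ((if x + e ∈ Λ then 1 / 2 else 1) * F x (x + e) +
      (if x - e ∈ Λ then 1 / 2 else 1) * F x (x - e)) = ∑ x ∈ B, F x (x + e) := by
  have h1 : ∑ x ∈ Λ, (if x + e ∈ Λ then 1 / 2 else 1) * F x (x + e) =
      ∑ x ∈ B, if x ∈ Λ then (if x + e ∈ Λ then 1 / 2 else 1) * F x (x + e) else 0 := by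
    rw [sum_ite_mem, inter_eq_right.mpr hB]
  have h2 : ∑ x ∈ Λ, (if x - e ∈ Λ then 1 / 2 else 1) * F x (x - e) =
      ∑ x ∈ B, if x + e ∈ Λ then (if x ∈ Λ then 1 / 2 else 1) * F x (x + e) else 0 := by
    rw [← sum_filter]
    refine sum_nbij' (fun x => x - e) (fun x => x + e) ?_ ?_ ?_ ?_ ?_
    · intro x hx; simpa using ⟨hBe x hx, hx⟩
    · intro x hx; exact (mem_filter.mp hx).2
    · intro x _; simp
    · intro x _; simp
    · intro x _; simp only [sub_add_cancel]; rw [hF]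
  rw [sum_add_distrib, h1, h2, ← sum_add_distrib]
  refine sum_congr rfl fun x _ => ?_
  by_cases hx : x ∈ Λ <;> by_cases hy : x + e ∈ Λ <;> simp only [hx, hy, if_true, if_false]
  · ring
  · ring
  · ring
  · rw [hF0 _ _ hx hy]; ring

theorem sum_nbrs (x : ℤ × ℤ) (F : ℤ × ℤ → ℝ) :
    ∑ y ∈ nbrs x, F y =
      (F (x + (1, 0)) + F (x - (1, 0))) + (F (x + (0, 1)) + F (x - (0, 1))) := by
  obtain ⟨a, b⟩ := x
  rw [nbrs, sum_insert, sum_insert, sum_insert, sum_singleton]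
  · simp only [Prod.mk_add_mk, Prod.mk_sub_mk, add_zero, sub_zero]; ring
  all_goals simp only [mem_insert, mem_singleton, Prod.mk.injEq]; omega

theorem exists_isingWeight_eq (Λ : Finset (ℤ × ℤ)) : ∃ c : ℝ, ∀ (β : ℝ) (B : Finset (ℤ × ℤ)),
    Λ ⊆ B → (∀ x ∈ Λ, x - (1, 0) ∈ B) → (∀ x ∈ Λ, x - (0, 1) ∈ B) →
    ∀ ω : Cfg2, (∀ x, x ∉ Λ → ω x = true) →
      isingWeight β 0 Λ (fun _ => true) ω = Real.exp (β * (c + fwdE B ω)) := by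
  refine ⟨∑ x ∈ Λ, ∑ y ∈ nbrs x, if y ∈ Λ then 1 / 2 else 1, fun β B h h1 h2 ω hω => ?_⟩
  let F : ℤ × ℤ → ℤ × ℤ → ℝ := fun x y => sval (ω x) * sval (ω y) - 1
  have hF : ∀ x y, F x y = F y x := fun x y => by simp only [F]; ring
  have hF0 : ∀ x y, x ∉ Λ → y ∉ Λ → F x y = 0 := fun x y hx hy => by
    simp only [F, hω x hx, hω y hy, sval_true]; norm_num
  have hsum : (∑ x ∈ Λ, ∑ y ∈ Λ.filter (fun y => y ∈ nbrs x), sval (ω x) * sval (ω y)) / 2 +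
      ∑ x ∈ Λ, ∑ y ∈ (nbrs x).filter (fun y => y ∉ Λ), sval (ω x) * sval true =
      ∑ x ∈ Λ, ∑ y ∈ nbrs x, (if y ∈ Λ then 1 / 2 else 1) * (F x y + 1) := by
    rw [sum_div, ← sum_add_distrib]
    refine sum_congr rfl fun x _ => ?_
    rw [filter_mem_eq_inter, inter_comm, ← filter_mem_eq_inter, sum_filter, sum_filter, sum_div,
      ← sum_add_distrib]
    refine sum_congr rfl fun y _ => ?_
    by_cases hy : y ∈ Λ
    · simp only [hy, if_true, not_true, if_false, F]; ring
    · simp only [hy, if_false, not_false_eq_true, if_true, F, hω y hy]; ring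
  rw [isingWeight, hsum, zero_mul, sub_zero]
  congr 2
  simp only [mul_add, mul_one, sum_add_distrib]
  rw [add_comm]
  congr 1
  simp only [sum_nbrs]
  rw [sum_add_distrib, sum_fwd_eq (1, 0) h h1 hF hF0, sum_fwd_eq (0, 1) h h2 hF hF0, fwdE,
    sum_add_distrib]

/-- A finite set containing `Λ` and its neighbours to the left and below. -/
noncomputable def thicken (Λ : Finset (ℤ × ℤ)) : Finset (ℤ × ℤ) :=
  Λ ∪ (Λ.image (fun x => x - (1, 0)) ∪ Λ.image fun x => x - (0, 1))

theorem subset_thicken (Λ : Finset (ℤ × ℤ)) : Λ ⊆ thicken Λ := subset_union_left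

theorem sub_left_mem_thicken {Λ : Finset (ℤ × ℤ)} {x : ℤ × ℤ} (hx : x ∈ Λ) :
    x - (1, 0) ∈ thicken Λ :=
  mem_union_right _ (mem_union_left _ (mem_image_of_mem (fun x => x - (1, 0)) hx))

theorem sub_down_mem_thicken {Λ : Finset (ℤ × ℤ)} {x : ℤ × ℤ} (hx : x ∈ Λ) :
    x - (0, 1) ∈ thicken Λ :=
  mem_union_right _ (mem_union_right _ (mem_image_of_mem (fun x => x - (0, 1)) hx))

theorem fwdE_supermodular (B : Finset (ℤ × ℤ)) (a b : Cfg2) :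
    fwdE B a + fwdE B b ≤ fwdE B (a ⊓ b) + fwdE B (a ⊔ b) := by
  simp only [fwdE, ← sum_add_distrib]
  refine sum_le_sum fun x _ => ?_
  have h1 := sval_pair_le (a x) (a (x + (1, 0))) (b x) (b (x + (1, 0)))
  have h2 := sval_pair_le (a x) (a (x + (0, 1))) (b x) (b (x + (0, 1)))
  simp only [Pi.inf_apply, Pi.sup_apply]
  linarith

/-- Configurations with plus spins outside `Λ`. -/
def fillPlus (Λ : Finset (ℤ × ℤ)) (τ : ↥Λ → Bool) : Cfg2 := fill Λ (fun _ => true) τ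

theorem fillPlus_of_notMem {Λ : Finset (ℤ × ℤ)} (τ : ↥Λ → Bool) {x : ℤ × ℤ} (hx : x ∉ Λ) :
    fillPlus Λ τ x = true := by simp [fillPlus, fill, hx]

theorem fillPlus_of_mem {Λ : Finset (ℤ × ℤ)} (τ : ↥Λ → Bool) {x : ℤ × ℤ} (hx : x ∈ Λ) :
    fillPlus Λ τ x = τ ⟨x, hx⟩ := by simp [fillPlus, fill, hx]

theorem fillPlus_injective (Λ : Finset (ℤ × ℤ)) : Function.Injective (fillPlus Λ) := by
  intro a b h
  funext x
  have := congrFun h x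
  rwa [fillPlus_of_mem a x.2, fillPlus_of_mem b x.2] at this

theorem fillPlus_restrict {Λ : Finset (ℤ × ℤ)} {ω : Cfg2} (hω : ∀ x, x ∉ Λ → ω x = true) :
    fillPlus Λ (fun x => ω x) = ω := by
  funext x
  by_cases hx : x ∈ Λ
  · rw [fillPlus_of_mem _ hx]
  · rw [fillPlus_of_notMem _ hx, hω x hx]

theorem fillPlus_inf {Λ : Finset (ℤ × ℤ)} (a b : ↥Λ → Bool) :
    fillPlus Λ (a ⊓ b) = fillPlus Λ a ⊓ fillPlus Λ b := by
  funext x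
  by_cases hx : x ∈ Λ
  · simp only [Pi.inf_apply, fillPlus_of_mem _ hx]
  · simp only [Pi.inf_apply, fillPlus_of_notMem _ hx]; rfl

theorem fillPlus_sup {Λ : Finset (ℤ × ℤ)} (a b : ↥Λ → Bool) :
    fillPlus Λ (a ⊔ b) = fillPlus Λ a ⊔ fillPlus Λ b := by
  funext x
  by_cases hx : x ∈ Λ
  · simp only [Pi.sup_apply, fillPlus_of_mem _ hx]
  · simp only [Pi.sup_apply, fillPlus_of_notMem _ hx]; rfl

/-- Boltzmann weight with plus boundary conditions. -/
noncomputable def plusW (β : ℝ) (Λ : Finset (ℤ × ℤ)) (ω : Cfg2) : ℝ :=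
  isingWeight β 0 Λ (fun _ => true) ω

theorem plusW_pos (β : ℝ) (Λ : Finset (ℤ × ℤ)) (ω : Cfg2) : 0 < plusW β Λ ω := Real.exp_pos _

open Classical in
/-- Partition function restricted to an event, with plus boundary conditions. -/
noncomputable def isingZ (β : ℝ) (Λ : Finset (ℤ × ℤ)) (p : Cfg2 → Prop) : ℝ :=
  ∑ τ : ↥Λ → Bool, if p (fillPlus Λ τ) then plusW β Λ (fillPlus Λ τ) else 0

theorem isingZ_nonneg (β : ℝ) (Λ : Finset (ℤ × ℤ)) (p : Cfg2 → Prop) : 0 ≤ isingZ β Λ p :=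
  sum_nonneg fun τ _ => by split_ifs; exacts [(plusW_pos _ _ _).le, le_rfl]

theorem isingZ_pos (β : ℝ) {Λ : Finset (ℤ × ℤ)} {p : Cfg2 → Prop} {ω : Cfg2} (hp : p ω)
    (hω : ∀ x, x ∉ Λ → ω x = true) : 0 < isingZ β Λ p := by
  refine sum_pos' (fun τ _ => by split_ifs; exacts [(plusW_pos _ _ _).le, le_rfl])
    ⟨fun x => ω x, mem_univ _, ?_⟩
  rw [fillPlus_restrict hω, if_pos hp]
  exact plusW_pos _ _ _

theorem isingZ_four {β : ℝ} (hβ : 0 ≤ β) (Λ : Finset (ℤ × ℤ)) {p₁ p₂ p₃ p₄ : Cfg2 → Prop}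
    (hp : ∀ a b, p₁ a → p₂ b → p₃ (a ⊓ b) ∧ p₄ (a ⊔ b)) :
    isingZ β Λ p₁ * isingZ β Λ p₂ ≤ isingZ β Λ p₃ * isingZ β Λ p₄ := by
  classical
  refine four_events (w₁ := fun τ => plusW β Λ (fillPlus Λ τ))
    (w₂ := fun τ => plusW β Λ (fillPlus Λ τ)) (w₃ := fun τ => plusW β Λ (fillPlus Λ τ))
    (w₄ := fun τ => plusW β Λ (fillPlus Λ τ)) (fun τ => (plusW_pos _ _ _).le)
    (fun τ => (plusW_pos _ _ _).le) (fun τ => (plusW_pos _ _ _).le) (fun τ => (plusW_pos _ _ _).le)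
    (fun a b => ?_) fun a b ha hb => ?_
  · obtain ⟨c, hc⟩ := exists_isingWeight_eq Λ
    have h := fun τ => hc β _ (subset_thicken Λ) (fun x => sub_left_mem_thicken)
      (fun x => sub_down_mem_thicken) _ (fun x => fillPlus_of_notMem (x := x) τ)
    simp only [plusW]
    rw [h a, h b, h (a ⊓ b), h (a ⊔ b), fillPlus_inf, fillPlus_sup, ← Real.exp_add, ← Real.exp_add,
      Real.exp_le_exp]
    have := mul_le_mul_of_nonneg_left
      (fwdE_supermodular (thicken Λ) (fillPlus Λ a) (fillPlus Λ b)) hβ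
    linarith
  · rw [fillPlus_inf, fillPlus_sup]; exact hp _ _ ha hb

theorem exists_isingZ_subset (β : ℝ) {Λ Λ' : Finset (ℤ × ℤ)} (h : Λ ⊆ Λ') :
    ∃ K : ℝ, 0 < K ∧ ∀ p : Cfg2 → Prop,
      isingZ β Λ p = K * isingZ β Λ' fun ω => p ω ∧ ∀ x, x ∈ Λ' → x ∉ Λ → ω x = true := by
  classical
  obtain ⟨c, hc⟩ := exists_isingWeight_eq Λ
  obtain ⟨c', hc'⟩ := exists_isingWeight_eq Λ'
  have hT := subset_thicken Λ'
  refine ⟨Real.exp (β * (c - c')), Real.exp_pos _, fun p => ?_⟩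
  rw [isingZ, isingZ, mul_sum]
  have hout : ∀ τ : ↥Λ → Bool, fillPlus Λ' (fun x => fillPlus Λ τ x) = fillPlus Λ τ := fun τ =>
    fillPlus_restrict fun x hx => fillPlus_of_notMem τ fun hx' => hx (h hx')
  refine Fintype.sum_of_injective (fun (τ : ↥Λ → Bool) (x : ↥Λ') => fillPlus Λ τ x) ?_ _ _ ?_ ?_
  · intro a b hab
    apply fillPlus_injective Λ
    rw [← hout a, ← hout b]
    exact congrArg (fillPlus Λ') hab
  · intro τ hτ
    rw [if_neg, mul_zero]
    rintro ⟨-, hx⟩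
    refine hτ ⟨fun x => fillPlus Λ' τ x, ?_⟩
    have h1 : fillPlus Λ (fun x => fillPlus Λ' τ x) = fillPlus Λ' τ := fillPlus_restrict fun x hx1 => by
      by_cases hx2 : x ∈ Λ'
      · exact hx x hx2 hx1
      · exact fillPlus_of_notMem τ hx2
    funext x
    simp only [h1]
    exact fillPlus_of_mem τ x.2
  · intro τ
    simp only [hout]
    have hcond : (∀ x, x ∈ Λ' → x ∉ Λ → fillPlus Λ τ x = true) := fun x _ hx =>
      fillPlus_of_notMem τ hx
    rw [mul_ite, mul_zero]
    refine if_congr ⟨fun hp => ⟨hp, hcond⟩, fun hp => hp.1⟩ ?_ rfl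
    have e1 := hc β (thicken Λ') (h.trans hT) (fun x hx => sub_left_mem_thicken (h hx))
      (fun x hx => sub_down_mem_thicken (h hx)) _ fun x hx => fillPlus_of_notMem τ hx
    have e2 := hc' β (thicken Λ') hT (fun x hx => sub_left_mem_thicken hx)
      (fun x hx => sub_down_mem_thicken hx) _ fun x hx =>
        fillPlus_of_notMem τ fun hx' => hx (h hx')
    rw [plusW, plusW, e1, e2, ← Real.exp_add]
    congr 1
    ring

end Schonmann

namespace Schonmann

open Matrix Finset Filter Topology MeasureTheory

theorem isingFV_toReal (β : ℝ) (Λ : Finset (ℤ × ℤ)) (p : Cfg2 → Prop) :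
    (isingFV β 0 Λ (fun _ => true) {η | p η}).toReal =
      isingZ β Λ p / isingZ β Λ fun _ => True := by
  classical
  have h1 : ∑ τ : ↥Λ → Bool, ENNReal.ofReal (isingWeight β 0 Λ (fun _ => true)
      (fill Λ (fun _ => true) τ)) = ENNReal.ofReal (isingZ β Λ fun _ => True) := by
    change ∑ τ : ↥Λ → Bool, ENNReal.ofReal (plusW β Λ (fillPlus Λ τ)) = _
    rw [← ENNReal.ofReal_sum_of_nonneg fun τ _ => (plusW_pos β Λ (fillPlus Λ τ)).le]
    simp only [isingZ, if_true]
  have h2 : (∑ τ : ↥Λ → Bool, ENNReal.ofReal (isingWeight β 0 Λ (fun _ => true)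
      (fill Λ (fun _ => true) τ)) • Measure.dirac (fill Λ (fun _ => true) τ)) {η | p η} =
      ENNReal.ofReal (isingZ β Λ p) := by
    rw [Measure.finsetSum_apply, isingZ, ENNReal.ofReal_sum_of_nonneg]
    · refine sum_congr rfl fun τ _ => ?_
      rw [Measure.smul_apply, Measure.dirac_apply, smul_eq_mul]
      by_cases hp : p (fillPlus Λ τ)
      · rw [if_pos hp, Set.indicator_of_mem (by exact hp), Pi.one_apply, mul_one]; rfl
      · rw [if_neg hp, Set.indicator_of_notMem (by exact hp), mul_zero, ENNReal.ofReal_zero]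
    · intro τ _
      split_ifs
      · exact (plusW_pos _ _ _).le
      · exact le_rfl
  rw [isingFV, h1, Measure.smul_apply, h2, smul_eq_mul, ENNReal.toReal_mul, ENNReal.toReal_inv,
    ENNReal.toReal_ofReal (isingZ_nonneg _ _ _), ENNReal.toReal_ofReal (isingZ_nonneg _ _ _),
    div_eq_inv_mul]

theorem abs_sval (b : Bool) : |sval b| = 1 := by cases b <;> norm_num [sval]

theorem abs_sval_pair_sub_le (a a' b b' : Bool) : |sval a * sval a' - sval b * sval b'| ≤ 2 := by
  refine (abs_sub _ _).trans ?_
  rw [abs_mul, abs_mul, abs_sval, abs_sval, abs_sval, abs_sval]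
  norm_num

theorem fwdE_update_le (B : Finset (ℤ × ℤ)) {ω ω' : Cfg2} {x : ℤ × ℤ} (h : ∀ y, y ≠ x → ω y = ω' y) :
    fwdE B ω ≤ fwdE B ω' + 12 := by
  have key : ∀ y, ((sval (ω y) * sval (ω (y + (1, 0))) - 1) +
      (sval (ω y) * sval (ω (y + (0, 1))) - 1)) -
      ((sval (ω' y) * sval (ω' (y + (1, 0))) - 1) + (sval (ω' y) * sval (ω' (y + (0, 1))) - 1)) ≤
      if y ∈ ({x, x - (1, 0), x - (0, 1)} : Finset (ℤ × ℤ)) then 4 else 0 := by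
    intro y
    split_ifs with hy
    · have h1 := (le_abs_self _).trans
        (abs_sval_pair_sub_le (ω y) (ω (y + (1, 0))) (ω' y) (ω' (y + (1, 0))))
      have h2 := (le_abs_self _).trans
        (abs_sval_pair_sub_le (ω y) (ω (y + (0, 1))) (ω' y) (ω' (y + (0, 1))))
      linarith
    · simp only [mem_insert, mem_singleton, not_or] at hy
      rw [h y hy.1, h _ fun e => hy.2.1 (eq_sub_of_add_eq e), h _ fun e => hy.2.2 (eq_sub_of_add_eq e)]
      simp
  have h1 := sum_le_sum fun y (_ : y ∈ B) => key y
  rw [sum_sub_distrib, sum_ite_mem, sum_const] at h1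
  have h2 : (B ∩ ({x, x - (1, 0), x - (0, 1)} : Finset (ℤ × ℤ))).card ≤ 3 :=
    (card_le_card inter_subset_right).trans card_le_three
  have h3 : ((B ∩ ({x, x - (1, 0), x - (0, 1)} : Finset (ℤ × ℤ))).card : ℝ) ≤ 3 := by
    exact_mod_cast h2
  rw [nsmul_eq_mul] at h1
  simp only [fwdE]
  linarith

theorem isingZ_flip_le {β : ℝ} (hβ : 0 ≤ β) {Λ : Finset (ℤ × ℤ)} {x : ℤ × ℤ} (hx : x ∈ Λ)
    {p : Cfg2 → Prop} (hp : ∀ ω b, p ω → p (Function.update ω x b)) (b : Bool) :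
    isingZ β Λ (fun ω => p ω ∧ ω x = !b) ≤
      Real.exp (12 * β) * isingZ β Λ (fun ω => p ω ∧ ω x = b) := by
  classical
  have hinv : Function.Involutive fun τ : ↥Λ → Bool => Function.update τ ⟨x, hx⟩ (!τ ⟨x, hx⟩) := by
    intro τ
    simp
  have hfill : ∀ τ : ↥Λ → Bool, fillPlus Λ (Function.update τ ⟨x, hx⟩ (!τ ⟨x, hx⟩)) =
      Function.update (fillPlus Λ τ) x (!τ ⟨x, hx⟩) := by
    intro τ
    funext y
    by_cases hy : y = x
    · subst hy; rw [fillPlus_of_mem _ hx]; simp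
    · rw [Function.update_of_ne hy]
      by_cases hy' : y ∈ Λ
      · rw [fillPlus_of_mem _ hy', fillPlus_of_mem _ hy', Function.update_of_ne]
        intro e; exact hy (congrArg Subtype.val e)
      · rw [fillPlus_of_notMem _ hy', fillPlus_of_notMem _ hy']
  obtain ⟨c, hc⟩ := exists_isingWeight_eq Λ
  have hW := fun τ => hc β _ (subset_thicken Λ) (fun x => sub_left_mem_thicken)
    (fun x => sub_down_mem_thicken) _ (fun x => fillPlus_of_notMem (x := x) τ)
  rw [isingZ, isingZ, mul_sum, ← Equiv.sum_comp (hinv.toPerm _)]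
  refine sum_le_sum fun τ _ => ?_
  rw [show hinv.toPerm _ τ = Function.update τ ⟨x, hx⟩ (!τ ⟨x, hx⟩) from rfl]
  by_cases h : p (fillPlus Λ (Function.update τ ⟨x, hx⟩ (!τ ⟨x, hx⟩))) ∧
      fillPlus Λ (Function.update τ ⟨x, hx⟩ (!τ ⟨x, hx⟩)) x = !b
  · have h' : p (fillPlus Λ τ) ∧ fillPlus Λ τ x = b := by
      rw [hfill] at h
      have hv : fillPlus Λ τ x = τ ⟨x, hx⟩ := fillPlus_of_mem τ hx
      refine ⟨?_, ?_⟩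
      · have := hp _ (τ ⟨x, hx⟩) h.1
        rwa [Function.update_idem, ← hv, Function.update_eq_self] at this
      · rw [hv]
        have h2 := h.2
        rw [Function.update_self] at h2
        exact Bool.not_inj h2
    rw [if_pos h, if_pos h', plusW, plusW, hW, hW, ← Real.exp_add, Real.exp_le_exp, hfill]
    have := fwdE_update_le (thicken Λ) (x := x)
      (ω := Function.update (fillPlus Λ τ) x (!τ ⟨x, hx⟩)) (ω' := fillPlus Λ τ)
      fun y hy => Function.update_of_ne hy _ _
    nlinarith
  · rw [if_neg h]
    split_ifs
    · exact (mul_pos (Real.exp_pos _) (plusW_pos _ _ _)).le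
    · simp

theorem isingZ_split (β : ℝ) (Λ : Finset (ℤ × ℤ)) (p : Cfg2 → Prop) (x : ℤ × ℤ) (b : Bool) :
    isingZ β Λ p = isingZ β Λ (fun ω => p ω ∧ ω x = b) + isingZ β Λ (fun ω => p ω ∧ ω x = !b) := by
  classical
  rw [isingZ, isingZ, isingZ, ← sum_add_distrib]
  refine sum_congr rfl fun τ _ => ?_
  by_cases h : p (fillPlus Λ τ)
  · by_cases h' : fillPlus Λ τ x = b
    · simp [h, h']
    · have : fillPlus Λ τ x = !b := by
        cases b <;> simpa using h'
      simp [h, this]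
  · simp [h]

/-- Finite energy. -/
theorem isingZ_cylinder_ge {β : ℝ} (hβ : 0 ≤ β) {Λ s : Finset (ℤ × ℤ)} (hs : s ⊆ Λ) (f : Cfg2) :
    isingZ β Λ (fun _ => True) ≤
      (1 + Real.exp (12 * β)) ^ s.card * isingZ β Λ fun ω => ∀ i ∈ s, ω i = f i := by
  classical
  induction s using Finset.induction_on with
  | empty => simp
  | insert x s hx ih =>
    have h1 := ih ((subset_insert x s).trans hs)
    have h2 := isingZ_flip_le hβ (hs (mem_insert_self x s)) (p := fun ω => ∀ i ∈ s, ω i = f i)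
      (fun ω b h i hi => by
        rw [Function.update_of_ne (show i ≠ x from fun e => hx (e ▸ hi))]; exact h i hi) (f x)
    have h3 := isingZ_split β Λ (fun ω => ∀ i ∈ s, ω i = f i) x (f x)
    have h4 : (fun ω : Cfg2 => ∀ i ∈ insert x s, ω i = f i) =
        fun ω => (∀ i ∈ s, ω i = f i) ∧ ω x = f x := by
      funext ω; rw [forall_mem_insert, and_comm]
    rw [card_insert_of_notMem hx, pow_succ, h4]
    refine h1.trans ?_
    rw [mul_assoc]
    refine mul_le_mul_of_nonneg_left ?_ (by positivity)
    rw [h3]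
    linarith

end Schonmann

namespace Schonmann

open Matrix Finset Filter Topology MeasureTheory

/-- The rectangle with `m` columns starting at `-n`, and rows `-M, …, M`. -/
noncomputable def rect (n m M : ℕ) : Finset (ℤ × ℤ) :=
  Icc (-(n : ℤ)) (m - n - 1) ×ˢ Icc (-(M : ℤ)) M

theorem mem_rect {n m M : ℕ} {x : ℤ × ℤ} :
    x ∈ rect n m M ↔ (-(n : ℤ) ≤ x.1 ∧ x.1 ≤ m - n - 1) ∧ -(M : ℤ) ≤ x.2 ∧ x.2 ≤ M := by
  simp [rect]

/-- Columns of a configuration in the upper (`e = 1`) or lower (`e = -1`) half plane. -/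
def cols (m M : ℕ) (n : ℕ) (e : ℤ) (ω : Cfg2) : Fin (m + 1) → St M :=
  fun j i => ω ((j : ℤ) - n - 1, e * (i : ℤ))

/-- The central row of a configuration. -/
def midRow (m : ℕ) (n : ℕ) (ω : Cfg2) : Fin (m + 1) → Bool := fun j => ω ((j : ℤ) - n - 1, 0)

section
variable {n m M : ℕ} {e : ℤ} {ω : Cfg2}

theorem rowSpin_cols (he : e = 1 ∨ e = -1) (hω : ∀ x, x ∉ rect n m M → ω x = true)
    (j : Fin (m + 1)) (P : ℕ) :
    rowSpin (cols m M n e ω j) P = sval (ω ((j : ℤ) - n - 1, e * P)) := by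
  unfold rowSpin
  split_ifs with h
  · rfl
  · rw [hω, sval_true]
    rw [mem_rect]
    rcases he with rfl | rfl <;> simp only <;> omega

theorem rowSpin_cols_succ (he : e = 1 ∨ e = -1) (hω : ∀ x, x ∉ rect n m M → ω x = true)
    (j : Fin (m + 1)) (P : ℕ) :
    rowSpin (cols m M n e ω (j + 1)) P = sval (ω ((j : ℤ) - n - 1 + 1, e * P)) := by
  rw [rowSpin_cols he hω]
  rcases Fin.eq_castSucc_or_eq_last j with ⟨i, rfl⟩ | rfl
  · rw [Fin.coeSucc_eq_succ, Fin.val_succ, Fin.val_castSucc]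
    congr 3
    push_cast; ring
  · rw [Fin.last_add_one, hω, hω]
    · rw [mem_rect]; simp
    · rw [mem_rect]; simp

theorem vertE_cols (he : e = 1 ∨ e = -1) (hω : ∀ x, x ∉ rect n m M → ω x = true)
    (j : Fin (m + 1)) :
    vertE (cols m M n e ω j) = ∑ i ∈ range (M + 1),
      sval (ω ((j : ℤ) - n - 1, e * i)) * sval (ω ((j : ℤ) - n - 1, e * (i + 1))) := by
  rw [vertE, ← Fin.sum_univ_eq_sum_range fun i : ℕ => sval (ω ((j : ℤ) - n - 1, e * i)) *
    sval (ω ((j : ℤ) - n - 1, e * (i + 1)))]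
  refine sum_congr rfl fun i _ => ?_
  rw [rowSpin_cols he hω, rowSpin_cols he hω]
  push_cast
  rfl

theorem horE_cols (he : e = 1 ∨ e = -1) (hω : ∀ x, x ∉ rect n m M → ω x = true)
    (j : Fin (m + 1)) :
    horE (cols m M n e ω j) (cols m M n e ω (j + 1)) = ∑ i ∈ range M,
      sval (ω ((j : ℤ) - n - 1, e * (i + 1))) * sval (ω ((j : ℤ) - n - 1 + 1, e * (i + 1))) := by
  rw [horE, Fin.sum_univ_succ, ← Fin.sum_univ_eq_sum_range fun i : ℕ =>
    sval (ω ((j : ℤ) - n - 1, e * (i + 1))) * sval (ω ((j : ℤ) - n - 1 + 1, e * (i + 1)))]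
  rw [if_pos (Fin.val_zero _), zero_add]
  refine sum_congr rfl fun i _ => ?_
  rw [rowSpin_cols he hω, rowSpin_cols_succ he hω, if_neg (by simp)]
  rw [Fin.val_succ]
  push_cast
  rfl

theorem sum_Icc_symm (M : ℕ) (g : ℤ → ℝ) : ∑ y ∈ Icc (-(M : ℤ) - 1) M, g y =
    ∑ i ∈ range (M + 1), g i + ∑ i ∈ range (M + 1), g (-1 * (i + 1)) := by
  induction M with
  | zero =>
    have : Icc (-((0 : ℕ) : ℤ) - 1) ((0 : ℕ) : ℤ) = {0, -1} := by
      ext y; simp only [mem_Icc, mem_insert, mem_singleton]; omega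
    rw [this, sum_insert (by simp), sum_singleton]
    simp
  | succ M ih =>
    have : Icc (-((M + 1 : ℕ) : ℤ) - 1) ((M + 1 : ℕ) : ℤ) =
        insert ((M + 1 : ℕ) : ℤ) (insert (-1 * (((M + 1 : ℕ) : ℤ) + 1)) (Icc (-(M : ℤ) - 1) M)) := by
      ext y; simp only [mem_Icc, mem_insert]; omega
    rw [this, sum_insert, sum_insert, ih, sum_range_succ _ (M + 1), sum_range_succ _ (M + 1)]
    · ring
    · simp only [mem_Icc]; omega
    · simp only [mem_insert, mem_Icc]; omega

theorem fwdE_rect (hω : ∀ x, x ∉ rect n m M → ω x = true) :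
    fwdE (Icc (-(n : ℤ) - 1) (m - n - 1) ×ˢ Icc (-(M : ℤ) - 1) M) ω =
      (m + 1) * (1 - 4 * (M + 1)) +
      (∑ j, sval (midRow m n ω j) * sval (midRow m n ω (j + 1)) +
      (∑ j, (vertE (cols m M n 1 ω j) + horE (cols m M n 1 ω j) (cols m M n 1 ω (j + 1))) +
       ∑ j, (vertE (cols m M n (-1) ω j) +
        horE (cols m M n (-1) ω j) (cols m M n (-1) ω (j + 1))))) := by
  have hcol : ∀ g : ℤ → ℝ, ∑ x ∈ Icc (-(n : ℤ) - 1) (m - n - 1), g x =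
      ∑ j : Fin (m + 1), g ((j : ℤ) - n - 1) := by
    intro g
    symm
    refine sum_bij (fun j _ => (j : ℤ) - n - 1) ?_ ?_ ?_ ?_
    · intro j _; rw [mem_Icc]; omega
    · intro i _ j _ h; ext; omega
    · intro y hy
      rw [mem_Icc] at hy
      exact ⟨⟨(y + n + 1).toNat, by omega⟩, mem_univ _, by simp only; omega⟩
    · intro j _; rfl
  have hconst : ((m : ℝ) + 1) * (1 - 4 * (M + 1)) = ∑ j : Fin (m + 1), (1 - 4 * ((M : ℝ) + 1)) := by
    simp [mul_sub]
  rw [fwdE, sum_product, hcol, hconst, ← sum_add_distrib, ← sum_add_distrib, ← sum_add_distrib]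
  refine sum_congr rfl fun j _ => ?_
  have h1 : (1 : ℤ) = 1 ∨ (1 : ℤ) = -1 := Or.inl rfl
  have h2 : (-1 : ℤ) = 1 ∨ (-1 : ℤ) = -1 := Or.inr rfl
  have hm1 : sval (midRow m n ω j) = sval (ω ((j : ℤ) - n - 1, 0)) := rfl
  have hm2 : sval (midRow m n ω (j + 1)) = sval (ω ((j : ℤ) - n - 1 + 1, 0)) := by
    have := rowSpin_cols_succ h1 hω j 0
    rw [rowSpin_cols h1 hω] at this
    simpa [midRow] using this
  have htop : ∀ x : ℤ, ω (x, -1 * ((M : ℤ) + 1)) = true := fun x => hω _ (by rw [mem_rect]; simp)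
  rw [vertE_cols h1 hω, vertE_cols h2 hω, horE_cols h1 hω, horE_cols h2 hω, hm1, hm2, sum_Icc_symm]
  simp only [Prod.mk_add_mk, add_zero, one_mul, sum_add_distrib, sum_sub_distrib, sum_const,
    card_range, nsmul_eq_mul, mul_one]
  rw [sum_range_succ' (fun i : ℕ => sval (ω ((j : ℤ) - n - 1, (i : ℤ))) *
      sval (ω ((j : ℤ) - n - 1 + 1, (i : ℤ)))) M,
    sum_range_succ (fun i : ℕ => sval (ω ((j : ℤ) - n - 1, -1 * ((i : ℤ) + 1))) *
      sval (ω ((j : ℤ) - n - 1 + 1, -1 * ((i : ℤ) + 1)))) M, htop, htop, sval_true]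
  have h3 : ∑ i ∈ range (M + 1), sval (ω ((j : ℤ) - n - 1, -1 * ((i : ℤ) + 1))) *
      sval (ω ((j : ℤ) - n - 1, -1 * ((i : ℤ) + 1) + 1)) =
      ∑ i ∈ range (M + 1), sval (ω ((j : ℤ) - n - 1, -1 * (i : ℤ))) *
      sval (ω ((j : ℤ) - n - 1, -1 * ((i : ℤ) + 1))) := by
    refine sum_congr rfl fun i _ => ?_
    rw [mul_comm]
    congr 4
    ring
  rw [h3]
  push_cast
  ring

/-- The configuration in the rectangle with given columns. -/
def unCols (m M n : ℕ) (s s' : Fin (m + 1) → St M) : Cfg2 := fun x =>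
  if 0 ≤ x.2 then s (Fin.ofNat (m + 1) (x.1 + n + 1).toNat) (Fin.ofNat (M + 1) x.2.toNat)
  else s' (Fin.ofNat (m + 1) (x.1 + n + 1).toNat) (Fin.ofNat (M + 1) (-x.2).toNat)

theorem sum_rect_eq (β : ℝ) (n m M : ℕ) : ∃ K : ℝ, 0 < K ∧ ∀ F : (Fin (m + 1) → Bool) → ℝ,
    ∑ τ : ↥(rect n m M) → Bool, F (midRow m n (fillPlus _ τ)) * plusW β (rect n m M) (fillPlus _ τ) =
      K * ∑ x, F x * rowW β M x := by
  classical
  obtain ⟨c, hc⟩ := exists_isingWeight_eq (rect n m M)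
  have hW : ∀ τ : ↥(rect n m M) → Bool, plusW β (rect n m M) (fillPlus _ τ) =
      Real.exp (β * (c + (m + 1) * (1 - 4 * (M + 1)))) *
      (Real.exp (β * ∑ j, sval (midRow m n (fillPlus _ τ) j) *
        sval (midRow m n (fillPlus _ τ) (j + 1))) *
      (pathW β (fun _ => β) (cols m M n 1 (fillPlus _ τ)) *
        pathW β (fun _ => β) (cols m M n (-1) (fillPlus _ τ)))) := by
    intro τ
    have hout := fun x => fillPlus_of_notMem (x := x) τ
    rw [plusW, hc β (Icc (-(n : ℤ) - 1) (m - n - 1) ×ˢ Icc (-(M : ℤ) - 1) M) _ _ _ _ hout,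
      fwdE_rect hout, pathW, pathW, ← Real.exp_add, ← Real.exp_add, ← Real.exp_add]
    · congr 1
      simp only [← mul_add, ← mul_sum]
      ring
    · intro x hx
      rw [mem_rect] at hx; rw [mem_product, mem_Icc, mem_Icc]; omega
    · intro x hx
      rw [mem_rect] at hx; rw [mem_product, mem_Icc, mem_Icc, Prod.fst_sub, Prod.snd_sub]
      simp only; omega
    · intro x hx
      rw [mem_rect] at hx; rw [mem_product, mem_Icc, mem_Icc, Prod.fst_sub, Prod.snd_sub]
      simp only; omega
  refine ⟨Real.exp (β * (c + (m + 1) * (1 - 4 * (M + 1)))), Real.exp_pos _, fun F => ?_⟩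
  have hR : ∑ x : Fin (m + 1) → Bool, F x * rowW β M x =
      ∑ t : (Fin (m + 1) → Bool) × (Fin (m + 1) → St M) × (Fin (m + 1) → St M),
        F t.1 * (Real.exp (β * ∑ j, sval (t.1 j) * sval (t.1 (j + 1))) *
        ((if (t.2.1 0 = fun _ => true) ∧ ∀ j, t.2.1 j 0 = t.1 j
            then pathW β (fun _ => β) t.2.1 else 0) *
          (if (t.2.2 0 = fun _ => true) ∧ ∀ j, t.2.2 j 0 = t.1 j
            then pathW β (fun _ => β) t.2.2 else 0))) := by
    rw [Fintype.sum_prod_type]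
    refine sum_congr rfl fun x _ => ?_
    rw [Fintype.sum_prod_type, rowW, sq, rowZPlus, sum_mul_sum, mul_sum, mul_sum]
    refine sum_congr rfl fun s _ => ?_
    rw [mul_sum, mul_sum]
  rw [hR, mul_sum]
  have hcols : ∀ (τ : ↥(rect n m M) → Bool) (e : ℤ), (cols m M n e (fillPlus _ τ) 0 = fun _ => true) ∧
      ∀ j, cols m M n e (fillPlus _ τ) j 0 = midRow m n (fillPlus _ τ) j := by
    intro τ e
    refine ⟨funext fun i => fillPlus_of_notMem τ ?_, fun j => ?_⟩
    · rw [mem_rect]; simp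
    · simp [cols, midRow]
  refine Fintype.sum_of_injective (fun τ : ↥(rect n m M) → Bool =>
    (midRow m n (fillPlus _ τ), cols m M n 1 (fillPlus _ τ), cols m M n (-1) (fillPlus _ τ)))
    ?_ _ _ ?_ ?_
  · intro a b hab
    simp only [Prod.mk.injEq] at hab
    apply fillPlus_injective
    funext x
    by_cases hx : x ∈ rect n m M
    · rw [mem_rect] at hx
      rcases le_total 0 x.2 with h | h
      · have := congrFun (congrFun hab.2.1 ⟨(x.1 + n + 1).toNat, by omega⟩) ⟨x.2.toNat, by omega⟩
        simp only [cols] at this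
        convert this using 2 <;> ext <;> simp only <;> omega
      · have := congrFun (congrFun hab.2.2 ⟨(x.1 + n + 1).toNat, by omega⟩) ⟨(-x.2).toNat, by omega⟩
        simp only [cols] at this
        convert this using 2 <;> ext <;> simp only <;> omega
    · rw [fillPlus_of_notMem _ hx, fillPlus_of_notMem _ hx]
  · rintro ⟨x, s, s'⟩ ht
    by_cases h1 : (s 0 = fun _ => true) ∧ ∀ j, s j 0 = x j
    · by_cases h2 : (s' 0 = fun _ => true) ∧ ∀ j, s' j 0 = x j
      · exfalso
        apply ht
        have hn1 : ∀ j : Fin (m + 1), Fin.ofNat (m + 1) ((j : ℤ) - n - 1 + n + 1).toNat = j := by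
          intro j
          have : ((j : ℤ) - n - 1 + n + 1).toNat = j := by omega
          rw [this]; exact Fin.ofNat_val_eq_self j
        have hv : ∀ (j : Fin (m + 1)) (i : ℤ), -(M : ℤ) ≤ i → i ≤ M → fillPlus (rect n m M)
            (fun x => unCols m M n s s' x) ((j : ℤ) - n - 1, i) =
            unCols m M n s s' ((j : ℤ) - n - 1, i) := by
          intro j i hi hi'
          by_cases hx : ((j : ℤ) - n - 1, i) ∈ rect n m M
          · rw [fillPlus_of_mem _ hx]
          · rw [fillPlus_of_notMem _ hx]
            have hj : j = 0 := by
              rw [mem_rect] at hx; ext; simp only [Fin.val_zero] at hx ⊢; omega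
            unfold unCols
            simp only [hn1]
            rw [hj, h1.1, h2.1, ite_self]
        have hp : ∀ (j : Fin (m + 1)) (i : Fin (M + 1)), unCols m M n s s' ((j : ℤ) - n - 1, i) = s j i := by
          intro j i
          unfold unCols
          simp only [hn1]
          rw [if_pos (by omega), Int.toNat_natCast, Fin.ofNat_val_eq_self]
        have hq : ∀ (j : Fin (m + 1)) (i : Fin (M + 1)),
            unCols m M n s s' ((j : ℤ) - n - 1, -1 * i) = s' j i := by
          intro j i
          by_cases hi : i = 0
          · subst hi
            have := hp j 0
            simp only [Fin.val_zero, Nat.cast_zero, mul_zero] at this ⊢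
            rw [this, h1.2, h2.2]
          · have : (i : ℕ) ≠ 0 := fun h => hi (Fin.ext h)
            unfold unCols
            simp only [hn1]
            rw [if_neg (by omega), neg_one_mul, neg_neg, Int.toNat_natCast, Fin.ofNat_val_eq_self]
        refine ⟨fun x => unCols m M n s s' x, ?_⟩
        refine Prod.ext ?_ (Prod.ext ?_ ?_)
        · funext j
          simp only [midRow]
          rw [hv j 0 (by omega) (by omega)]
          have := hp j 0
          simp only [Fin.val_zero, Nat.cast_zero] at this
          rw [this, h1.2]
        · funext j i
          simp only [cols, one_mul]
          rw [hv j i (by omega) (by omega), hp]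
        · funext j i
          simp only [cols]
          rw [hv j _ (by omega) (by omega), hq]
      · simp only [if_neg h2, mul_zero]
    · simp only [if_neg h1, mul_zero, zero_mul]
  · intro τ
    simp only
    rw [if_pos (hcols τ 1), if_pos (hcols τ (-1)), hW]
    ring

theorem isingZ_rect_eq (β : ℝ) (n m M : ℕ) : ∃ K : ℝ, 0 < K ∧
    ∀ (p : Cfg2 → Prop) (q : (Fin (m + 1) → Bool) → Prop) [DecidablePred q],
      (∀ ω, (∀ x, x ∉ rect n m M → ω x = true) → (p ω ↔ q (midRow m n ω))) →
      isingZ β (rect n m M) p = K * ∑ x, (if q x then 1 else 0) * rowW β M x := by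
  obtain ⟨K, hK, h⟩ := sum_rect_eq β n m M
  refine ⟨K, hK, fun p q _ hpq => ?_⟩
  rw [← h, isingZ]
  refine sum_congr rfl fun τ _ => ?_
  have h1 := hpq (fillPlus _ τ) fun x hx => fillPlus_of_notMem τ hx
  rw [boole_mul]
  by_cases h2 : q (midRow m n (fillPlus _ τ))
  · rw [if_pos (h1.mpr h2), if_pos h2]
  · rw [if_neg fun h3 => h2 (h1.mp h3), if_neg h2]

end

end Schonmann

namespace Schonmann

open Finset hiding box
open Matrix Filter Topology MeasureTheory

/-- The configuration on the line agrees with `f` on `S`. -/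
def RowPat (S : Finset ℤ) (f : ℤ → Bool) (η : ZSeq Bool) : Prop := ∀ i ∈ S, η i = f i

theorem RowPat.inf_sup {S S' : Finset ℤ} {f g a b : ℤ → Bool}
    (h : ∀ i ∈ S, i ∈ S' → f i ≤ g i) (h1 : ∀ i ∈ S, i ∉ S' → f i = false)
    (h2 : ∀ i ∈ S', i ∉ S → g i = true) (ha : RowPat S f a) (hb : RowPat S' g b) :
    RowPat S f (a ⊓ b) ∧ RowPat S' g (a ⊔ b) := by
  refine ⟨fun i hi => ?_, fun i hi => ?_⟩
  · rw [Pi.inf_apply, ha i hi]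
    by_cases hi' : i ∈ S'
    · rw [hb i hi', inf_eq_left.mpr (h i hi hi')]
    · rw [h1 i hi hi']; exact Bool.false_and _
  · rw [Pi.sup_apply, hb i hi]
    by_cases hi' : i ∈ S
    · rw [ha i hi', sup_eq_right.mpr (h i hi' hi)]
    · rw [h2 i hi hi']; exact Bool.or_true _

theorem rowPat_origin {S : Finset ℤ} (hS : (0 : ℤ) ∉ S) (f : ℤ → Bool) (η : ZSeq Bool) :
    RowPat (insert 0 S) (Function.update f 0 true) η ↔ η 0 = true ∧ RowPat S f η := by
  rw [RowPat, forall_mem_insert, Function.update_self]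
  refine and_congr_right fun _ => forall₂_congr fun i hi => ?_
  rw [Function.update_of_ne (show i ≠ 0 from fun e => hS (e ▸ hi))]

theorem RowPat.origin_inf_sup {S S' : Finset ℤ} (hS : (0 : ℤ) ∉ S) (hS' : (0 : ℤ) ∉ S')
    {f g a b : ℤ → Bool}
    (h : ∀ i ∈ S, i ∈ S' → f i ≤ g i) (h1 : ∀ i ∈ S, i ∉ S' → f i = false)
    (h2 : ∀ i ∈ S', i ∉ S → g i = true)
    (ha : RowPat (insert 0 S) (Function.update f 0 true) a) (hb : RowPat S' g b) :
    RowPat S f (a ⊓ b) ∧ RowPat (insert 0 S') (Function.update g 0 true) (a ⊔ b) := by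
  rw [rowPat_origin hS] at ha
  rw [rowPat_origin hS']
  have := RowPat.inf_sup h h1 h2 ha.2 hb
  refine ⟨this.1, ?_, this.2⟩
  rw [Pi.sup_apply, ha.1]
  exact Bool.true_or _

/-- Probability of a cylinder. -/
noncomputable def nuR (ν : Measure (ZSeq Bool)) (S : Finset ℤ) (f : ℤ → Bool) : ℝ :=
  (ν {η | RowPat S f η}).toReal

/-- Probability of a cylinder intersected with a plus spin at the origin. -/
noncomputable def nuO (ν : Measure (ZSeq Bool)) (S : Finset ℤ) (f : ℤ → Bool) : ℝ :=
  nuR ν (insert 0 S) (Function.update f 0 true)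

/-- Weight of a cylinder on the line. -/
noncomputable def rowPatZ (β : ℝ) (Λ : Finset (ℤ × ℤ)) (S : Finset ℤ) (f : ℤ → Bool) : ℝ :=
  isingZ β Λ fun ω => RowPat S f (lineProj ω)

theorem isingZ_dom {β : ℝ} (hβ : 0 ≤ β) {Λ Λ' : Finset (ℤ × ℤ)} (h : Λ ⊆ Λ')
    {p₁ p₂ p₃ p₄ : Cfg2 → Prop} (hp : ∀ a b, p₁ a → p₂ b → p₃ (a ⊓ b) ∧ p₄ (a ⊔ b)) :
    isingZ β Λ' p₁ * isingZ β Λ p₂ ≤ isingZ β Λ' p₃ * isingZ β Λ p₄ := by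
  obtain ⟨K, hK, hZ⟩ := exists_isingZ_subset β h
  rw [hZ p₂, hZ p₄, mul_left_comm, mul_left_comm _ K]
  refine mul_le_mul_of_nonneg_left (isingZ_four hβ Λ' fun a b ha hb => ?_) hK.le
  refine ⟨(hp a b ha hb.1).1, (hp a b ha hb.1).2, fun x hx hx' => ?_⟩
  rw [Pi.sup_apply, hb.2 x hx hx']
  exact Bool.or_true _

theorem rowPatZ_dom {β : ℝ} (hβ : 0 ≤ β) {Λ Λ' : Finset (ℤ × ℤ)} (h : Λ ⊆ Λ')
    {S₁ S₂ S₃ S₄ : Finset ℤ} {f₁ f₂ f₃ f₄ : ℤ → Bool}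
    (hp : ∀ a b, RowPat S₁ f₁ a → RowPat S₂ f₂ b → RowPat S₃ f₃ (a ⊓ b) ∧ RowPat S₄ f₄ (a ⊔ b)) :
    rowPatZ β Λ' S₁ f₁ * rowPatZ β Λ S₂ f₂ ≤ rowPatZ β Λ' S₃ f₃ * rowPatZ β Λ S₄ f₄ :=
  isingZ_dom hβ h fun _ _ ha hb => hp _ _ ha hb

theorem mem_box {n : ℕ} {x : ℤ × ℤ} :
    x ∈ box n ↔ (-(n : ℤ) ≤ x.1 ∧ x.1 ≤ n) ∧ -(n : ℤ) ≤ x.2 ∧ x.2 ≤ n := by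
  simp [box]

theorem measurable_lineProj : Measurable lineProj :=
  measurable_pi_lambda _ fun _ => measurable_pi_apply _

theorem measurableSet_rowPat (S : Finset ℤ) (f : ℤ → Bool) : MeasurableSet {η | RowPat S f η} := by
  have : {η : ZSeq Bool | RowPat S f η} = ⋂ i ∈ S, {η | η i = f i} := by
    ext η; simp [RowPat]
  rw [this]
  exact Finset.measurableSet_biInter _ fun i _ =>
    (measurable_pi_apply i : Measurable fun η : ZSeq Bool => η i) (MeasurableSet.singleton (f i))

theorem rowPat_eq_cylinder (S : Finset ℤ) (f : ℤ → Bool) :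
    {ω : Cfg2 | RowPat S f (lineProj ω)} =
      {ω | ∀ x ∈ S.image fun i => (i, (0 : ℤ)), ω x = f x.1} := by
  ext ω
  simp [RowPat, lineProj]

theorem rowPatZ_eq_cylinder (β : ℝ) (Λ : Finset (ℤ × ℤ)) (S : Finset ℤ) (f : ℤ → Bool) :
    rowPatZ β Λ S f = isingZ β Λ fun ω => ∀ x ∈ S.image fun i => (i, (0 : ℤ)), ω x = f x.1 := by
  rw [rowPatZ]
  congr 1
  exact rowPat_eq_cylinder S f

theorem isingZ_true_pos (β : ℝ) (Λ : Finset (ℤ × ℤ)) : 0 < isingZ β Λ fun _ => True :=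
  isingZ_pos β (ω := fun _ => true) trivial fun _ _ => rfl

section
variable {β : ℝ} {μp : Measure Cfg2}

theorem isProbabilityMeasure_schonmann (hμp : IsPlusPhase β 0 μp) :
    IsProbabilityMeasure (schonmann μp) :=
  have := hμp.1
  Measure.isProbabilityMeasure_map measurable_lineProj.aemeasurable

theorem tendsto_nuR (hμp : IsPlusPhase β 0 μp) (S : Finset ℤ) (f : ℤ → Bool) :
    Tendsto (fun n => rowPatZ β (box n) S f / isingZ β (box n) fun _ => True) atTop
      (𝓝 (nuR (schonmann μp) S f)) := by
  have := hμp.1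
  have h := hμp.2 (S.image fun i => (i, (0 : ℤ))) fun x => f x.1
  have h1 := (ENNReal.tendsto_toReal (measure_ne_top μp _)).comp h
  have h2 : nuR (schonmann μp) S f =
      (μp {ω | ∀ x ∈ S.image fun i => (i, (0 : ℤ)), ω x = f x.1}).toReal := by
    rw [← rowPat_eq_cylinder, nuR, schonmann, Measure.map_apply measurable_lineProj
      (measurableSet_rowPat S f)]
    rfl
  rw [h2]
  refine h1.congr fun n => ?_
  rw [Function.comp_apply, isingFV_toReal, rowPatZ_eq_cylinder]

theorem nuR_pos (hβ : 0 ≤ β) (hμp : IsPlusPhase β 0 μp) (S : Finset ℤ) (f : ℤ → Bool) :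
    0 < nuR (schonmann μp) S f := by
  have hE : 0 < (1 + Real.exp (12 * β)) ^ (S.image fun i => (i, (0 : ℤ))).card := by positivity
  refine (inv_pos.mpr hE).trans_le (ge_of_tendsto (tendsto_nuR hμp S f) ?_)
  have hbox : ∃ n₀ : ℕ, ∀ n ≥ n₀, (S.image fun i => (i, (0 : ℤ))) ⊆ box n := by
    refine ⟨S.sup Int.natAbs, fun n hn x hx => ?_⟩
    obtain ⟨i, hi, rfl⟩ := mem_image.mp hx
    have : i.natAbs ≤ S.sup Int.natAbs := le_sup (f := Int.natAbs) hi
    rw [mem_box]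
    simp only
    omega
  obtain ⟨n₀, hn₀⟩ := hbox
  filter_upwards [eventually_ge_atTop n₀] with n hn
  rw [le_div_iff₀ (isingZ_true_pos _ _), inv_mul_le_iff₀ hE, rowPatZ_eq_cylinder]
  exact isingZ_cylinder_ge hβ (hn₀ n hn) fun x => f x.1

theorem nuR_four (hβ : 0 ≤ β) (hμp : IsPlusPhase β 0 μp)
    {S₁ S₂ S₃ S₄ : Finset ℤ} {f₁ f₂ f₃ f₄ : ℤ → Bool}
    (hp : ∀ a b, RowPat S₁ f₁ a → RowPat S₂ f₂ b → RowPat S₃ f₃ (a ⊓ b) ∧ RowPat S₄ f₄ (a ⊔ b)) :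
    nuR (schonmann μp) S₁ f₁ * nuR (schonmann μp) S₂ f₂ ≤
      nuR (schonmann μp) S₃ f₃ * nuR (schonmann μp) S₄ f₄ := by
  refine le_of_tendsto_of_tendsto' ((tendsto_nuR hμp S₁ f₁).mul (tendsto_nuR hμp S₂ f₂))
    ((tendsto_nuR hμp S₃ f₃).mul (tendsto_nuR hμp S₄ f₄)) fun n => ?_
  rw [div_mul_div_comm, div_mul_div_comm]
  exact div_le_div_of_nonneg_right (rowPatZ_dom hβ (Subset.refl _) hp)
    (mul_pos (isingZ_true_pos _ _) (isingZ_true_pos _ _)).le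

theorem rowPatZ_pos (β : ℝ) {Λ : Finset (ℤ × ℤ)} {S : Finset ℤ} (f : ℤ → Bool)
    (hS : ∀ i ∈ S, (i, (0 : ℤ)) ∈ Λ) : 0 < rowPatZ β Λ S f := by
  classical
  refine isingZ_pos β (ω := fun x => if x ∈ Λ then f x.1 else true) (fun i hi => ?_) fun x hx =>
    if_neg hx
  exact if_pos (hS i hi)

/-- The block `-(k+N), …, -(k+1)`. -/
noncomputable def farBlock (k N : ℕ) : Finset ℤ := Icc (-((k : ℤ) + N)) (-((k : ℤ) + 1))

theorem mem_farBlock {k N : ℕ} {i : ℤ} :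
    i ∈ farBlock k N ↔ -((k : ℤ) + N) ≤ i ∧ i ≤ -((k : ℤ) + 1) := mem_Icc

theorem zero_notMem_farBlock (k N : ℕ) : (0 : ℤ) ∉ farBlock k N := by
  rw [mem_farBlock]; omega

theorem leftEvt_midRow_iff {r k m : ℕ} (hr : r ≤ m) (b : Bool) (ω : Cfg2) :
    RowPat (farBlock k r) (fun _ => b) (lineProj ω) ↔ LeftEvt r b (midRow m (r + k) ω) := by
  simp only [RowPat, mem_farBlock, LeftEvt, lineProj, midRow]
  constructor
  · intro h c h1 h2
    exact h _ (by push_cast; omega)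
  · intro h i hi
    have := h ⟨(i + r + k + 1).toNat, by omega⟩ (by simp only; omega) (by simp only; omega)
    simp only at this
    rw [← this]
    congr 2
    push_cast
    omega

theorem rect_influence_le (hβ : betaCrit < β) : ∃ C lam : ℝ, 0 ≤ C ∧ 1 < lam ∧ ∀ k N : ℕ,
    ∃ (r : ℕ) (Λ : Finset (ℤ × ℤ)), N ≤ r ∧ box N ⊆ Λ ∧ (∀ i ∈ farBlock k r, (i, (0 : ℤ)) ∈ Λ) ∧
      rowPatZ β Λ (insert 0 (farBlock k r)) (Function.update (fun _ => true) 0 true) /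
          rowPatZ β Λ (farBlock k r) (fun _ => true) -
        rowPatZ β Λ (insert 0 (farBlock k r)) (Function.update (fun _ => false) 0 true) /
          rowPatZ β Λ (farBlock k r) (fun _ => false) ≤ C * (lam⁻¹) ^ k := by
  obtain ⟨C, lam, hC, hlam, H⟩ := exists_row_influence_le hβ
  have hlam0 : 0 < lam := by linarith
  refine ⟨C / 2 / lam, lam, by positivity, hlam, fun k N => ?_⟩
  obtain ⟨r, m, M, hr, hM, hm, h⟩ := H (k + 1) N
  have h := h ⟨r + (k + 1), by omega⟩ rfl
  have hmem : ∀ i ∈ farBlock k r, (i, (0 : ℤ)) ∈ rect (r + k) m M := by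
    intro i hi
    rw [mem_farBlock] at hi
    rw [mem_rect]; simp only; push_cast; omega
  refine ⟨r, rect (r + k) m M, hr, fun x hx => ?_, hmem, ?_⟩
  · rw [mem_box] at hx
    rw [mem_rect]; push_cast; omega
  obtain ⟨K, hK, hZ⟩ := isingZ_rect_eq β (r + k) m M
  have hL : ∀ b, rowPatZ β (rect (r + k) m M) (farBlock k r) (fun _ => b) =
      K * leftZ (m := m) β M r b fun _ => 1 := fun b =>
    hZ _ (LeftEvt r b) fun ω _ => leftEvt_midRow_iff (by omega) b ω
  have hO : ∀ b, 2 * rowPatZ β (rect (r + k) m M) (insert 0 (farBlock k r))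
      (Function.update (fun _ => b) 0 true) = K * leftZ (m := m) β M r b (fun _ => 1) +
        K * leftZ (m := m) β M r b fun x => sval (x ⟨r + (k + 1), by omega⟩) := by
    intro b
    rw [rowPatZ, hZ _ (fun x => x ⟨r + (k + 1), by omega⟩ = true ∧ LeftEvt r b x), ← mul_add,
      leftZ, leftZ, mul_left_comm, mul_sum, ← sum_add_distrib]
    · congr 1
      refine sum_congr rfl fun x _ => ?_
      by_cases h1 : LeftEvt r b x <;> by_cases h2 : x ⟨r + (k + 1), by omega⟩ = true
      · simp only [h1, h2, and_true, if_true, sval_true]; ring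
      · rw [Bool.not_eq_true] at h2
        simp only [h1, h2, if_true, sval_false]; simp
      · simp [h1]
      · simp [h1]
    · intro ω _
      rw [rowPat_origin (zero_notMem_farBlock k r), leftEvt_midRow_iff (by omega : r ≤ m)]
      refine and_congr_left fun _ => ?_
      simp only [lineProj, midRow]
      rw [show ((r + (k + 1) : ℕ) : ℤ) - (r + k : ℕ) - 1 = 0 by push_cast; ring]
  have ha1 := rowPatZ_pos β (fun _ => true) hmem
  have ha2 := rowPatZ_pos β (fun _ => false) hmem
  have hO1 := hO true
  have hO2 := hO false
  rw [hL] at ha1 ha2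
  rw [hL, hL]
  set l1 := leftZ (m := m) β M r true fun _ => 1
  set l2 := leftZ (m := m) β M r false fun _ => 1
  set s1 := leftZ (m := m) β M r true fun x => sval (x ⟨r + (k + 1), by omega⟩)
  set s2 := leftZ (m := m) β M r false fun x => sval (x ⟨r + (k + 1), by omega⟩)
  have hl1 : 0 < l1 := (mul_pos_iff_of_pos_left hK).mp ha1
  have hl2 : 0 < l2 := (mul_pos_iff_of_pos_left hK).mp ha2
  have e1 : rowPatZ β (rect (r + k) m M) (insert 0 (farBlock k r))
      (Function.update (fun _ => true) 0 true) = K * (l1 + s1) / 2 := by linarith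
  have e2 : rowPatZ β (rect (r + k) m M) (insert 0 (farBlock k r))
      (Function.update (fun _ => false) 0 true) = K * (l2 + s2) / 2 := by linarith
  have e3 : K * (l1 + s1) / 2 / (K * l1) - K * (l2 + s2) / 2 / (K * l2) =
      (s1 * l2 - l1 * s2) / (2 * (l1 * l2)) := by
    field_simp; ring
  rw [e1, e2, e3, div_le_iff₀ (by positivity)]
  have h3 : lam ^ (k + 1) * (s1 * l2 - l1 * s2) ≤ C * (l1 * l2) := by
    refine le_trans (mul_le_mul_of_nonneg_left ?_ (by positivity)) h
    rw [abs_sub_comm]; exact le_abs_self _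
  have h4 : C / 2 / lam * lam⁻¹ ^ k * (2 * (l1 * l2)) = C * (l1 * l2) / lam ^ (k + 1) := by
    rw [inv_pow, pow_succ]; field_simp
  rw [h4, le_div_iff₀ (by positivity)]
  linarith

theorem rowPatZ_corr {β : ℝ} (hβ : 0 ≤ β) {Λ Λ' : Finset (ℤ × ℤ)} (h : Λ ⊆ Λ') {k N N' : ℕ} {b : Bool}
    (h1 : N' < N → b = false) (h2 : N < N' → b = true) :
    rowPatZ β Λ' (insert 0 (farBlock k N)) (Function.update (fun _ => b) 0 true) *
        rowPatZ β Λ (farBlock k N') (fun _ => b) ≤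
      rowPatZ β Λ' (farBlock k N) (fun _ => b) *
        rowPatZ β Λ (insert 0 (farBlock k N')) (Function.update (fun _ => b) 0 true) := by
  refine rowPatZ_dom hβ h fun a b ha hb => RowPat.origin_inf_sup (zero_notMem_farBlock _ _)
    (zero_notMem_farBlock _ _) (fun _ _ _ => le_rfl) (fun i hi hi' => h1 ?_) (fun i hi hi' => h2 ?_) ha hb
  · rw [mem_farBlock] at hi hi'; omega
  · rw [mem_farBlock] at hi hi'; omega

theorem exists_influence_le (hβ : betaCrit < β) (hμp : IsPlusPhase β 0 μp) :
    ∃ C lam : ℝ, 0 ≤ C ∧ 1 < lam ∧ ∀ k N : ℕ,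
      nuO (schonmann μp) (farBlock k N) (fun _ => true) /
          nuR (schonmann μp) (farBlock k N) (fun _ => true) -
        nuO (schonmann μp) (farBlock k N) (fun _ => false) /
          nuR (schonmann μp) (farBlock k N) (fun _ => false) ≤ C * (lam⁻¹) ^ k := by
  have h0 : 0 ≤ β := (betaCrit_pos.trans hβ).le
  obtain ⟨C, lam, hC, hlam, H⟩ := rect_influence_le hβ
  refine ⟨C, lam, hC, hlam, fun k N => ?_⟩
  have hν := nuR_pos h0 hμp
  rw [sub_le_comm]
  have hlim : Tendsto (fun n =>
      rowPatZ β (box n) (insert 0 (farBlock k N)) (Function.update (fun _ => false) 0 true) /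
        rowPatZ β (box n) (farBlock k N) fun _ => false) atTop
      (𝓝 (nuO (schonmann μp) (farBlock k N) (fun _ => false) /
        nuR (schonmann μp) (farBlock k N) fun _ => false)) := by
    refine ((tendsto_nuR hμp (insert 0 (farBlock k N)) (Function.update (fun _ => false) 0 true)).div
      (tendsto_nuR hμp (farBlock k N) fun _ => false) (hν _ _).ne').congr fun n => ?_
    exact div_div_div_cancel_right₀ (isingZ_true_pos _ _).ne' _ _
  refine ge_of_tendsto hlim ?_
  filter_upwards [eventually_ge_atTop (N + k)] with n hn
  obtain ⟨r, Λ, hr, hbox, hmem, hle⟩ := H k n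
  have hT : ∀ i ∈ farBlock k N, (i, (0 : ℤ)) ∈ box n := by
    intro i hi
    rw [mem_farBlock] at hi; rw [mem_box]; simp only; omega
  have hpΛ := fun b => rowPatZ_pos β (fun _ => b) hmem
  have hpb := rowPatZ_pos β (fun _ => false) hT
  have hlow := rowPatZ_corr h0 hbox (k := k) (N := r) (N' := N) (b := false) (fun _ => rfl)
    fun h => absurd h (by omega)
  have hup : nuO (schonmann μp) (farBlock k N) (fun _ => true) *
      rowPatZ β Λ (farBlock k r) (fun _ => true) ≤
      nuR (schonmann μp) (farBlock k N) (fun _ => true) *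
      rowPatZ β Λ (insert 0 (farBlock k r)) (Function.update (fun _ => true) 0 true) := by
    refine le_of_tendsto_of_tendsto ((tendsto_nuR hμp _ _).mul_const _)
      ((tendsto_nuR hμp _ _).mul_const _) ?_
    filter_upwards [eventually_ge_atTop (Λ.sup fun x => max x.1.natAbs x.2.natAbs)] with n' hn'
    have hsub : Λ ⊆ box n' := by
      intro x hx
      have := (le_sup (f := fun x : ℤ × ℤ => max x.1.natAbs x.2.natAbs) hx).trans hn'
      rw [mem_box]
      simp only [sup_le_iff] at this
      omega
    rw [div_mul_eq_mul_div, div_mul_eq_mul_div]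
    exact div_le_div_of_nonneg_right (rowPatZ_corr h0 hsub (fun h => absurd h (by omega))
      fun _ => rfl) (isingZ_true_pos _ _).le
  have hup' := (div_le_div_iff₀ (hν (farBlock k N) fun _ => true) (hpΛ true)).mpr
    (hup.trans_eq (mul_comm _ _))
  have hlow' := (div_le_div_iff₀ (hpΛ false) hpb).mpr (hlow.trans_eq (mul_comm _ _))
  linarith

end

end Schonmann

namespace Schonmann

open Finset hiding box
open Matrix Filter Topology MeasureTheory

/-- The block `-n, …, -1`. -/
noncomputable def pastBlock (n : ℕ) : Finset ℤ := Icc (-(n : ℤ)) (-1)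

theorem mem_pastBlock {n : ℕ} {i : ℤ} : i ∈ pastBlock n ↔ -(n : ℤ) ≤ i ∧ i ≤ -1 := mem_Icc

theorem zero_notMem_pastBlock (n : ℕ) : (0 : ℤ) ∉ pastBlock n := by
  rw [mem_pastBlock]; omega

/-- The pattern equal to the past `ω` on `-k, …, -1` and to `b` further away. -/
def extPast (b : Bool) (ω : Past Bool) (k : ℕ) : ℤ → Bool :=
  fun i => if -(k : ℤ) ≤ i then ω (i.natAbs - 1) else b

/-- Conditional probability of a plus spin at the origin. -/
noncomputable def condO (ν : Measure (ZSeq Bool)) (S : Finset ℤ) (f : ℤ → Bool) : ℝ :=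
  nuO ν S f / nuR ν S f

/-- Influence of the spins at `-(k+N), …, -(k+1)` on the origin, given the past `ω` up to `-k`. -/
noncomputable def influence (ν : Measure (ZSeq Bool)) (k N : ℕ) (ω : Past Bool) : ℝ :=
  condO ν (pastBlock (k + N)) (extPast true ω k) - condO ν (pastBlock (k + N)) (extPast false ω k)

/-- Extend a finite past by plus spins. -/
def padPast {k : ℕ} (y : Fin k → Bool) : Past Bool := fun j => if h : j < k then y ⟨j, h⟩ else true

/-- The most recent `k` symbols of a past. -/
def recent (k : ℕ) (ω : Past Bool) : Fin k → Bool := fun j => ω j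

theorem padPast_recent {k : ℕ} (ω : Past Bool) {j : ℕ} (hj : j < k) :
    padPast (recent k ω) j = ω j := dif_pos hj

theorem extPast_congr {b : Bool} {ω ω' : Past Bool} {k : ℕ} (h : ∀ j < k, ω j = ω' j) {i : ℤ}
    (hi : i ≤ -1) : extPast b ω k i = extPast b ω' k i := by
  unfold extPast
  split_ifs with h'
  · exact h _ (by omega)
  · rfl

theorem extPast_padPast_inf (b : Bool) {k : ℕ} (x y : Fin k → Bool) {i : ℤ} (hi : i ≤ -1) :
    extPast b (padPast (x ⊓ y)) k i = (extPast b (padPast x) k ⊓ extPast b (padPast y) k) i := by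
  rw [Pi.inf_apply]
  unfold extPast padPast
  by_cases h : -(k : ℤ) ≤ i
  · have : i.natAbs - 1 < k := by omega
    simp [h, this]
  · simp [h]

theorem extPast_padPast_sup (b : Bool) {k : ℕ} (x y : Fin k → Bool) {i : ℤ} (hi : i ≤ -1) :
    extPast b (padPast (x ⊔ y)) k i = (extPast b (padPast x) k ⊔ extPast b (padPast y) k) i := by
  rw [Pi.sup_apply]
  unfold extPast padPast
  by_cases h : -(k : ℤ) ≤ i
  · have : i.natAbs - 1 < k := by omega
    simp [h, this]
  · simp [h]

theorem extPast_padPast_mono (b : Bool) {k : ℕ} {x y : Fin k → Bool} (hxy : x ≤ y) {i : ℤ}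
    (hi : i ≤ -1) : extPast b (padPast x) k i ≤ extPast b (padPast y) k i := by
  have h := extPast_padPast_inf b x y hi
  rw [inf_eq_left.mpr hxy] at h
  rw [h]
  exact inf_le_right

theorem rowPat_congr {S : Finset ℤ} {f g : ℤ → Bool} (h : ∀ i ∈ S, f i = g i) (η : ZSeq Bool) :
    RowPat S f η ↔ RowPat S g η :=
  forall₂_congr fun i hi => by rw [h i hi]

theorem nuR_congr (ν : Measure (ZSeq Bool)) {S : Finset ℤ} {f g : ℤ → Bool}
    (h : ∀ i ∈ S, f i = g i) : nuR ν S f = nuR ν S g := by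
  simp only [nuR, rowPat_congr h]

theorem nuO_congr (ν : Measure (ZSeq Bool)) {S : Finset ℤ} {f g : ℤ → Bool}
    (h : ∀ i ∈ S, f i = g i) : nuO ν S f = nuO ν S g := by
  refine nuR_congr ν fun i hi => ?_
  by_cases h0 : i = 0
  · subst h0; simp
  · rw [Function.update_of_ne h0, Function.update_of_ne h0]
    exact h i ((mem_insert.mp hi).resolve_left h0)

theorem condO_congr (ν : Measure (ZSeq Bool)) {S : Finset ℤ} {f g : ℤ → Bool}
    (h : ∀ i ∈ S, f i = g i) : condO ν S f = condO ν S g := by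
  rw [condO, condO, nuR_congr ν h, nuO_congr ν h]

theorem influence_congr (ν : Measure (ZSeq Bool)) {k : ℕ} (N : ℕ) {ω ω' : Past Bool}
    (h : ∀ j < k, ω j = ω' j) : influence ν k N ω = influence ν k N ω' := by
  rw [influence, influence, condO_congr ν fun i hi => extPast_congr h (mem_pastBlock.mp hi).2,
    condO_congr ν fun i hi => extPast_congr h (mem_pastBlock.mp hi).2]

theorem sum_nuR_fiber (ν : Measure (ZSeq Bool)) [IsProbabilityMeasure ν] {k : ℕ} {S T : Finset ℤ}
    {g : (Fin k → Bool) → ℤ → Bool} {f : ℤ → Bool}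
    (h : ∀ y η, RowPat S (g y) η ↔ recent k (restrictPast η) = y ∧ RowPat T f η) :
    ∑ y, nuR ν S (g y) = nuR ν T f := by
  have hmeas : Measurable fun η : ZSeq Bool => recent k (restrictPast η) :=
    measurable_pi_lambda _ fun _ => measurable_pi_apply _
  have h1 := sum_measure_preimage_singleton (μ := ν.restrict {η | RowPat T f η}) univ
    (f := fun η : ZSeq Bool => recent k (restrictPast η))
    fun y _ => hmeas (measurableSet_singleton y)
  rw [coe_univ, Set.preimage_univ, Measure.restrict_apply_univ] at h1
  rw [nuR, ← h1, ENNReal.toReal_sum fun y _ => measure_ne_top _ _]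
  refine sum_congr rfl fun y _ => ?_
  rw [nuR, Measure.restrict_apply (hmeas (measurableSet_singleton y))]
  congr 2
  ext η
  exact h y η

theorem rowPat_extPast_padPast_iff {k N : ℕ} (b : Bool) (y : Fin k → Bool) (η : ZSeq Bool) :
    RowPat (pastBlock (k + N)) (extPast b (padPast y) k) η ↔
      recent k (restrictPast η) = y ∧ RowPat (farBlock k N) (fun _ => b) η := by
  constructor
  · intro h
    constructor
    · funext j
      have := h (-((j : ℤ) + 1)) (by rw [mem_pastBlock]; push_cast; omega)
      rw [recent, restrictPast, this, extPast, if_pos (by omega)]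
      have hj : (-((j : ℤ) + 1)).natAbs - 1 = j := by omega
      rw [hj, padPast, dif_pos j.2]
    · intro i hi
      rw [mem_farBlock] at hi
      rw [h i (by rw [mem_pastBlock]; push_cast; omega), extPast, if_neg (by omega)]
  · rintro ⟨rfl, h⟩ i hi
    rw [mem_pastBlock] at hi
    push_cast at hi
    rw [extPast]
    split_ifs with h'
    · rw [padPast_recent _ (by omega), restrictPast]
      congr 1
      omega
    · exact h i (by rw [mem_farBlock]; omega)

section
variable {β : ℝ} {μp : Measure Cfg2}

theorem nuO_le_nuR (hμp : IsPlusPhase β 0 μp) {S : Finset ℤ} (hS : (0 : ℤ) ∉ S) (f : ℤ → Bool) :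
    nuO (schonmann μp) S f ≤ nuR (schonmann μp) S f := by
  have := isProbabilityMeasure_schonmann hμp
  refine ENNReal.toReal_mono (measure_ne_top _ _) (measure_mono fun η hη => ?_)
  exact ((rowPat_origin hS f η).mp hη).2

theorem condO_mem_Icc (hμp : IsPlusPhase β 0 μp) {S : Finset ℤ} (hS : (0 : ℤ) ∉ S) (f : ℤ → Bool) :
    condO (schonmann μp) S f ∈ Set.Icc (0 : ℝ) 1 :=
  ⟨div_nonneg ENNReal.toReal_nonneg ENNReal.toReal_nonneg,
    div_le_one_of_le₀ (nuO_le_nuR hμp hS f) ENNReal.toReal_nonneg⟩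

theorem nuO_eq (hβ : 0 ≤ β) (hμp : IsPlusPhase β 0 μp) (S : Finset ℤ) (f : ℤ → Bool) :
    nuO (schonmann μp) S f = nuR (schonmann μp) S f * condO (schonmann μp) S f := by
  rw [condO, mul_div_cancel₀ _ (nuR_pos hβ hμp S f).ne']

theorem condO_mono (hβ : 0 ≤ β) (hμp : IsPlusPhase β 0 μp) {S S' : Finset ℤ} (hS : (0 : ℤ) ∉ S)
    (hS' : (0 : ℤ) ∉ S') {f g : ℤ → Bool}
    (h : ∀ i ∈ S, i ∈ S' → f i ≤ g i) (h1 : ∀ i ∈ S, i ∉ S' → f i = false)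
    (h2 : ∀ i ∈ S', i ∉ S → g i = true) :
    condO (schonmann μp) S f ≤ condO (schonmann μp) S' g := by
  have := nuR_four hβ hμp fun a b ha hb => RowPat.origin_inf_sup hS hS' h h1 h2 ha hb
  rw [condO, condO, div_le_div_iff₀ (nuR_pos hβ hμp _ _) (nuR_pos hβ hμp _ _),
    mul_comm (nuO _ S' g)]
  exact this

theorem condO_extPast_mono (hβ : 0 ≤ β) (hμp : IsPlusPhase β 0 μp) (b : Bool) {k : ℕ} (n : ℕ)
    {x y : Fin k → Bool} (hxy : x ≤ y) :
    condO (schonmann μp) (pastBlock n) (extPast b (padPast x) k) ≤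
      condO (schonmann μp) (pastBlock n) (extPast b (padPast y) k) :=
  condO_mono hβ hμp (zero_notMem_pastBlock _) (zero_notMem_pastBlock _)
    (fun _ hi _ => extPast_padPast_mono b hxy (mem_pastBlock.mp hi).2) (fun _ hi hi' => absurd hi hi')
    fun _ hi hi' => absurd hi hi'

theorem influence_mono (hβ : 0 ≤ β) (hμp : IsPlusPhase β 0 μp) (k : ℕ) (ω : Past Bool) :
    Monotone fun N => influence (schonmann μp) k N ω := by
  intro N N' hN
  refine sub_le_sub ?_ ?_
  · refine condO_mono hβ hμp (zero_notMem_pastBlock _) (zero_notMem_pastBlock _)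
      (fun _ _ _ => le_rfl) (fun i hi hi' => ?_) fun i hi hi' => ?_
    · rw [mem_pastBlock] at hi hi'; omega
    · rw [mem_pastBlock] at hi hi'; rw [extPast, if_neg (by omega)]
  · refine condO_mono hβ hμp (zero_notMem_pastBlock _) (zero_notMem_pastBlock _)
      (fun _ _ _ => le_rfl) (fun i hi hi' => ?_) fun i hi hi' => ?_
    · rw [mem_pastBlock] at hi hi'; rw [extPast, if_neg (by omega)]
    · rw [mem_pastBlock] at hi hi'; omega

theorem influence_le_one (hμp : IsPlusPhase β 0 μp) (k N : ℕ) (ω : Past Bool) :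
    influence (schonmann μp) k N ω ≤ 1 := by
  have h1 := condO_mem_Icc hμp (zero_notMem_pastBlock (k + N)) (extPast true ω k)
  have h2 := condO_mem_Icc hμp (zero_notMem_pastBlock (k + N)) (extPast false ω k)
  rw [influence]
  linarith [h1.2, h2.1]

theorem abs_condO_sub_le (hβ : 0 ≤ β) (hμp : IsPlusPhase β 0 μp) {k n : ℕ} (hk : k ≤ n)
    {ω : Past Bool} {f g : ℤ → Bool} (hf : ∀ i : ℤ, -(k : ℤ) ≤ i → i ≤ -1 → f i = ω (i.natAbs - 1))
    (hg : ∀ i : ℤ, -(k : ℤ) ≤ i → i ≤ -1 → g i = ω (i.natAbs - 1)) :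
    |condO (schonmann μp) (pastBlock n) f - condO (schonmann μp) (pastBlock n) g| ≤
      influence (schonmann μp) k (n - k) ω := by
  have key : ∀ f : ℤ → Bool, (∀ i : ℤ, -(k : ℤ) ≤ i → i ≤ -1 → f i = ω (i.natAbs - 1)) →
      condO (schonmann μp) (pastBlock n) (extPast false ω k) ≤ condO (schonmann μp) (pastBlock n) f ∧
      condO (schonmann μp) (pastBlock n) f ≤
        condO (schonmann μp) (pastBlock n) (extPast true ω k) := by
    intro f hf
    constructor
    · refine condO_mono hβ hμp (zero_notMem_pastBlock _) (zero_notMem_pastBlock _)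
        (fun i hi _ => ?_) (fun _ hi hi' => absurd hi hi') fun _ hi hi' => absurd hi hi'
      rw [extPast]
      split_ifs with h
      · rw [hf i h (mem_pastBlock.mp hi).2]
      · exact Bool.false_le _
    · refine condO_mono hβ hμp (zero_notMem_pastBlock _) (zero_notMem_pastBlock _)
        (fun i hi _ => ?_) (fun _ hi hi' => absurd hi hi') fun _ hi hi' => absurd hi hi'
      rw [extPast]
      split_ifs with h
      · rw [hf i h (mem_pastBlock.mp hi).2]
      · exact Bool.le_true _
  have h1 := key f hf
  have h2 := key g hg
  rw [influence, Nat.add_sub_cancel' hk, abs_le]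
  constructor <;> linarith [h1.1, h1.2, h2.1, h2.2]

theorem sum_influence_le (hβ : 0 ≤ β) (hμp : IsPlusPhase β 0 μp) (k N : ℕ) :
    ∑ y : Fin k → Bool, nuR (schonmann μp) (pastBlock k) (extPast true (padPast y) k) *
        influence (schonmann μp) k N (padPast y) ≤
      nuO (schonmann μp) (farBlock k N) (fun _ => true) /
          nuR (schonmann μp) (farBlock k N) (fun _ => true) -
        nuO (schonmann μp) (farBlock k N) (fun _ => false) /
          nuR (schonmann μp) (farBlock k N) (fun _ => false) := by
  have := isProbabilityMeasure_schonmann hμp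
  set ν := schonmann μp with hν
  have hpos := nuR_pos hβ hμp
  have hR0 : ∀ S f, 0 ≤ nuR ν S f := fun S f => (hpos S f).le
  have hc0 : ∀ n f, 0 ≤ condO ν (pastBlock n) f := fun n f =>
    (condO_mem_Icc hμp (zero_notMem_pastBlock n) f).1
  have hagree : ∀ (b : Bool) (y : Fin k → Bool), nuR ν (pastBlock k) (extPast true (padPast y) k) =
      nuR ν (pastBlock k) (extPast b (padPast y) k) := fun b y => nuR_congr ν fun i hi => by
    rw [mem_pastBlock] at hi; rw [extPast, extPast, if_pos hi.1, if_pos hi.1]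
  have hone : ∑ y : Fin k → Bool, nuR ν (pastBlock k) (extPast true (padPast y) k) = 1 := by
    have h := sum_nuR_fiber ν (k := k) (T := ∅) (f := fun _ => true)
      (g := fun y => extPast true (padPast y) k) (S := pastBlock (k + 0)) fun y η => by
        rw [rowPat_extPast_padPast_iff]
        refine and_congr_right fun _ => ⟨fun _ => fun i hi => by simp at hi, fun _ => fun i hi => ?_⟩
        rw [mem_farBlock] at hi; push_cast at hi; omega
    have h' : nuR ν ∅ (fun _ => true) = 1 := by
      simp [nuR, RowPat]
    rw [h'] at h
    exact h
  have hfar : ∀ b, ∑ y : Fin k → Bool, nuR ν (pastBlock (k + N)) (extPast b (padPast y) k) =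
      nuR ν (farBlock k N) fun _ => b := fun b => sum_nuR_fiber ν (rowPat_extPast_padPast_iff b)
  have hfarO : ∀ b, ∑ y : Fin k → Bool, nuO ν (pastBlock (k + N)) (extPast b (padPast y) k) =
      nuO ν (farBlock k N) fun _ => b := fun b => sum_nuR_fiber ν fun y η => by
    rw [rowPat_origin (zero_notMem_pastBlock _), rowPat_origin (zero_notMem_farBlock _ _),
      rowPat_extPast_padPast_iff]
    tauto
  have hup : (∑ y : Fin k → Bool, nuR ν (pastBlock k) (extPast true (padPast y) k) *
      condO ν (pastBlock (k + N)) (extPast true (padPast y) k)) *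
      (∑ y : Fin k → Bool, nuR ν (pastBlock (k + N)) (extPast true (padPast y) k)) ≤
      (∑ y : Fin k → Bool, nuR ν (pastBlock k) (extPast true (padPast y) k)) *
      ∑ y : Fin k → Bool, nuO ν (pastBlock (k + N)) (extPast true (padPast y) k) := by
    refine four_functions_theorem_univ _ _ _ _ (fun y => mul_nonneg (hR0 _ _) (hc0 _ _))
      (fun y => hR0 _ _) (fun y => hR0 _ _) (fun y => hR0 _ _) fun x y => ?_
    rw [nuO_eq hβ hμp, mul_right_comm, ← mul_assoc]
    refine mul_le_mul (nuR_four hβ hμp fun a b ha hb => ?_)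
      (condO_extPast_mono hβ hμp true _ le_sup_left) (hc0 _ _) (mul_nonneg (hR0 _ _) (hR0 _ _))
    refine ⟨fun i hi => ?_, fun i hi => ?_⟩
    · have hi' := mem_pastBlock.mp hi
      rw [extPast_padPast_inf true x y hi'.2, Pi.inf_apply, Pi.inf_apply, ha i hi, hb i]
      rw [mem_pastBlock]; push_cast; omega
    · have hi' := mem_pastBlock.mp hi
      rw [extPast_padPast_sup true x y hi'.2, Pi.sup_apply, Pi.sup_apply, hb i hi]
      by_cases h : i ∈ pastBlock k
      · rw [ha i h]
      · have : ¬ -(k : ℤ) ≤ i := fun h' => h (mem_pastBlock.mpr ⟨h', hi'.2⟩)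
        simp [extPast, this]
  have hdown : (∑ y : Fin k → Bool, nuO ν (pastBlock (k + N)) (extPast false (padPast y) k)) *
      (∑ y : Fin k → Bool, nuR ν (pastBlock k) (extPast true (padPast y) k)) ≤
      (∑ y : Fin k → Bool, nuR ν (pastBlock (k + N)) (extPast false (padPast y) k)) *
      ∑ y : Fin k → Bool, nuR ν (pastBlock k) (extPast true (padPast y) k) *
        condO ν (pastBlock (k + N)) (extPast false (padPast y) k) := by
    refine four_functions_theorem_univ _ _ _ _ (fun y => hR0 _ _)
      (fun y => hR0 _ _) (fun y => hR0 _ _) (fun y => mul_nonneg (hR0 _ _) (hc0 _ _)) fun x y => ?_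
    rw [nuO_eq hβ hμp, mul_right_comm, ← mul_assoc, hagree false, hagree false (x ⊔ y)]
    refine mul_le_mul (nuR_four hβ hμp fun a b ha hb => ?_)
      (condO_extPast_mono hβ hμp false _ le_sup_left) (hc0 _ _) (mul_nonneg (hR0 _ _) (hR0 _ _))
    refine ⟨fun i hi => ?_, fun i hi => ?_⟩
    · have hi' := mem_pastBlock.mp hi
      rw [extPast_padPast_inf false x y hi'.2, Pi.inf_apply, Pi.inf_apply, ha i hi]
      by_cases h : i ∈ pastBlock k
      · rw [hb i h]
      · have : ¬ -(k : ℤ) ≤ i := fun h' => h (mem_pastBlock.mpr ⟨h', hi'.2⟩)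
        simp [extPast, this]
    · have hi' := mem_pastBlock.mp hi
      rw [extPast_padPast_sup false x y hi'.2, Pi.sup_apply, Pi.sup_apply, hb i hi, ha i]
      rw [mem_pastBlock]; push_cast; omega
  rw [hone, hfar, hfarO, one_mul] at hup
  rw [hone, hfar, hfarO, mul_one] at hdown
  simp only [influence, mul_sub, sum_sub_distrib]
  refine sub_le_sub ?_ ?_
  · rw [le_div_iff₀ (hpos _ _)]; exact hup
  · rw [div_le_iff₀ (hpos _ _), mul_comm]; exact hdown

/-- Total influence of the remote past on the origin, given the `k` most recent spins. -/
noncomputable def totalInfluence (ν : Measure (ZSeq Bool)) (k : ℕ) (y : Fin k → Bool) : ℝ :=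
  ⨆ N, influence ν k N (padPast y)

theorem bddAbove_influence (hμp : IsPlusPhase β 0 μp) (k : ℕ) (ω : Past Bool) :
    BddAbove (Set.range fun N => influence (schonmann μp) k N ω) :=
  ⟨1, by rintro _ ⟨N, rfl⟩; exact influence_le_one hμp k N ω⟩

theorem influence_le_totalInfluence (hμp : IsPlusPhase β 0 μp) (k N : ℕ) (ω : Past Bool) :
    influence (schonmann μp) k N ω ≤ totalInfluence (schonmann μp) k (recent k ω) := by
  rw [influence_congr _ N fun j hj => (padPast_recent ω hj).symm]
  exact le_ciSup (bddAbove_influence hμp k (padPast (recent k ω))) N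

theorem totalInfluence_le_one (hμp : IsPlusPhase β 0 μp) (k : ℕ) (y : Fin k → Bool) :
    totalInfluence (schonmann μp) k y ≤ 1 :=
  ciSup_le fun N => influence_le_one hμp k N _

theorem totalInfluence_nonneg (hβ : 0 ≤ β) (hμp : IsPlusPhase β 0 μp) (k : ℕ) (y : Fin k → Bool) :
    0 ≤ totalInfluence (schonmann μp) k y := by
  refine le_trans ?_ (le_ciSup (bddAbove_influence hμp k (padPast y)) 0)
  have h := abs_condO_sub_le hβ hμp (le_refl k) (ω := padPast y) (f := extPast true (padPast y) k)
    (g := extPast true (padPast y) k) (fun i hi _ => if_pos hi) fun i hi _ => if_pos hi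
  rw [Nat.sub_self] at h
  exact (abs_nonneg _).trans h

theorem exists_sum_totalInfluence_le (hβ : betaCrit < β) (hμp : IsPlusPhase β 0 μp) :
    ∃ C lam : ℝ, 0 ≤ C ∧ 1 < lam ∧ ∀ k,
      ∑ y : Fin k → Bool, totalInfluence (schonmann μp) k y *
        nuR (schonmann μp) (pastBlock k) (extPast true (padPast y) k) ≤ C * lam⁻¹ ^ k := by
  have h0 : 0 ≤ β := (betaCrit_pos.trans hβ).le
  obtain ⟨C, lam, hC, hlam, H⟩ := exists_influence_le hβ hμp
  refine ⟨C, lam, hC, hlam, fun k => ?_⟩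
  refine le_of_tendsto' (tendsto_finsetSum univ fun y _ => (tendsto_atTop_ciSup
    (influence_mono h0 hμp k (padPast y)) (bddAbove_influence hμp k (padPast y))).mul_const _)
    fun N => ?_
  refine le_trans (le_of_eq ?_) ((sum_influence_le h0 hμp k N).trans (H k N))
  exact sum_congr rfl fun y _ => mul_comm _ _

theorem ae_summable_totalInfluence (hβ : betaCrit < β) (hμp : IsPlusPhase β 0 μp) :
    ∀ᵐ ω ∂((schonmann μp).map restrictPast),
      Summable fun k => totalInfluence (schonmann μp) k (recent k ω) := by
  have := isProbabilityMeasure_schonmann hμp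
  have h0 : 0 ≤ β := (betaCrit_pos.trans hβ).le
  obtain ⟨C, lam, hC, hlam, H⟩ := exists_sum_totalInfluence_le hβ hμp
  have hrestr : Measurable (restrictPast : ZSeq Bool → Past Bool) :=
    measurable_pi_lambda _ fun _ => measurable_pi_apply _
  have hrec : ∀ k, Measurable (recent k) := fun k =>
    measurable_pi_lambda _ fun _ => measurable_pi_apply _
  have hmeas : ∀ k, Measurable fun ω : Past Bool =>
      ENNReal.ofReal (totalInfluence (schonmann μp) k (recent k ω)) := fun k =>
    (measurable_of_finite fun y => ENNReal.ofReal (totalInfluence (schonmann μp) k y)).comp (hrec k)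
  have hint : ∀ k, ∫⁻ ω, ENNReal.ofReal (totalInfluence (schonmann μp) k (recent k ω))
      ∂((schonmann μp).map restrictPast) ≤ ENNReal.ofReal (C * lam⁻¹ ^ k) := by
    intro k
    rw [← lintegral_map (f := fun y => ENNReal.ofReal (totalInfluence (schonmann μp) k y))
      (measurable_of_finite _) (hrec k), lintegral_fintype, Measure.map_map (hrec k) hrestr]
    refine le_trans (le_of_eq ?_) (ENNReal.ofReal_le_ofReal (H k))
    rw [ENNReal.ofReal_sum_of_nonneg fun y _ => mul_nonneg (totalInfluence_nonneg h0 hμp k y)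
      (nuR_pos h0 hμp _ _).le]
    refine sum_congr rfl fun y _ => ?_
    rw [ENNReal.ofReal_mul (totalInfluence_nonneg h0 hμp k y), nuR,
      ENNReal.ofReal_toReal (measure_ne_top _ _), Measure.map_apply ((hrec k).comp hrestr)
      (measurableSet_singleton y)]
    congr 2
    ext η
    have h1 := rowPat_extPast_padPast_iff (N := 0) true y η
    have h2 : RowPat (farBlock k 0) (fun _ => true) η := fun i hi => by
      rw [mem_farBlock] at hi; push_cast at hi; omega
    exact ⟨fun h => h1.mpr ⟨h, h2⟩, fun h => (h1.mp h).1⟩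
  have hfin : ∫⁻ ω, ∑' k, ENNReal.ofReal (totalInfluence (schonmann μp) k (recent k ω))
      ∂((schonmann μp).map restrictPast) ≠ ⊤ := by
    rw [lintegral_tsum fun k => (hmeas k).aemeasurable]
    refine ne_top_of_le_ne_top ?_ (ENNReal.tsum_le_tsum hint)
    have hs : Summable fun k : ℕ => C * lam⁻¹ ^ k :=
      (summable_geometric_of_lt_one (by positivity) (inv_lt_one_of_one_lt₀ hlam)).mul_left C
    exact hs.tsum_ofReal_ne_top
  filter_upwards [ae_lt_top (Measurable.tsum hmeas) hfin] with ω hω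
  refine (ENNReal.summable_toReal hω.ne).congr fun k => ?_
  exact ENNReal.toReal_ofReal (totalInfluence_nonneg h0 hμp k _)

theorem pastEvt_eq (n l : ℕ) (b : Bool) (ω : Past Bool) :
    pastEvt n l b ω = {η | RowPat (pastBlock (n + l)) (extPast b ω n) η} := by
  ext η
  constructor
  · rintro ⟨h1, h2⟩ i hi
    rw [mem_pastBlock] at hi
    push_cast at hi
    rw [extPast]
    split_ifs with h
    · exact h1 i h hi.2
    · exact h2 i (by omega) (by omega)
  · intro h
    refine ⟨fun i hi hi' => ?_, fun i hi hi' => ?_⟩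
    · rw [h i (by rw [mem_pastBlock]; push_cast; omega), extPast, if_pos hi]
    · rw [h i (by rw [mem_pastBlock]; push_cast; omega), extPast, if_neg (by omega)]

theorem condProbR_pastEvt_true (n l : ℕ) (b : Bool) (ω : Past Bool) :
    condProbR (schonmann μp) {η | η 0 = true} (pastEvt n l b ω) =
      condO (schonmann μp) (pastBlock (n + l)) (extPast b ω n) := by
  rw [condProbR, pastEvt_eq, ProbabilityTheory.cond_apply (measurableSet_rowPat _ _),
    ENNReal.toReal_mul, ENNReal.toReal_inv, condO, div_eq_inv_mul, nuO, nuR, nuR]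
  congr 3
  ext η
  rw [Set.mem_inter_iff, and_comm]
  exact (rowPat_origin (zero_notMem_pastBlock _) _ η).symm

theorem condProbR_pastEvt_false (hβ : 0 ≤ β) (hμp : IsPlusPhase β 0 μp) (n l : ℕ) (b : Bool)
    (ω : Past Bool) :
    condProbR (schonmann μp) {η | η 0 = false} (pastEvt n l b ω) =
      1 - condO (schonmann μp) (pastBlock (n + l)) (extPast b ω n) := by
  have := isProbabilityMeasure_schonmann hμp
  rw [← condProbR_pastEvt_true, condProbR, condProbR]
  have hne : schonmann μp (pastEvt n l b ω) ≠ 0 := by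
    intro h
    have := nuR_pos hβ hμp (pastBlock (n + l)) (extPast b ω n)
    rw [nuR, ← pastEvt_eq, h] at this
    simp at this
  have := ProbabilityTheory.cond_isProbabilityMeasure hne
  have hm : MeasurableSet {η : ZSeq Bool | η 0 = true} :=
    (measurable_pi_apply 0 : Measurable fun η : ZSeq Bool => η 0) (MeasurableSet.singleton true)
  have hc : {η : ZSeq Bool | η 0 = false} = {η : ZSeq Bool | η 0 = true}ᶜ := by
    ext η; simp
  rw [hc]
  rw [prob_compl_eq_one_sub hm, ENNReal.toReal_sub_of_le prob_le_one ENNReal.one_ne_top, ENNReal.toReal_one]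

theorem abs_condG_sub_le (hβ : 0 ≤ β) (hμp : IsPlusPhase β 0 μp) {P : Bool → Past Bool → ℝ}
    (hP : IsCondG (schonmann μp) true P) (a : Bool) (σ τ ω : Past Bool) (k : ℕ) :
    |P a (splice σ ω k) - P a (splice τ ω k)| ≤
      totalInfluence (schonmann μp) k (recent k ω) := by
  obtain ⟨L, hL, hLP⟩ := hP a (splice σ ω k)
  obtain ⟨L', hL', hLP'⟩ := hP a (splice τ ω k)
  refine le_of_tendsto (hLP.sub hLP').abs ?_
  filter_upwards [eventually_ge_atTop k] with n hn
  refine le_of_tendsto' ((hL n).sub (hL' n)).abs fun l => ?_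
  have hsp : ∀ (σ : Past Bool) (i : ℤ), -(k : ℤ) ≤ i → i ≤ -1 →
      extPast true (splice σ ω k) n i = ω (i.natAbs - 1) := by
    intro σ i h1 h2
    rw [extPast, if_pos (by omega), splice, if_pos (by omega)]
  have h := (abs_condO_sub_le hβ hμp (by omega : k ≤ n + l) (hsp σ) (hsp τ)).trans
    (influence_le_totalInfluence hμp k _ ω)
  cases a
  · rw [condProbR_pastEvt_false hβ hμp, condProbR_pastEvt_false hβ hμp, sub_sub_sub_cancel_left,
      abs_sub_comm]
    exact h
  · rw [condProbR_pastEvt_true, condProbR_pastEvt_true]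
    exact h

end

end Schonmann

/-- For `h = 0`, `β > β_c` and `P` the g-function `P_{β,0}^{+,+}` from the main
theorem, for all pasts `σ, τ` and `ν_{β,0}^+`-almost every past `ω`,
`∑_k ∑_a |P(a|σ_{-∞}^{-(k+1)}ω_{-k}^{-1}) − P(a|τ_{-∞}^{-(k+1)}ω_{-k}^{-1})|² < ∞`. -/
theorem schonmann_square_summable_variation_along_ae_past
    (β : ℝ) (hβ : betaCrit < β) (μp : Measure Cfg2) (hμp : IsPlusPhase β 0 μp)
    (P : Bool → Past Bool → ℝ) (hP : IsCondG (schonmann μp) true P)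
    (σ τ : Past Bool) :
    ∀ᵐ ω ∂((schonmann μp).map restrictPast),
      Summable (fun k : ℕ =>
        ∑ a : Bool, |P a (splice σ ω k) - P a (splice τ ω k)| ^ 2) := by
  have h0 : 0 ≤ β := (Schonmann.betaCrit_pos.trans hβ).le
  filter_upwards [Schonmann.ae_summable_totalInfluence hβ hμp] with ω hω
  refine Summable.of_nonneg_of_le (fun k => Finset.sum_nonneg fun a _ => sq_nonneg _) (fun k => ?_)
    (hω.mul_left 2)
  have h1 := Schonmann.totalInfluence_nonneg h0 hμp k (Schonmann.recent k ω)
  have h2 := Schonmann.totalInfluence_le_one hμp k (Schonmann.recent k ω)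
  have h3 : ∀ a, |P a (splice σ ω k) - P a (splice τ ω k)| ^ 2 ≤
      Schonmann.totalInfluence (schonmann μp) k (Schonmann.recent k ω) := fun a =>
    (pow_le_pow_left₀ (abs_nonneg _)
      (Schonmann.abs_condG_sub_le h0 hμp hP a σ τ ω k) 2).trans (by nlinarith)
  rw [Fintype.sum_bool]
  linarith [h3 true, h3 false]
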